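/- Inhomogeneous Strichartz estimate for the von-Neumann Schrödinger equation: let (k,ℓ) and (k̃,ℓ̃) be admissible pairs, i.e. in (2,∞]×[2,∞] with 2/k + 1/ℓ = 1/2 and 2/k̃ + 1/ℓ̃ = 1/2, and let (k̃',ℓ̃') be the Hölder conjugates of (k̃,ℓ̃). Then there is a constant C such that for all Schwartz Γ₀ and F, the Duhamel solution Γ of 𝐒_±Γ = F with Γ(0)=Γ₀ satisfies both ‖Γ‖_{L^k(dt)L^ℓ(dx)L²(dy)} ≤ C(‖Γ₀‖_{L²} + ‖F‖_{L^{k̃'}(dt)L^{ℓ̃'}(dx)L²(dy)}) and, for any σ ≥ 0, ‖|∇_{x,y}|^σ Γ‖_{L^k(dt)L^ℓ(dx)L²(dy)} ≤ C(‖|∇_{x,y}|^σ Γ₀‖_{L²} + ‖|∇_{x,y}|^σ F‖_{L^{k̃'}(dt)L^{ℓ̃'}(dx)L²(dy)}). -/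

import Mathlib

open MeasureTheory Complex SchwartzMap
open scoped ENNReal NNReal Real

noncomputable section

/-- 1D Fourier transform with the convention `f̂ ξ = ∫ e^{-iξx} f x dx`. -/
def FT1 (f : ℝ → ℂ) (ξ : ℝ) : ℂ :=
  ∫ x : ℝ, Complex.exp (-(Complex.I) * (ξ : ℂ) * (x : ℂ)) * f x

/-- 1D inverse Fourier transform. -/
def IFT1 (g : ℝ → ℂ) (x : ℝ) : ℂ :=
  (2 * (Real.pi : ℂ))⁻¹ * ∫ ξ : ℝ, Complex.exp (Complex.I * (ξ : ℂ) * (x : ℂ)) * g ξ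

/-- 2D Fourier transform (curried kernels). -/
def FT2 (f : ℝ → ℝ → ℂ) (ξ η : ℝ) : ℂ :=
  ∫ x : ℝ, ∫ y : ℝ, Complex.exp (-(Complex.I) * ((ξ : ℂ) * x + (η : ℂ) * y)) * f x y

/-- 2D inverse Fourier transform. -/
def IFT2 (g : ℝ → ℝ → ℂ) (x y : ℝ) : ℂ :=
  ((2 * (Real.pi : ℂ)) ^ 2)⁻¹ *
    ∫ ξ : ℝ, ∫ η : ℝ, Complex.exp (Complex.I * ((ξ : ℂ) * x + (η : ℂ) * y)) * g ξ η

/-- Free propagator `e^{it(Δ_x − Δ_y)}`, Fourier multiplier `e^{it(η²−ξ²)}`. -/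
def freeGamma (Γ₀ : ℝ → ℝ → ℂ) (t x y : ℝ) : ℂ :=
  IFT2 (fun ξ η => Complex.exp (Complex.I * (t : ℂ) * ((η : ℂ) ^ 2 - (ξ : ℂ) ^ 2)) * FT2 Γ₀ ξ η) x y

/-- Free propagator `e^{it(Δ_x + Δ_y)}`, Fourier multiplier `e^{−it(ξ²+η²)}`. -/
def freeLambda (Λ₀ : ℝ → ℝ → ℂ) (t x y : ℝ) : ℂ :=
  IFT2 (fun ξ η => Complex.exp (-(Complex.I) * (t : ℂ) * ((ξ : ℂ) ^ 2 + (η : ℂ) ^ 2)) * FT2 Λ₀ ξ η) x y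

/-- `|∇_x|^s`, Fourier multiplier `|ξ|^s` in one variable. -/
def absDx (s : ℝ) (f : ℝ → ℂ) (x : ℝ) : ℂ :=
  IFT1 (fun ξ => ((|ξ| ^ s : ℝ) : ℂ) * FT1 f ξ) x

/-- `|∇_{x,y}|^s`, Fourier multiplier `(ξ²+η²)^{s/2}` on `ℝ²`. -/
def absDxy (s : ℝ) (f : ℝ → ℝ → ℂ) (x y : ℝ) : ℂ :=
  IFT2 (fun ξ η => (((ξ ^ 2 + η ^ 2) ^ (s / 2) : ℝ) : ℂ) * FT2 f ξ η) x y

/-- `|∇_{x+y}|^s`, Fourier multiplier `(|ξ+η|/2)^s` on `ℝ²`. -/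
def absDxpy (s : ℝ) (f : ℝ → ℝ → ℂ) (x y : ℝ) : ℂ :=
  IFT2 (fun ξ η => (((|ξ + η| / 2) ^ s : ℝ) : ℂ) * FT2 f ξ η) x y

/-- `⟨∇_x⟩^s`, Fourier multiplier `(1+ξ²)^{s/2}` in one variable. -/
def japDx (s : ℝ) (f : ℝ → ℂ) (x : ℝ) : ℂ :=
  IFT1 (fun ξ => (((1 + ξ ^ 2) ^ (s / 2) : ℝ) : ℂ) * FT1 f ξ) x

/-- `⟨∇_{x,y}⟩^s`, Fourier multiplier `(1+ξ²+η²)^{s/2}` on `ℝ²`. -/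
def japDxy (s : ℝ) (f : ℝ → ℝ → ℂ) (x y : ℝ) : ℂ :=
  IFT2 (fun ξ η => (((1 + ξ ^ 2 + η ^ 2) ^ (s / 2) : ℝ) : ℂ) * FT2 f ξ η) x y

/-- `L²` norm of a kernel on `ℝ²`. -/
def L2K (f : ℝ → ℝ → ℂ) : ℝ≥0∞ :=
  eLpNorm (fun p : ℝ × ℝ => f p.1 p.2) 2 volume

/-- `L²` norm on `ℝ`. -/
def L2F (f : ℝ → ℂ) : ℝ≥0∞ := eLpNorm f 2 volume

/-- Mixed norm `L^q(μ(dt)) L^r(dx)` for a function of `(t,x)`. -/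
def MixedN2 (μ : Measure ℝ) (q r : ℝ≥0∞) (u : ℝ → ℝ → ℂ) : ℝ≥0∞ :=
  eLpNorm (fun t => (eLpNorm (u t) r volume).toReal) q μ

/-- Mixed norm `L^q(μ(dt)) L^r(dx) L^s(dy)` for a function of `(t,x,y)`. -/
def MixedN3 (μ : Measure ℝ) (q r s : ℝ≥0∞) (u : ℝ → ℝ → ℝ → ℂ) : ℝ≥0∞ :=
  eLpNorm (fun t => (eLpNorm (fun x => (eLpNorm (u t x) s volume).toReal) r volume).toReal) q μ

/-- Spacetime Fourier transform on `ℝ_t × ℝ_x`. -/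
def FTtx (u : ℝ → ℝ → ℂ) (τ ξ : ℝ) : ℂ :=
  ∫ t : ℝ, ∫ x : ℝ, Complex.exp (-(Complex.I) * ((τ : ℂ) * t + (ξ : ℂ) * x)) * u t x

/-- Spacetime Fourier transform on `ℝ_t × ℝ²`. -/
def FTtxy (u : ℝ → ℝ → ℝ → ℂ) (τ ξ η : ℝ) : ℂ :=
  ∫ t : ℝ, ∫ x : ℝ, ∫ y : ℝ,
    Complex.exp (-(Complex.I) * ((τ : ℂ) * t + (ξ : ℂ) * x + (η : ℂ) * y)) * u t x y

/-- Bourgain space norm `X^b` associated to `𝐒 = (1/i)∂_t − Δ_x − Δ_y`. -/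
def XbNorm (b : ℝ) (u : ℝ → ℝ → ℝ → ℂ) : ℝ≥0∞ :=
  eLpNorm (fun p : ℝ × ℝ × ℝ =>
    (((1 + |p.1 + p.2.1 ^ 2 + p.2.2 ^ 2|) ^ b : ℝ) : ℂ) * FTtxy u p.1 p.2.1 p.2.2) 2 volume

/-- Duhamel solution of `𝐒_± Γ = F` with data `Γ₀`. -/
def duhamelGamma (Γ₀ : ℝ → ℝ → ℂ) (F : ℝ → ℝ → ℝ → ℂ) (t x y : ℝ) : ℂ :=
  freeGamma Γ₀ t x y + Complex.I * ∫ s in (0:ℝ)..t, freeGamma (F s) (t - s) x y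

/-- Duhamel solution of `𝐒 Λ = F` with data `Λ₀`. -/
def duhamelLambda (Λ₀ : ℝ → ℝ → ℂ) (F : ℝ → ℝ → ℝ → ℂ) (t x y : ℝ) : ℂ :=
  freeLambda Λ₀ t x y + Complex.I * ∫ s in (0:ℝ)..t, freeLambda (F s) (t - s) x y

/-! ### The unimodular phase and the one-dimensional Plancherel identity -/

/-- The unimodular phase `e^{ix}`. -/
def phase (x : ℝ) : ℂ := Complex.exp (x * Complex.I)

@[simp] lemma norm_phase (x : ℝ) : ‖phase x‖ = 1 := Complex.norm_exp_ofReal_mul_I x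

@[simp] lemma enorm_phase (x : ℝ) : ‖phase x‖ₑ = 1 := by
  rw [← ofReal_norm, norm_phase, ENNReal.ofReal_one]

lemma phase_add (x y : ℝ) : phase (x + y) = phase x * phase y := by
  simp [phase, ← Complex.exp_add, add_mul]

lemma conj_phase (x : ℝ) : (starRingEnd ℂ) (phase x) = phase (-x) := by
  simp [phase, ← Complex.exp_conj]

@[fun_prop] lemma continuous_phase : Continuous phase := by
  unfold phase; fun_prop

@[fun_prop] lemma measurable_phase : Measurable phase := continuous_phase.measurable

/-- Unnormalised inverse Fourier integral. -/
def invFI (f : ℝ → ℂ) (x : ℝ) : ℂ := ∫ ξ, phase (ξ * x) * f ξ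

lemma invFI_eq_fourier (f : ℝ → ℂ) (x : ℝ) :
    invFI f x = FourierTransform.fourier f ((-(2 * π)⁻¹) * x) := by
  rw [Real.fourier_real_eq_integral_exp_smul]
  unfold invFI phase
  congr 1; ext ξ
  rw [smul_eq_mul]
  congr 2
  have : (π : ℂ) ≠ 0 := by exact_mod_cast Real.pi_ne_zero
  push_cast
  field_simp

lemma fourier_ae_eq_Lp (f : ℝ → ℂ) (h1 : Integrable f) (h2 : MemLp f 2) :
    (FourierTransform.fourier f : ℝ → ℂ) =ᵐ[volume]
      (FourierTransform.fourier (h2.toLp f) : Lp ℂ 2 (volume : Measure ℝ)) := by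
  apply ae_eq_of_integral_contDiff_smul_eq
  · apply Continuous.locallyIntegrable
    exact VectorFourier.fourierIntegral_continuous Real.continuous_fourierChar
      (by fun_prop) h1
  · exact (Lp.memLp _).locallyIntegrable (by norm_num)
  intro g hg hc
  have hg₁ : HasCompactSupport (Complex.ofRealCLM ∘ g) := hc.comp_left rfl
  have hg₂ : ContDiff ℝ ((⊤ : ℕ∞) : WithTop ℕ∞) (Complex.ofRealCLM ∘ g) :=
    Complex.ofRealCLM.contDiff.comp hg
  set φ : 𝓢(ℝ, ℂ) := hg₁.toSchwartzMap hg₂ with hφ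
  have hφa : ∀ x, φ x = (g x : ℂ) := fun x => by simp [hφ]
  have e1 : ∫ x, g x • (FourierTransform.fourier (h2.toLp f) : Lp ℂ 2 (volume : Measure ℝ)) x
      = ∫ x, (FourierTransform.fourier φ) x • f x := by
    have := congrArg (fun T : 𝓢'(ℝ, ℂ) => T φ) (Lp.fourier_toTemperedDistribution_eq (h2.toLp f))
    simp only [TemperedDistribution.fourier_apply, Lp.toTemperedDistribution_apply, hφa] at this
    rw [show (fun x => g x • (FourierTransform.fourier (h2.toLp f) : Lp ℂ 2 (volume : Measure ℝ)) x)
      = fun x => (g x : ℂ) • (FourierTransform.fourier (h2.toLp f) : Lp ℂ 2 (volume : Measure ℝ)) x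
      from by ext x; simp, ← this]
    apply integral_congr_ae
    filter_upwards [h2.coeFn_toLp] with x hx
    rw [hx]
  rw [e1]
  have e2 := VectorFourier.integral_fourierIntegral_smul_eq_flip (μ := (volume : Measure ℝ))
    (ν := (volume : Measure ℝ)) (L := innerₗ ℝ) (f := φ) (g := f) Real.continuous_fourierChar
    (by fun_prop) φ.integrable h1
  rw [SchwartzMap.fourier_coe]
  have e3 : (innerₗ ℝ : ℝ →ₗ[ℝ] ℝ →ₗ[ℝ] ℝ).flip = innerₗ ℝ := by
    ext; simp
  rw [e3] at e2
  refine Eq.trans ?_ e2.symm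
  congr 1

lemma lintegral_comp_mul_left' (a : ℝ) (ha : a ≠ 0) (g : ℝ → ℝ≥0∞) (hg : Measurable g) :
    ∫⁻ x, g (a * x) = ENNReal.ofReal |a⁻¹| * ∫⁻ x, g x := by
  rw [← lintegral_map (f := g) (g := fun x => a * x) hg (by fun_prop),
    Real.map_volume_mul_left ha, lintegral_smul_measure]
  rfl

lemma continuous_invFI {f : ℝ → ℂ} (h1 : Integrable f) : Continuous (invFI f) := by
  have : Continuous (FourierTransform.fourier f) :=
    VectorFourier.fourierIntegral_continuous Real.continuous_fourierChar (by fun_prop) h1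
  have e : invFI f = fun x => FourierTransform.fourier f ((-(2 * π)⁻¹) * x) :=
    funext (invFI_eq_fourier f)
  rw [e]
  fun_prop

theorem lintegral_invFI_sq (f : ℝ → ℂ) (h1 : Integrable f) (h2 : MemLp f 2) :
    ∫⁻ x, ‖invFI f x‖ₑ ^ 2 = ENNReal.ofReal (2 * π) * ∫⁻ ξ, ‖f ξ‖ₑ ^ 2 := by
  have hc : Continuous (FourierTransform.fourier f) :=
    VectorFourier.fourierIntegral_continuous Real.continuous_fourierChar (by fun_prop) h1
  simp_rw [invFI_eq_fourier]
  rw [lintegral_comp_mul_left' (-(2 * π)⁻¹) (by simp [Real.pi_ne_zero])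
    (fun x => ‖FourierTransform.fourier f x‖ₑ ^ 2) (by fun_prop)]
  have e1 : |(-(2 * π)⁻¹)⁻¹| = 2 * π := by
    rw [inv_neg, inv_inv, abs_neg, abs_of_pos (by positivity)]
  rw [e1]
  congr 1
  have key : eLpNorm (FourierTransform.fourier f : ℝ → ℂ) 2 volume = eLpNorm f 2 volume := by
    rw [eLpNorm_congr_ae (fourier_ae_eq_Lp f h1 h2), ← eLpNorm_congr_ae h2.coeFn_toLp,
      ← Lp.enorm_def, ← Lp.enorm_def, ← ofReal_norm, ← ofReal_norm,
      Lp.norm_fourier_eq]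
  have sq : ∀ u : ℝ → ℂ, ∫⁻ x, ‖u x‖ₑ ^ 2 = eLpNorm u 2 volume ^ 2 := fun u => by
    rw [eLpNorm_eq_lintegral_rpow_enorm_toReal (by norm_num) (by norm_num)]
    rw [← ENNReal.rpow_natCast, ← ENNReal.rpow_mul]
    norm_num
  rw [sq, sq, key]

theorem integral_invFI_mul_conj (f g : ℝ → ℂ) (hf1 : Integrable f) (hf2 : MemLp f 2)
    (hg1 : Integrable g) (hg2 : MemLp g 2) :
    ∫ x, invFI f x * (starRingEnd ℂ) (invFI g x) = 2 * π * ∫ ξ, f ξ * (starRingEnd ℂ) (g ξ) := by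
  simp_rw [invFI_eq_fourier]
  rw [Measure.integral_comp_mul_left (fun x => FourierTransform.fourier f x *
    (starRingEnd ℂ) (FourierTransform.fourier g x))]
  have e1 : |(-(2 * π)⁻¹)⁻¹| = 2 * π := by
    rw [inv_neg, inv_inv, abs_neg, abs_of_pos (by positivity)]
  rw [e1]
  have key := Lp.inner_fourier_eq (hg2.toLp g) (hf2.toLp f)
  rw [L2.inner_def, L2.inner_def] at key
  have l : ∫ x, FourierTransform.fourier f x * (starRingEnd ℂ) (FourierTransform.fourier g x)
     = ∫ ξ, f ξ * (starRingEnd ℂ) (g ξ) := by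
    refine Eq.trans (integral_congr_ae ?_) (key.trans (integral_congr_ae ?_))
    · filter_upwards [fourier_ae_eq_Lp f hf1 hf2, fourier_ae_eq_Lp g hg1 hg2] with x h1 h2
      rw [h1, h2]; simp
    · filter_upwards [hf2.coeFn_toLp, hg2.coeFn_toLp] with x h1 h2
      rw [h1, h2]; simp
  rw [l]
  simp

/-! ### Hardy–Littlewood–Sobolev inequality with kernel `|t|^{-1/2}` -/

/-- The kernel `|τ|^{-1/2}` with values in `[0, ∞]`. -/
def rieszK (τ : ℝ) : ℝ≥0∞ := ENNReal.ofReal (|τ| ^ (-(1 / 2) : ℝ))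

@[fun_prop] lemma measurable_rieszK : Measurable rieszK := by
  unfold rieszK; fun_prop

lemma rieszK_neg (τ : ℝ) : rieszK (-τ) = rieszK τ := by simp [rieszK]

lemma lintegral_rieszK_Ioc (r : ℝ) (hr : 0 < r) :
    ∫⁻ τ in Set.Ioc 0 r, rieszK τ = 2 * ENNReal.ofReal r ^ (1 / 2 : ℝ) := by
  have h1 : ∫⁻ τ in Set.Ioc 0 r, rieszK τ
      = ∫⁻ τ in Set.Ioc 0 r, ENNReal.ofReal (τ ^ (-(1 / 2) : ℝ)) := by
    refine setLIntegral_congr_fun measurableSet_Ioc fun τ hτ => ?_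
    rw [rieszK, abs_of_pos hτ.1]
  have hi : IntegrableOn (fun τ : ℝ => τ ^ (-(1 / 2) : ℝ)) (Set.Ioc 0 r) := by
    have := intervalIntegral.intervalIntegrable_rpow' (a := 0) (b := r) (r := -(1 / 2))
      (by norm_num)
    rwa [intervalIntegrable_iff_integrableOn_Ioc_of_le hr.le] at this
  rw [h1, ← ofReal_integral_eq_lintegral_ofReal hi]
  · rw [← intervalIntegral.integral_of_le hr.le, integral_rpow (Or.inl (by norm_num)),
      ENNReal.ofReal_rpow_of_pos hr]
    rw [show (2 : ℝ≥0∞) = ENNReal.ofReal 2 by simp, ← ENNReal.ofReal_mul (by norm_num)]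
    congr 1
    norm_num
    ring
  · filter_upwards [ae_restrict_mem measurableSet_Ioc] with τ hτ
    exact Real.rpow_nonneg hτ.1.le _

lemma lintegral_rieszK_Icc (r : ℝ) (hr : 0 < r) :
    ∫⁻ τ in Set.Icc (-r) r, rieszK τ ≤ 4 * ENNReal.ofReal r ^ (1 / 2 : ℝ) := by
  have hsub : Set.Icc (-r) r ⊆ {0} ∪ (Set.Ioc 0 r ∪ Set.Ico (-r) 0) := by
    intro x hx
    rcases lt_trichotomy x 0 with h | h | h
    · exact Or.inr (Or.inr ⟨hx.1, h⟩)
    · exact Or.inl h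
    · exact Or.inr (Or.inl ⟨h, hx.2⟩)
  have hneg : ∫⁻ τ in Set.Ico (-r) 0, rieszK τ = ∫⁻ τ in Set.Ioc 0 r, rieszK τ := by
    rw [← lintegral_indicator measurableSet_Ico, ← lintegral_indicator measurableSet_Ioc,
      ← lintegral_neg_eq_self]
    congr 1; ext x
    have : (-x ∈ Set.Ico (-r) 0) ↔ x ∈ Set.Ioc 0 r := by
      simp only [Set.mem_Ico, Set.mem_Ioc]; constructor <;> intro h <;> constructor <;> linarith [h.1, h.2]
    simp only [Set.indicator_apply, this, rieszK_neg]
  calc ∫⁻ τ in Set.Icc (-r) r, rieszK τ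
      ≤ ∫⁻ τ in {0} ∪ (Set.Ioc 0 r ∪ Set.Ico (-r) 0), rieszK τ := lintegral_mono_set hsub
    _ ≤ (∫⁻ τ in {0}, rieszK τ) + ((∫⁻ τ in Set.Ioc 0 r, rieszK τ) +
          ∫⁻ τ in Set.Ico (-r) 0, rieszK τ) :=
        (lintegral_union_le _ _ _).trans (add_le_add le_rfl (lintegral_union_le _ _ _))
    _ = 4 * ENNReal.ofReal r ^ (1 / 2 : ℝ) := by
        rw [hneg, lintegral_rieszK_Ioc r hr, Measure.restrict_singleton]
        simp
        ring

lemma setLIntegral_rieszK_le (E : Set ℝ) (s : ℝ) :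
    ∫⁻ t in E, rieszK (t - s) ≤ 5 * volume E ^ (1 / 2 : ℝ) := by
  rcases eq_or_ne (volume E) ∞ with h | h
  · rw [h]; simp
  rcases eq_or_ne (volume E) 0 with h0 | h0
  · rw [Measure.restrict_eq_zero.2 h0]; simp
  set r := (volume E).toReal with hr
  have hrpos : 0 < r := ENNReal.toReal_pos h0 h
  have hv : volume E = ENNReal.ofReal r := (ENNReal.ofReal_toReal h).symm
  have pt : ∀ t, rieszK (t - s) ≤ (Set.Icc (-r) r).indicator rieszK (t - s)
      + ENNReal.ofReal (r ^ (-(1 / 2) : ℝ)) := by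
    intro t
    by_cases ht : t - s ∈ Set.Icc (-r) r
    · rw [Set.indicator_of_mem ht]; exact le_self_add
    · rw [Set.indicator_of_notMem ht, zero_add]
      refine ENNReal.ofReal_le_ofReal ?_
      have : r < |t - s| := by
        rw [Set.mem_Icc, ← abs_le] at ht
        exact not_le.1 ht
      exact Real.rpow_le_rpow_of_nonpos hrpos this.le (by norm_num)
  calc ∫⁻ t in E, rieszK (t - s)
      ≤ ∫⁻ t in E, ((Set.Icc (-r) r).indicator rieszK (t - s)
        + ENNReal.ofReal (r ^ (-(1 / 2) : ℝ))) := lintegral_mono pt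
    _ = (∫⁻ t in E, (Set.Icc (-r) r).indicator rieszK (t - s))
        + ENNReal.ofReal (r ^ (-(1 / 2) : ℝ)) * volume E := by
        rw [lintegral_add_right _ measurable_const, setLIntegral_const]
    _ ≤ 4 * ENNReal.ofReal r ^ (1 / 2 : ℝ) + ENNReal.ofReal r ^ (1 / 2 : ℝ) := by
        refine add_le_add ?_ ?_
        · refine (setLIntegral_le_lintegral _ _).trans ?_
          rw [lintegral_sub_right_eq_self (fun τ => (Set.Icc (-r) r).indicator rieszK τ) s,
            lintegral_indicator measurableSet_Icc]
          exact lintegral_rieszK_Icc r hrpos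
        · rw [hv, ← ENNReal.ofReal_mul (by positivity), ENNReal.ofReal_rpow_of_pos hrpos]
          refine ENNReal.ofReal_le_ofReal (le_of_eq ?_)
          nth_rewrite 2 [← Real.rpow_one r]
          rw [← Real.rpow_add hrpos]
          norm_num
    _ = 5 * volume E ^ (1 / 2 : ℝ) := by rw [hv]; ring

lemma lintegral_level (y : ℝ≥0∞) :
    ∫⁻ a in Set.Ioi (0 : ℝ), (if ENNReal.ofReal a < y then 1 else 0) = y := by
  have hm : MeasurableSet {a : ℝ | ENNReal.ofReal a < y} :=
    measurableSet_lt (by fun_prop) measurable_const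
  have : (fun a : ℝ => if ENNReal.ofReal a < y then (1 : ℝ≥0∞) else 0)
      = {a : ℝ | ENNReal.ofReal a < y}.indicator 1 := by
    ext a; simp [Set.indicator_apply]
  rw [this, lintegral_indicator_one hm, Measure.restrict_apply hm]
  rcases eq_or_ne y ∞ with rfl | hy
  · simp
  · have : {a : ℝ | ENNReal.ofReal a < y} ∩ Set.Ioi 0 = Set.Ioo 0 y.toReal := by
      ext a
      simp only [Set.mem_inter_iff, Set.mem_ofPred_eq, Set.mem_Ioi, Set.mem_Ioo]
      constructor
      · rintro ⟨h1, h2⟩; exact ⟨h2, (ENNReal.ofReal_lt_iff_lt_toReal h2.le hy).1 h1⟩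
      · rintro ⟨h1, h2⟩; exact ⟨(ENNReal.ofReal_lt_iff_lt_toReal h1.le hy).2 h2, h1⟩
    rw [this, Real.volume_Ioo, sub_zero, ENNReal.ofReal_toReal hy]

lemma measurableSet_level {f : ℝ → ℝ≥0∞} (hf : Measurable f) :
    MeasurableSet {p : ℝ × ℝ | ENNReal.ofReal p.1 < f p.2} :=
  measurableSet_lt (by fun_prop) (by fun_prop)

lemma lintegral_mul_eq_level {f φ : ℝ → ℝ≥0∞} (hf : Measurable f) (hφ : Measurable φ) :
    ∫⁻ s, f s * φ s =
      ∫⁻ a in Set.Ioi (0 : ℝ), ∫⁻ s in {s | ENNReal.ofReal a < f s}, φ s := by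
  have e : ∀ a : ℝ, ∫⁻ s in {s | ENNReal.ofReal a < f s}, φ s
      = ∫⁻ s, (if ENNReal.ofReal a < f s then 1 else 0) * φ s := by
    intro a
    rw [← lintegral_indicator (measurableSet_lt measurable_const hf)]
    congr 1; ext s; simp [Set.indicator_apply]
  simp_rw [e]
  rw [lintegral_lintegral_swap]
  · congr 1; ext s
    rw [lintegral_mul_const _ (Measurable.ite (measurableSet_lt (by fun_prop) measurable_const)
      measurable_const measurable_const), lintegral_level]
  · refine Measurable.aemeasurable (Measurable.mul (Measurable.ite (measurableSet_level hf)
      measurable_const measurable_const) (by fun_prop))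

lemma measurable_volume_level {f : ℝ → ℝ≥0∞} (hf : Measurable f) :
    Measurable fun a : ℝ => volume {s | ENNReal.ofReal a < f s} :=
  measurable_measure_prodMk_left (measurableSet_level hf)

lemma lintegral_level_rpow_le {f : ℝ → ℝ≥0∞} (hf : Measurable f) :
    ∫⁻ a in Set.Ioi (0 : ℝ), volume {s | ENNReal.ofReal a < f s} * ENNReal.ofReal a ^ (1 / 3 : ℝ)
      ≤ ∫⁻ s, f s ^ (4 / 3 : ℝ) := by
  have e : ∀ a : ℝ, volume {s | ENNReal.ofReal a < f s} * ENNReal.ofReal a ^ (1 / 3 : ℝ)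
      = ∫⁻ s, (if ENNReal.ofReal a < f s then 1 else 0) * ENNReal.ofReal a ^ (1 / 3 : ℝ) := by
    intro a
    rw [lintegral_mul_const _ (Measurable.ite (measurableSet_lt measurable_const hf)
      measurable_const measurable_const)]
    congr 1
    rw [← lintegral_indicator_one (measurableSet_lt measurable_const hf)]
    congr 1; ext s; simp [Set.indicator_apply]
  simp_rw [e]
  rw [lintegral_lintegral_swap]
  · refine lintegral_mono fun s => ?_
    calc ∫⁻ a in Set.Ioi (0 : ℝ), (if ENNReal.ofReal a < f s then 1 else 0) *
          ENNReal.ofReal a ^ (1 / 3 : ℝ)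
        ≤ ∫⁻ a in Set.Ioi (0 : ℝ), (if ENNReal.ofReal a < f s then 1 else 0) *
          f s ^ (1 / 3 : ℝ) := by
          refine lintegral_mono fun a => ?_
          dsimp only
          split_ifs with h
          · gcongr
          · simp
      _ = f s * f s ^ (1 / 3 : ℝ) := by
          rw [lintegral_mul_const _ (Measurable.ite (measurableSet_lt (by fun_prop)
            measurable_const) measurable_const measurable_const), lintegral_level]
      _ = f s ^ (4 / 3 : ℝ) := by
          nth_rewrite 1 [← ENNReal.rpow_one (f s)]
          rw [← ENNReal.rpow_add_of_nonneg _ _ (by norm_num) (by norm_num)]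
          norm_num
  · refine Measurable.aemeasurable (Measurable.mul (Measurable.ite (measurableSet_level hf)
      measurable_const measurable_const) (by fun_prop))

lemma lintegral_Ioc_rpow_neg_third (a : ℝ) (ha : 0 < a) :
    ∫⁻ b in Set.Ioc 0 a, ENNReal.ofReal b ^ (-(1 / 3) : ℝ) ≤ 2 * ENNReal.ofReal a ^ (2 / 3 : ℝ) := by
  have hi : IntegrableOn (fun τ : ℝ => τ ^ (-(1 / 3) : ℝ)) (Set.Ioc 0 a) := by
    have := intervalIntegral.intervalIntegrable_rpow' (a := 0) (b := a) (r := -(1 / 3))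
      (by norm_num)
    rwa [intervalIntegrable_iff_integrableOn_Ioc_of_le ha.le] at this
  have h1 : ∫⁻ b in Set.Ioc 0 a, ENNReal.ofReal b ^ (-(1 / 3) : ℝ)
      = ∫⁻ τ in Set.Ioc 0 a, ENNReal.ofReal (τ ^ (-(1 / 3) : ℝ)) :=
    setLIntegral_congr_fun measurableSet_Ioc fun τ hτ => ENNReal.ofReal_rpow_of_pos hτ.1
  rw [h1, ← ofReal_integral_eq_lintegral_ofReal hi]
  · rw [← intervalIntegral.integral_of_le ha.le, integral_rpow (Or.inl (by norm_num)),
      ENNReal.ofReal_rpow_of_pos ha]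
    rw [show (2 : ℝ≥0∞) = ENNReal.ofReal 2 by simp, ← ENNReal.ofReal_mul (by norm_num)]
    refine ENNReal.ofReal_le_ofReal ?_
    have := Real.rpow_nonneg ha.le (2 / 3)
    norm_num
    linarith
  · filter_upwards [ae_restrict_mem measurableSet_Ioc] with τ hτ
    exact Real.rpow_nonneg hτ.1.le _

lemma lintegral_sqrt_level_le {g : ℝ → ℝ≥0∞} (hg : Measurable g)
    (hG : ∫⁻ s, g s ^ (4 / 3 : ℝ) ≤ 1) (a : ℝ) (ha : 0 < a) :
    ∫⁻ b in Set.Ioc 0 a, volume {s | ENNReal.ofReal b < g s} ^ (1 / 2 : ℝ)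
      ≤ 2 * ENNReal.ofReal a ^ (1 / 3 : ℝ) := by
  set w := fun b : ℝ => volume {s | ENNReal.ofReal b < g s} with hw
  have hwm : Measurable w := measurable_volume_level hg
  have e : ∀ b ∈ Set.Ioc 0 a, w b ^ (1 / 2 : ℝ) =
      ((fun b => (w b * ENNReal.ofReal b ^ (1 / 3 : ℝ)) ^ (1 / 2 : ℝ)) *
        fun b => (ENNReal.ofReal b ^ (-(1 / 3) : ℝ)) ^ (1 / 2 : ℝ)) b := by
    intro b hb
    have hb0 : ENNReal.ofReal b ≠ 0 := by simpa using hb.1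
    simp only [Pi.mul_apply]
    rw [← ENNReal.mul_rpow_of_nonneg _ _ (by norm_num), mul_assoc,
      ← ENNReal.rpow_add _ _ hb0 ENNReal.ofReal_ne_top]
    simp
  rw [setLIntegral_congr_fun measurableSet_Ioc e]
  refine (ENNReal.lintegral_mul_le_Lp_mul_Lq _ Real.HolderConjugate.two_two
    (Measurable.aemeasurable (by fun_prop)) (Measurable.aemeasurable (by fun_prop))).trans ?_
  have s2 : ∀ x : ℝ≥0∞, (x ^ (1 / 2 : ℝ)) ^ (2 : ℝ) = x := fun x => by
    rw [← ENNReal.rpow_mul]; norm_num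
  simp_rw [s2]
  have h1 : ∫⁻ b in Set.Ioc 0 a, w b * ENNReal.ofReal b ^ (1 / 3 : ℝ) ≤ 1 :=
    (lintegral_mono_set Set.Ioc_subset_Ioi_self).trans ((lintegral_level_rpow_le hg).trans hG)
  calc _ ≤ (1 : ℝ≥0∞) ^ (1 / 2 : ℝ) * (2 * ENNReal.ofReal a ^ (2 / 3 : ℝ)) ^ (1 / 2 : ℝ) := by
        gcongr
        exact lintegral_Ioc_rpow_neg_third a ha
    _ = 2 ^ (1 / 2 : ℝ) * ENNReal.ofReal a ^ (1 / 3 : ℝ) := by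
        rw [ENNReal.one_rpow, one_mul, ENNReal.mul_rpow_of_nonneg _ _ (by norm_num),
          ← ENNReal.rpow_mul]
        norm_num
    _ ≤ 2 * ENNReal.ofReal a ^ (1 / 3 : ℝ) := by
        gcongr
        calc (2 : ℝ≥0∞) ^ (1 / 2 : ℝ) ≤ 2 ^ (1 : ℝ) :=
              ENNReal.rpow_le_rpow_of_exponent_le (by norm_num) (by norm_num)
          _ = 2 := ENNReal.rpow_one 2

lemma half_hls {f g : ℝ → ℝ≥0∞} (hf : Measurable f) (hg : Measurable g)
    (hF : ∫⁻ s, f s ^ (4 / 3 : ℝ) ≤ 1) (hG : ∫⁻ s, g s ^ (4 / 3 : ℝ) ≤ 1) :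
    ∫⁻ a in Set.Ioi (0 : ℝ), ∫⁻ b in Set.Ioc 0 a,
      volume {s | ENNReal.ofReal a < f s} * volume {s | ENNReal.ofReal b < g s} ^ (1 / 2 : ℝ)
      ≤ 2 := by
  calc _ ≤ ∫⁻ a in Set.Ioi (0 : ℝ), 2 * (volume {s | ENNReal.ofReal a < f s} *
        ENNReal.ofReal a ^ (1 / 3 : ℝ)) := by
        refine setLIntegral_mono' measurableSet_Ioi fun a ha => ?_
        rw [lintegral_const_mul _ ((measurable_volume_level hg).pow_const _)]
        calc _ ≤ volume {s | ENNReal.ofReal a < f s} * (2 * ENNReal.ofReal a ^ (1 / 3 : ℝ)) := by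
              gcongr
              exact lintegral_sqrt_level_le hg hG a ha
          _ = _ := by ring
    _ ≤ 2 * 1 := by
        have hm : Measurable fun a : ℝ => volume {s | ENNReal.ofReal a < f s} *
            ENNReal.ofReal a ^ (1 / 3 : ℝ) := (measurable_volume_level hf).mul (by fun_prop)
        rw [lintegral_const_mul _ hm]
        gcongr
        exact (lintegral_level_rpow_le hf).trans hF
    _ = 2 := by norm_num

lemma hls_normalized {f g : ℝ → ℝ≥0∞} (hf : Measurable f) (hg : Measurable g)
    (hF : ∫⁻ s, f s ^ (4 / 3 : ℝ) ≤ 1) (hG : ∫⁻ s, g s ^ (4 / 3 : ℝ) ≤ 1) :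
    ∫⁻ s, ∫⁻ t, f s * g t * rieszK (t - s) ≤ 20 := by
  set v := fun a : ℝ => volume {s | ENNReal.ofReal a < f s} with hv
  set w := fun b : ℝ => volume {s | ENNReal.ofReal b < g s} with hw
  have hvm : Measurable v := measurable_volume_level hf
  have hwm : Measurable w := measurable_volume_level hg
  set Λ : ℝ → ℝ → ℝ≥0∞ := fun a b =>
    ∫⁻ s in {s | ENNReal.ofReal a < f s}, ∫⁻ t in {t | ENNReal.ofReal b < g t}, rieszK (t - s)
    with hΛ
  have b1 : ∀ a b, Λ a b ≤ 5 * (v a * w b ^ (1 / 2 : ℝ)) := by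
    intro a b
    calc Λ a b ≤ ∫⁻ s in {s | ENNReal.ofReal a < f s}, 5 * w b ^ (1 / 2 : ℝ) :=
          lintegral_mono fun s => setLIntegral_rieszK_le _ s
      _ = 5 * (v a * w b ^ (1 / 2 : ℝ)) := by rw [setLIntegral_const]; ring
  have b2 : ∀ a b, Λ a b ≤ 5 * (w b * v a ^ (1 / 2 : ℝ)) := by
    intro a b
    have : Λ a b = ∫⁻ t in {t | ENNReal.ofReal b < g t}, ∫⁻ s in {s | ENNReal.ofReal a < f s},
        rieszK (t - s) := by
      refine lintegral_lintegral_swap (Measurable.aemeasurable ?_)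
      exact measurable_rieszK.comp (by fun_prop)
    rw [this]
    calc _ ≤ ∫⁻ t in {t | ENNReal.ofReal b < g t}, 5 * v a ^ (1 / 2 : ℝ) := by
          refine lintegral_mono fun t => ?_
          have e : ∀ s, rieszK (t - s) = rieszK (s - t) := fun s => by
            rw [← rieszK_neg, neg_sub]
          simp_rw [e]
          exact setLIntegral_rieszK_le _ t
      _ = 5 * (w b * v a ^ (1 / 2 : ℝ)) := by rw [setLIntegral_const]; ring
  have rep : ∫⁻ s, ∫⁻ t, f s * g t * rieszK (t - s)
      = ∫⁻ a in Set.Ioi (0 : ℝ), ∫⁻ b in Set.Ioi (0 : ℝ), Λ a b := by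
    have i1 : ∀ s, ∫⁻ t, f s * g t * rieszK (t - s) = f s * ∫⁻ t, g t * rieszK (t - s) := by
      intro s
      simp_rw [mul_assoc]
      rw [lintegral_const_mul]
      exact hg.mul (measurable_rieszK.comp (by fun_prop))
    simp_rw [i1]
    have hmeas : Measurable fun s => ∫⁻ t, g t * rieszK (t - s) := by
      refine Measurable.lintegral_prod_right' (f := fun p : ℝ × ℝ => g p.2 * rieszK (p.2 - p.1)) ?_
      exact (by fun_prop : Measurable fun p : ℝ × ℝ => g p.2).mul
        (measurable_rieszK.comp (by fun_prop))
    rw [lintegral_mul_eq_level hf hmeas]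
    refine lintegral_congr fun a => ?_
    have i2 : ∀ s, ∫⁻ t, g t * rieszK (t - s)
        = ∫⁻ b in Set.Ioi (0 : ℝ), ∫⁻ t in {t | ENNReal.ofReal b < g t}, rieszK (t - s) :=
      fun s => lintegral_mul_eq_level hg (measurable_rieszK.comp (by fun_prop))
    simp_rw [i2]
    rw [lintegral_lintegral_swap]
    have e : ∀ p : ℝ × ℝ, ∫⁻ t in {t | ENNReal.ofReal p.2 < g t}, rieszK (t - p.1)
        = ∫⁻ t, (if ENNReal.ofReal p.2 < g t then rieszK (t - p.1) else 0) := by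
      intro p
      rw [← lintegral_indicator (measurableSet_lt measurable_const hg)]
      congr 1; ext t; simp [Set.indicator_apply]
    refine Measurable.aemeasurable ?_
    change Measurable fun p : ℝ × ℝ => ∫⁻ t in {t | ENNReal.ofReal p.2 < g t}, rieszK (t - p.1)
    simp_rw [e]
    refine Measurable.lintegral_prod_right' (f := fun q : (ℝ × ℝ) × ℝ =>
      if ENNReal.ofReal q.1.2 < g q.2 then rieszK (q.2 - q.1.1) else 0) ?_
    exact Measurable.ite (measurableSet_lt (by fun_prop) (by fun_prop))
      (measurable_rieszK.comp (by fun_prop)) measurable_const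
  rw [rep]
  calc ∫⁻ a in Set.Ioi (0 : ℝ), ∫⁻ b in Set.Ioi (0 : ℝ), Λ a b
      ≤ ∫⁻ a in Set.Ioi (0 : ℝ), ∫⁻ b in Set.Ioi (0 : ℝ),
          (5 * (Set.Ioc 0 a).indicator (fun b => v a * w b ^ (1 / 2 : ℝ)) b
          + 5 * (Set.Ioc 0 b).indicator (fun a => w b * v a ^ (1 / 2 : ℝ)) a) := by
        refine setLIntegral_mono' measurableSet_Ioi fun a ha =>
          setLIntegral_mono' measurableSet_Ioi fun b hb => ?_
        rcases le_total b a with h | h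
        · rw [Set.indicator_of_mem (show b ∈ Set.Ioc 0 a from ⟨hb, h⟩)]
          exact (b1 a b).trans le_self_add
        · rw [Set.indicator_of_mem (show a ∈ Set.Ioc 0 b from ⟨ha, h⟩)]
          exact (b2 a b).trans le_add_self
    _ = 5 * (∫⁻ a in Set.Ioi (0 : ℝ), ∫⁻ b in Set.Ioc 0 a, v a * w b ^ (1 / 2 : ℝ))
        + 5 * (∫⁻ b in Set.Ioi (0 : ℝ), ∫⁻ a in Set.Ioc 0 b, w b * v a ^ (1 / 2 : ℝ)) := by
        have s1 : MeasurableSet {p : ℝ × ℝ | 0 < p.2 ∧ p.2 ≤ p.1} :=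
          (measurableSet_lt measurable_const measurable_snd).inter
            (measurableSet_le measurable_snd measurable_fst)
        have s2 : MeasurableSet {p : ℝ × ℝ | 0 < p.1 ∧ p.1 ≤ p.2} :=
          (measurableSet_lt measurable_const measurable_fst).inter
            (measurableSet_le measurable_fst measurable_snd)
        have m1 : Measurable fun p : ℝ × ℝ =>
            (Set.Ioc 0 p.1).indicator (fun b => v p.1 * w b ^ (1 / 2 : ℝ)) p.2 := by
          simp only [Set.indicator_apply, Set.mem_Ioc]
          exact Measurable.ite s1 (by fun_prop) measurable_const
        have m2 : Measurable fun p : ℝ × ℝ =>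
            (Set.Ioc 0 p.2).indicator (fun a => w p.2 * v a ^ (1 / 2 : ℝ)) p.1 := by
          simp only [Set.indicator_apply, Set.mem_Ioc]
          exact Measurable.ite s2 (by fun_prop) measurable_const
        have restr : ∀ (a : ℝ) (u : ℝ → ℝ≥0∞), ∫⁻ b in Set.Ioi 0, (Set.Ioc 0 a).indicator u b
            = ∫⁻ b in Set.Ioc 0 a, u b := by
          intro a u
          rw [lintegral_indicator measurableSet_Ioc, Measure.restrict_restrict measurableSet_Ioc,
            Set.inter_eq_left.2 Set.Ioc_subset_Ioi_self]
        have in1 : ∀ a, ∫⁻ b in Set.Ioi (0 : ℝ),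
            (5 * (Set.Ioc 0 a).indicator (fun b => v a * w b ^ (1 / 2 : ℝ)) b
            + 5 * (Set.Ioc 0 b).indicator (fun a => w b * v a ^ (1 / 2 : ℝ)) a)
            = 5 * (∫⁻ b in Set.Ioc 0 a, v a * w b ^ (1 / 2 : ℝ)) + 5 * ∫⁻ b in Set.Ioi (0 : ℝ),
              (Set.Ioc 0 b).indicator (fun a => w b * v a ^ (1 / 2 : ℝ)) a := by
          intro a
          have n1 : Measurable fun b => (Set.Ioc 0 a).indicator (fun b => v a * w b ^ (1 / 2 : ℝ)) b :=
            m1.comp measurable_prodMk_left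
          have n2 : Measurable fun b => (Set.Ioc 0 b).indicator (fun a => w b * v a ^ (1 / 2 : ℝ)) a :=
            m2.comp measurable_prodMk_left
          rw [lintegral_add_left (n1.const_mul 5), lintegral_const_mul _ n1,
            lintegral_const_mul _ n2, restr]
        simp_rw [in1]
        have m3 : Measurable fun a => ∫⁻ b in Set.Ioc 0 a, v a * w b ^ (1 / 2 : ℝ) := by
          simp_rw [← restr]
          exact m1.lintegral_prod_right'
        rw [lintegral_add_left (m3.const_mul 5), lintegral_const_mul _ m3,
          lintegral_const_mul _ m2.lintegral_prod_right']
        congr 2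
        rw [lintegral_lintegral_swap m2.aemeasurable]
        simp_rw [restr]
    _ ≤ 5 * 2 + 5 * 2 := by
        gcongr
        · exact half_hls hf hg hF hG
        · exact half_hls hg hf hG hF
    _ = 20 := by norm_num

/-- Hardy–Littlewood–Sobolev inequality `L^{4/3} × L^{4/3}` with kernel `|t - s|^{-1/2}`. -/
theorem hls {f g : ℝ → ℝ≥0∞} (hf : Measurable f) (hg : Measurable g) :
    ∫⁻ s, ∫⁻ t, f s * g t * rieszK (t - s) ≤
      20 * ((∫⁻ s, f s ^ (4 / 3 : ℝ)) ^ (3 / 4 : ℝ) * (∫⁻ s, g s ^ (4 / 3 : ℝ)) ^ (3 / 4 : ℝ)) := by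
  set A := ∫⁻ s, f s ^ (4 / 3 : ℝ) with hA
  set B := ∫⁻ s, g s ^ (4 / 3 : ℝ) with hB
  have zero_of : ∀ {u : ℝ → ℝ≥0∞}, Measurable u → ∫⁻ s, u s ^ (4 / 3 : ℝ) = 0 → u =ᵐ[volume] 0 := by
    intro u hu h0
    rw [lintegral_eq_zero_iff (by fun_prop)] at h0
    filter_upwards [h0] with s hs
    have hs' : u s ^ (4 / 3 : ℝ) = 0 := hs
    rwa [ENNReal.rpow_eq_zero_iff_of_pos (by norm_num)] at hs'
  rcases eq_or_ne A 0 with hA0 | hA0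
  · have : ∫⁻ s, ∫⁻ t, f s * g t * rieszK (t - s) = 0 := by
      rw [← lintegral_zero (μ := (volume : Measure ℝ))]
      refine lintegral_congr_ae ?_
      filter_upwards [zero_of hf hA0] with s hs
      simp [hs]
    rw [this]; exact zero_le
  rcases eq_or_ne B 0 with hB0 | hB0
  · have : ∫⁻ s, ∫⁻ t, f s * g t * rieszK (t - s) = 0 := by
      rw [← lintegral_zero (μ := (volume : Measure ℝ))]
      refine lintegral_congr fun s => ?_
      rw [← lintegral_zero (μ := (volume : Measure ℝ))]
      refine lintegral_congr_ae ?_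
      filter_upwards [zero_of hg hB0] with t ht
      simp [ht]
    rw [this]; exact zero_le
  rcases eq_or_ne A ∞ with hAt | hAt
  · rw [hAt, ENNReal.top_rpow_of_pos (by norm_num), ENNReal.top_mul (by
      rw [Ne, ENNReal.rpow_eq_zero_iff_of_pos (by norm_num)]; exact hB0),
      ENNReal.mul_top (by norm_num)]
    exact le_top
  rcases eq_or_ne B ∞ with hBt | hBt
  · rw [hBt, ENNReal.top_rpow_of_pos (by norm_num), ENNReal.mul_top (by
      rw [Ne, ENNReal.rpow_eq_zero_iff_of_pos (by norm_num)]; exact hA0),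
      ENNReal.mul_top (by norm_num)]
    exact le_top
  have norm_of : ∀ {u : ℝ → ℝ≥0∞} {U : ℝ≥0∞}, Measurable u → ∫⁻ s, u s ^ (4 / 3 : ℝ) = U →
      U ≠ 0 → U ≠ ∞ → ∫⁻ s, (U ^ (-(3 / 4) : ℝ) * u s) ^ (4 / 3 : ℝ) ≤ 1 := by
    intro u U hu hU h0 ht
    simp_rw [ENNReal.mul_rpow_of_nonneg _ _ (by norm_num : (0 : ℝ) ≤ 4 / 3)]
    rw [lintegral_const_mul _ (by fun_prop), hU, ← ENNReal.rpow_mul]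
    norm_num
    rw [ENNReal.rpow_neg_one, ENNReal.inv_mul_cancel h0 ht]
  have key := hls_normalized (hf.const_mul (A ^ (-(3 / 4) : ℝ))) (hg.const_mul (B ^ (-(3 / 4) : ℝ)))
    (norm_of hf rfl hA0 hAt) (norm_of hg rfl hB0 hBt)
  have cancel : ∀ {U : ℝ≥0∞}, U ≠ 0 → U ≠ ∞ → U ^ (3 / 4 : ℝ) * U ^ (-(3 / 4) : ℝ) = 1 := by
    intro U h0 ht
    rw [← ENNReal.rpow_add _ _ h0 ht]; norm_num
  have m1 : ∀ s, Measurable fun t => f s * g t * rieszK (t - s) := fun s =>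
    (hg.const_mul _).mul (measurable_rieszK.comp (by fun_prop))
  have m2 : Measurable fun s => ∫⁻ t, f s * g t * rieszK (t - s) := by
    refine Measurable.lintegral_prod_right' (f := fun p : ℝ × ℝ => f p.1 * g p.2 * rieszK (p.2 - p.1))
      (Measurable.mul (by fun_prop) (measurable_rieszK.comp (by fun_prop)))
  have scale : ∫⁻ s, ∫⁻ t, (A ^ (-(3 / 4) : ℝ) * f s) * (B ^ (-(3 / 4) : ℝ) * g t) * rieszK (t - s)
      = A ^ (-(3 / 4) : ℝ) * B ^ (-(3 / 4) : ℝ) * ∫⁻ s, ∫⁻ t, f s * g t * rieszK (t - s) := by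
    rw [← lintegral_const_mul _ m2]
    refine lintegral_congr fun s => ?_
    rw [← lintegral_const_mul _ (m1 s)]
    refine lintegral_congr fun t => ?_
    ring
  rw [scale] at key
  calc ∫⁻ s, ∫⁻ t, f s * g t * rieszK (t - s)
      = (A ^ (3 / 4 : ℝ) * A ^ (-(3 / 4) : ℝ)) * (B ^ (3 / 4 : ℝ) * B ^ (-(3 / 4) : ℝ)) *
        ∫⁻ s, ∫⁻ t, f s * g t * rieszK (t - s) := by
        rw [cancel hA0 hAt, cancel hB0 hBt]; simp
    _ = A ^ (3 / 4 : ℝ) * B ^ (3 / 4 : ℝ) * (A ^ (-(3 / 4) : ℝ) * B ^ (-(3 / 4) : ℝ) *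
        ∫⁻ s, ∫⁻ t, f s * g t * rieszK (t - s)) := by ring
    _ ≤ A ^ (3 / 4 : ℝ) * B ^ (3 / 4 : ℝ) * 20 := by gcongr
    _ = _ := by ring

/-! ### Parametric integrals, decaying functions and the `L²` norm in one variable -/

@[fun_prop] theorem measurable_integral_param {α : Type*} [MeasurableSpace α] {f : α → ℝ → ℂ}
    (hf : Measurable fun p : α × ℝ => f p.1 p.2) : Measurable fun a => ∫ x, f a x :=
  hf.stronglyMeasurable.integral_prod_right'.measurable

@[fun_prop] theorem measurable_lintegral_param {α : Type*} [MeasurableSpace α]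
    {f : α → ℝ → ℝ≥0∞} (hf : Measurable fun p : α × ℝ => f p.1 p.2) :
    Measurable fun a => ∫⁻ x, f a x :=
  hf.lintegral_prod_right'

/-- The integrable weight `(1 + x²)⁻¹`. -/
def rho (x : ℝ) : ℝ := (1 + x ^ 2)⁻¹

lemma rho_pos (x : ℝ) : 0 < rho x := by unfold rho; positivity

lemma rho_le_one (x : ℝ) : rho x ≤ 1 := by
  unfold rho; exact inv_le_one_of_one_le₀ (by nlinarith [sq_nonneg x])

lemma integrable_rho : Integrable rho := integrable_inv_one_add_sq

@[fun_prop] lemma continuous_rho : Continuous rho := by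
  unfold rho
  exact Continuous.inv₀ (by fun_prop) fun x => by positivity

@[fun_prop] lemma measurable_rho : Measurable rho := continuous_rho.measurable

lemma integrable_rho_prod : Integrable (fun p : ℝ × ℝ => rho p.1 * rho p.2) :=
  integrable_rho.mul_prod integrable_rho

lemma integrable_rho_prod₃ : Integrable (fun p : ℝ × ℝ × ℝ => rho p.1 * (rho p.2.1 * rho p.2.2)) :=
  integrable_rho.mul_prod integrable_rho_prod

lemma integrable_of_rho {f : ℝ → ℂ} {D : ℝ} (hf : Measurable f) (hb : ∀ x, ‖f x‖ ≤ D * rho x) :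
    Integrable f :=
  (integrable_rho.const_mul D).mono' hf.aestronglyMeasurable (ae_of_all _ hb)

lemma integrable_of_rho_prod {f : ℝ → ℝ → ℂ} {D : ℝ}
    (hf : Measurable fun p : ℝ × ℝ => f p.1 p.2) (hb : ∀ x y, ‖f x y‖ ≤ D * (rho x * rho y)) :
    Integrable fun p : ℝ × ℝ => f p.1 p.2 :=
  (integrable_rho_prod.const_mul D).mono' hf.aestronglyMeasurable (ae_of_all _ fun p => hb p.1 p.2)

lemma integral_swap_of_rho {f : ℝ → ℝ → ℂ} {D : ℝ}
    (hf : Measurable fun p : ℝ × ℝ => f p.1 p.2) (hb : ∀ x y, ‖f x y‖ ≤ D * (rho x * rho y)) :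
    ∫ x, ∫ y, f x y = ∫ y, ∫ x, f x y :=
  integral_integral_swap (integrable_of_rho_prod hf hb)

/-- The total mass of the weight `rho`. -/
def rhoMass : ℝ := ∫ x, rho x

lemma rhoMass_nonneg : 0 ≤ rhoMass := integral_nonneg fun x => (rho_pos x).le

lemma norm_integral_le_of_rho {f : ℝ → ℂ} {D : ℝ} (hb : ∀ x, ‖f x‖ ≤ D * rho x) :
    ‖∫ x, f x‖ ≤ D * rhoMass := by
  refine (norm_integral_le_of_norm_le (integrable_rho.const_mul D) (ae_of_all _ hb)).trans ?_
  rw [integral_const_mul]; rfl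

lemma memLp_two_of_rho {f : ℝ → ℂ} {D : ℝ} (hf : Measurable f) (hb : ∀ x, ‖f x‖ ≤ D * rho x) :
    MemLp f 2 := by
  rw [memLp_two_iff_integrable_sq_norm hf.aestronglyMeasurable]
  refine (integrable_rho.const_mul (D ^ 2)).mono' (by fun_prop) (ae_of_all _ fun x => ?_)
  rw [Real.norm_of_nonneg (by positivity)]
  calc ‖f x‖ ^ 2 ≤ (D * rho x) ^ 2 := by gcongr; exact hb x
    _ = D ^ 2 * (rho x * rho x) := by ring
    _ ≤ D ^ 2 * (rho x * 1) := by
        have := rho_le_one x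
        have := (rho_pos x).le
        gcongr
    _ = D ^ 2 * rho x := by ring

/-- The `L²` norm on the line, as an extended nonnegative number. -/
def nTwo (w : ℝ → ℂ) : ℝ≥0∞ := (∫⁻ η, ‖w η‖ₑ ^ 2) ^ (1 / 2 : ℝ)

lemma nTwo_eq_eLpNorm (w : ℝ → ℂ) : nTwo w = eLpNorm w 2 volume := by
  rw [eLpNorm_eq_lintegral_rpow_enorm_toReal (by norm_num) (by norm_num)]
  simp [nTwo]

lemma sq_rpow_half (x : ℝ≥0∞) : (x ^ 2) ^ (1 / 2 : ℝ) = x := by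
  rw [← ENNReal.rpow_natCast, ← ENNReal.rpow_mul]; norm_num

lemma rpow_half_sq (x : ℝ≥0∞) : (x ^ (1 / 2 : ℝ)) ^ 2 = x := by
  rw [← ENNReal.rpow_natCast, ← ENNReal.rpow_mul]; norm_num

lemma ennreal_le_of_sq_le_sq {x y : ℝ≥0∞} (h : x ^ 2 ≤ y ^ 2) : x ≤ y := by
  rw [← sq_rpow_half x, ← sq_rpow_half y]; gcongr

lemma nTwo_sq (w : ℝ → ℂ) : nTwo w ^ 2 = ∫⁻ η, ‖w η‖ₑ ^ 2 := rpow_half_sq _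

@[fun_prop] lemma measurable_nTwo {α : Type*} [MeasurableSpace α] {f : α → ℝ → ℂ}
    (hf : Measurable fun p : α × ℝ => f p.1 p.2) : Measurable fun a => nTwo (f a) := by
  unfold nTwo; fun_prop

lemma lintegral_mul_le_sqrt_mul_sqrt {α : Type*} [MeasurableSpace α] {μ : Measure α}
    {f g : α → ℝ≥0∞} (hf : AEMeasurable f μ) (hg : AEMeasurable g μ) :
    ∫⁻ x, f x * g x ∂μ ≤ (∫⁻ x, f x ^ 2 ∂μ) ^ (1 / 2 : ℝ) * (∫⁻ x, g x ^ 2 ∂μ) ^ (1 / 2 : ℝ) := by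
  have := ENNReal.lintegral_mul_le_Lp_mul_Lq μ Real.HolderConjugate.two_two hf hg
  simpa using this

lemma lintegral_enorm_mul_le_nTwo {w v : ℝ → ℂ} (hw : Measurable w) (hv : Measurable v) :
    ∫⁻ η, ‖w η‖ₑ * ‖v η‖ₑ ≤ nTwo w * nTwo v :=
  lintegral_mul_le_sqrt_mul_sqrt (by fun_prop) (by fun_prop)

/-- Minkowski's integral inequality for the `L²` norm in the second variable. -/
lemma lintegral_sq_lintegral_le {f : ℝ → ℝ → ℝ≥0∞} (hf : Measurable fun p : ℝ × ℝ => f p.1 p.2) :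
    ∫⁻ η, (∫⁻ t, f t η) ^ 2 ≤ (∫⁻ t, (∫⁻ η, f t η ^ 2) ^ (1 / 2 : ℝ)) ^ 2 := by
  have e : ∀ η, (∫⁻ t, f t η) ^ 2 = ∫⁻ t, ∫⁻ t', f t η * f t' η := by
    intro η
    have m : Measurable fun t => f t η := by fun_prop
    rw [sq, ← lintegral_mul_const _ m]
    refine lintegral_congr fun t => ?_
    rw [lintegral_const_mul _ m]
  simp_rw [e]
  rw [lintegral_lintegral_swap (by fun_prop)]
  have m' : Measurable fun t => (∫⁻ η, f t η ^ 2) ^ (1 / 2 : ℝ) := by fun_prop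
  rw [sq (∫⁻ t, (∫⁻ η, f t η ^ 2) ^ (1 / 2 : ℝ)), ← lintegral_mul_const _ m']
  refine lintegral_mono fun t => ?_
  dsimp only
  rw [lintegral_lintegral_swap (by fun_prop), ← lintegral_const_mul _ m']
  refine lintegral_mono fun t' => ?_
  exact lintegral_mul_le_sqrt_mul_sqrt (by fun_prop) (by fun_prop)

/-! ### The Gaussian-regularised dispersive kernel -/

lemma enorm_regularised_kernel_le {ε τ : ℝ} (hε : 0 < ε) (hτ : τ ≠ 0) (x : ℝ) :
    ‖∫ ξ : ℝ, phase (ξ * x + τ * ξ ^ 2) * (Real.exp (-ε * ξ ^ 2) : ℂ)‖ₑ ≤ 2 * rieszK τ := by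
  have hb : 0 < ((ε : ℂ) - τ * I).re := by simpa using hε
  have e : ∫ ξ : ℝ, phase (ξ * x + τ * ξ ^ 2) * (Real.exp (-ε * ξ ^ 2) : ℂ)
      = (π / ((ε : ℂ) - τ * I)) ^ (1 / 2 : ℂ) * cexp (-(x : ℂ) ^ 2 / (4 * ((ε : ℂ) - τ * I))) := by
    rw [← fourierIntegral_gaussian hb]
    congr 1; ext ξ
    rw [phase, Complex.ofReal_exp, ← Complex.exp_add, ← Complex.exp_add]
    congr 1; push_cast; ring
  have hnb : |τ| ≤ ‖(ε : ℂ) - τ * I‖ := by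
    have := Complex.abs_im_le_norm ((ε : ℂ) - τ * I)
    simpa using this
  have hτ' : 0 < |τ| := abs_pos.2 hτ
  have hre : (-(x : ℂ) ^ 2 / (4 * ((ε : ℂ) - τ * I))).re ≤ 0 := by
    have : (-(x : ℂ) ^ 2 / (4 * ((ε : ℂ) - τ * I))) = ((-(x ^ 2 / 4) : ℝ) : ℂ) * ((ε : ℂ) - τ * I)⁻¹ := by
      push_cast; rw [mul_comm (4 : ℂ), div_mul_eq_div_div]; ring
    rw [this, Complex.re_ofReal_mul, Complex.inv_re]
    have h1 : 0 ≤ ((ε : ℂ) - τ * I).re / normSq ((ε : ℂ) - τ * I) :=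
      div_nonneg hb.le (normSq_nonneg _)
    nlinarith [sq_nonneg x, mul_nonneg (sq_nonneg x) h1]
  rw [e, ← ofReal_norm, norm_mul, Complex.norm_exp, rieszK,
    show (2 : ℝ≥0∞) = ENNReal.ofReal 2 by simp, ← ENNReal.ofReal_mul (by norm_num)]
  refine ENNReal.ofReal_le_ofReal ?_
  have hn : ‖((π : ℂ) / ((ε : ℂ) - τ * I)) ^ (1 / 2 : ℂ)‖ = (π / ‖(ε : ℂ) - τ * I‖) ^ (1 / 2 : ℝ) := by
    rw [show (1 / 2 : ℂ) = ((1 / 2 : ℝ) : ℂ) by norm_num, Complex.norm_cpow_real, norm_div]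
    simp [abs_of_pos Real.pi_pos]
  calc _ ≤ ‖((π : ℂ) / ((ε : ℂ) - τ * I)) ^ (1 / 2 : ℂ)‖ * 1 := by
        gcongr; exact Real.exp_le_one_iff.2 hre
    _ ≤ (4 / |τ|) ^ (1 / 2 : ℝ) := by
        rw [mul_one, hn]
        have := Real.pi_le_four
        gcongr
    _ = 2 * |τ| ^ (-(1 / 2) : ℝ) := by
        rw [Real.div_rpow (by norm_num) hτ'.le, Real.rpow_neg hτ'.le, div_eq_mul_inv]
        congr 1
        rw [show (4 : ℝ) = 2 ^ (2 : ℝ) by norm_num, ← Real.rpow_mul (by norm_num)]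
        norm_num

lemma exp_neg_mul_sq_le {ε : ℝ} (hε : 0 < ε) (ξ : ℝ) :
    Real.exp (-ε * ξ ^ 2) ≤ (1 + ε⁻¹) * rho ξ := by
  have h1 : 1 + ε * ξ ^ 2 ≤ Real.exp (ε * ξ ^ 2) := by linarith [Real.add_one_le_exp (ε * ξ ^ 2)]
  rw [neg_mul, Real.exp_neg, rho, ← div_eq_mul_inv, inv_eq_one_div,
    div_le_div_iff₀ (Real.exp_pos _) (by positivity), one_mul]
  calc 1 + ξ ^ 2 ≤ (1 + ε⁻¹) * (1 + ε * ξ ^ 2) := by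
        have : ε⁻¹ * ε = 1 := inv_mul_cancel₀ hε.ne'
        have h2 : (1 + ε⁻¹) * (1 + ε * ξ ^ 2) = 1 + ξ ^ 2 + (ε⁻¹ + ε * ξ ^ 2) := by
          linear_combination ξ ^ 2 * this
        rw [h2]; have : 0 < ε⁻¹ := inv_pos.2 hε
        nlinarith [mul_nonneg hε.le (sq_nonneg ξ)]
    _ ≤ _ := by gcongr

/-! ### The adjoint of the free evolution restricted to a curve -/

lemma lintegral_enorm_sq_eq {α : Type*} [MeasurableSpace α] {μ : Measure α} {G : α → ℂ}
    (hG : Integrable (fun x => ‖G x‖ ^ 2) μ) :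
    ∫⁻ x, ‖G x‖ₑ ^ 2 ∂μ = ‖∫ x, G x * (starRingEnd ℂ) (G x) ∂μ‖ₑ := by
  have e : ∀ x, G x * (starRingEnd ℂ) (G x) = ((‖G x‖ ^ 2 : ℝ) : ℂ) := fun x => by
    rw [Complex.mul_conj, Complex.normSq_eq_norm_sq]
  simp_rw [e]
  rw [integral_complex_ofReal, ← ofReal_norm, Complex.norm_real,
    Real.norm_of_nonneg (integral_nonneg fun x => by positivity),
    ofReal_integral_eq_lintegral_ofReal hG (ae_of_all _ fun x => by positivity)]
  refine lintegral_congr fun x => ?_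
  rw [ENNReal.ofReal_pow (norm_nonneg _), ofReal_norm]

/-- The adjoint of the free evolution sampled along the curve `X`. -/
def curveAdj (X : ℝ → ℝ) (α : ℝ → ℂ) (ξ : ℝ) : ℂ :=
  ∫ t, phase (-(ξ * X t) + t * ξ ^ 2) * α t

lemma norm_curveAdj_le {X : ℝ → ℝ} {α : ℝ → ℂ} {D : ℝ} (hb : ∀ t, ‖α t‖ ≤ D * rho t) (ξ : ℝ) :
    ‖curveAdj X α ξ‖ ≤ D * rhoMass :=
  norm_integral_le_of_rho fun t => by simpa using hb t

@[fun_prop] lemma measurable_curveAdj {X : ℝ → ℝ} {α : ℝ → ℂ} (hX : Measurable X)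
    (hα : Measurable α) : Measurable (curveAdj X α) := by
  unfold curveAdj; fun_prop

lemma lintegral_regularised_curveAdj_le {X : ℝ → ℝ} (hX : Measurable X) {α : ℝ → ℂ} {D : ℝ}
    (hα : Measurable α) (hb : ∀ t, ‖α t‖ ≤ D * rho t) {ε : ℝ} (hε : 0 < ε) :
    ∫⁻ ξ, ‖(Real.exp (-ε * ξ ^ 2) : ℂ) * curveAdj X α ξ‖ₑ ^ 2
      ≤ 2 * ∫⁻ t, ∫⁻ t', ‖α t‖ₑ * ‖α t'‖ₑ * rieszK (t' - t) := by
  have hD : 0 ≤ D := nonneg_of_mul_nonneg_left ((norm_nonneg _).trans (hb 0)) (rho_pos 0)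
  have hbd : ∀ ξ, ‖(Real.exp (-ε * ξ ^ 2) : ℂ) * curveAdj X α ξ‖
      ≤ (1 + ε⁻¹) * D * rhoMass * rho ξ := by
    intro ξ
    rw [norm_mul, Complex.norm_real, Real.norm_of_nonneg (Real.exp_pos _).le]
    calc _ ≤ ((1 + ε⁻¹) * rho ξ) * (D * rhoMass) :=
          mul_le_mul (exp_neg_mul_sq_le hε ξ) (norm_curveAdj_le hb ξ) (norm_nonneg _)
            (mul_nonneg (by positivity) (rho_pos ξ).le)
      _ = _ := by ring
  have hL2 := memLp_two_of_rho (by fun_prop) hbd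
  rw [memLp_two_iff_integrable_sq_norm hL2.aestronglyMeasurable] at hL2
  rw [lintegral_enorm_sq_eq hL2]
  set Φ : ℝ → ℝ → ℝ → ℂ := fun ξ t t' => (Real.exp (-(2 * ε) * ξ ^ 2) : ℂ) *
    ((phase (-(ξ * X t) + t * ξ ^ 2) * α t) *
      (starRingEnd ℂ) (phase (-(ξ * X t') + t' * ξ ^ 2) * α t')) with hΦ
  have hconj : Measurable fun z : ℂ => (starRingEnd ℂ) z := continuous_conj.measurable
  have hΦm : Measurable fun p : ℝ × ℝ × ℝ => Φ p.1 p.2.1 p.2.2 := by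
    simp only [hΦ]
    fun_prop
  have hΦb : ∀ ξ t t', ‖Φ ξ t t'‖ ≤ ((1 + (2 * ε)⁻¹) * D ^ 2) * (rho ξ * (rho t * rho t')) := by
    intro ξ t t'
    simp only [hΦ, norm_mul, RCLike.norm_conj, norm_phase, one_mul, Complex.norm_real,
      Real.norm_of_nonneg (Real.exp_pos _).le]
    calc _ ≤ ((1 + (2 * ε)⁻¹) * rho ξ) * ((D * rho t) * (D * rho t')) := by
          have h1 := exp_neg_mul_sq_le (by positivity : 0 < 2 * ε) ξ
          have h2 := (rho_pos t).le
          have h3 := (rho_pos ξ).le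
          have h4 := hb t
          have h5 := hb t'
          gcongr
      _ = _ := by ring
  have e1 : ∀ ξ, (Real.exp (-ε * ξ ^ 2) : ℂ) * curveAdj X α ξ *
      (starRingEnd ℂ) ((Real.exp (-ε * ξ ^ 2) : ℂ) * curveAdj X α ξ) = ∫ t, ∫ t', Φ ξ t t' := by
    intro ξ
    simp only [hΦ]
    simp_rw [integral_const_mul, integral_mul_const, integral_conj]
    rw [map_mul, Complex.conj_ofReal, show -(2 * ε) * ξ ^ 2 = -ε * ξ ^ 2 + -ε * ξ ^ 2 by ring,
      Real.exp_add]
    push_cast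
    simp only [curveAdj]
    ring
  simp_rw [e1]
  have sw1 : ∫ ξ, ∫ t, ∫ t', Φ ξ t t' = ∫ t, ∫ t', ∫ ξ, Φ ξ t t' := by
    rw [integral_swap_of_rho (D := (1 + (2 * ε)⁻¹) * D ^ 2 * rhoMass) (by fun_prop)]
    · refine integral_congr_ae (ae_of_all _ fun t => ?_)
      refine integral_swap_of_rho (D := (1 + (2 * ε)⁻¹) * D ^ 2 * rho t) (by fun_prop) ?_
      intro ξ t'
      refine (hΦb ξ t t').trans (le_of_eq (by ring))
    · intro ξ t
      refine (norm_integral_le_of_rho (D := (1 + (2 * ε)⁻¹) * D ^ 2 * (rho ξ * rho t)) ?_).trans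
        (le_of_eq (by ring))
      intro t'
      exact (hΦb ξ t t').trans (le_of_eq (by ring))
  rw [sw1]
  have hm2 : Measurable fun t => ∫⁻ t', ‖α t‖ₑ * ‖α t'‖ₑ * rieszK (t' - t) := by fun_prop
  rw [← lintegral_const_mul _ hm2]
  refine (enorm_integral_le_lintegral_enorm _).trans (lintegral_mono fun t => ?_)
  dsimp only
  rw [← lintegral_const_mul _ (by fun_prop)]
  refine (enorm_integral_le_lintegral_enorm _).trans (lintegral_mono_ae ?_)
  have hne : ∀ᵐ t' : ℝ, t' ≠ t := by
    simp [ae_iff]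
  filter_upwards [hne] with t' ht'
  have e2 : ∫ ξ, Φ ξ t t' = (α t * (starRingEnd ℂ) (α t')) *
      ∫ ξ : ℝ, phase (ξ * (X t' - X t) + (t - t') * ξ ^ 2) * (Real.exp (-(2 * ε) * ξ ^ 2) : ℂ) := by
    rw [← integral_const_mul]
    congr 1; ext ξ
    simp only [hΦ]
    rw [map_mul, conj_phase, show ξ * (X t' - X t) + (t - t') * ξ ^ 2 =
      (-(ξ * X t) + t * ξ ^ 2) + -(-(ξ * X t') + t' * ξ ^ 2) by ring,
      phase_add (-(ξ * X t) + t * ξ ^ 2)]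
    ring
  rw [e2, enorm_mul, enorm_mul, RCLike.enorm_conj]
  calc _ ≤ ‖α t‖ₑ * ‖α t'‖ₑ * (2 * rieszK (t - t')) := by
        gcongr
        exact enorm_regularised_kernel_le (by positivity) (sub_ne_zero.2 ht'.symm) _
    _ = _ := by rw [← rieszK_neg (t - t'), neg_sub]; ring

lemma tendsto_exp_neg_mul_sq (ξ : ℝ) :
    Filter.Tendsto (fun n : ℕ => (Real.exp (-(1 / ((n : ℝ) + 1)) * ξ ^ 2) : ℂ)) Filter.atTop
      (nhds 1) := by
  have h := (tendsto_one_div_add_atTop_nhds_zero_nat (𝕜 := ℝ)).neg.mul_const (ξ ^ 2)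
  have h2 := (Complex.continuous_ofReal.comp Real.continuous_exp).continuousAt.tendsto.comp h
  simpa [Function.comp_def] using h2

lemma lintegral_curveAdj_le {X : ℝ → ℝ} (hX : Measurable X) {α : ℝ → ℂ} {D : ℝ}
    (hα : Measurable α) (hb : ∀ t, ‖α t‖ ≤ D * rho t) :
    ∫⁻ ξ, ‖curveAdj X α ξ‖ₑ ^ 2 ≤ 2 * ∫⁻ t, ∫⁻ t', ‖α t‖ₑ * ‖α t'‖ₑ * rieszK (t' - t) := by
  refine (lintegral_congr fun ξ => ?_).trans_le ((lintegral_liminf_le (u := Filter.atTop)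
    (f := fun (n : ℕ) ξ => ‖(Real.exp (-(1 / ((n : ℝ) + 1)) * ξ ^ 2) : ℂ) * curveAdj X α ξ‖ₑ ^ 2)
    fun n => by fun_prop).trans ?_)
  · symm
    refine Filter.Tendsto.liminf_eq ?_
    have := ((tendsto_exp_neg_mul_sq ξ).mul_const (curveAdj X α ξ)).enorm
    rw [one_mul] at this
    exact ((ENNReal.continuous_pow 2).tendsto _).comp this
  · refine Filter.liminf_le_of_le (by isBoundedDefault) fun b hb' => ?_
    obtain ⟨n, hn⟩ := hb'.exists
    exact hn.trans (lintegral_regularised_curveAdj_le hX hα hb (by positivity))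

/-- The norm of `L^{4/3}(dt) L²(dη)`. -/
def testNorm (a : ℝ → ℝ → ℂ) : ℝ≥0∞ := (∫⁻ t, nTwo (a t) ^ (4 / 3 : ℝ)) ^ (3 / 4 : ℝ)

/-- The adjoint estimate `L^{4/3}(dt) L²(dη) → L²(dξ dη)`. -/
lemma lintegral_lintegral_curveAdj_le {X : ℝ → ℝ} (hX : Measurable X) {a : ℝ → ℝ → ℂ} {D : ℝ}
    (ha : Measurable fun p : ℝ × ℝ => a p.1 p.2) (hb : ∀ t η, ‖a t η‖ ≤ D * (rho t * rho η)) :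
    ∫⁻ η, ∫⁻ ξ, ‖curveAdj X (fun t => a t η) ξ‖ₑ ^ 2 ≤ (7 * testNorm a) ^ 2 := by
  calc ∫⁻ η, ∫⁻ ξ, ‖curveAdj X (fun t => a t η) ξ‖ₑ ^ 2
      ≤ ∫⁻ η, 2 * ∫⁻ t, ∫⁻ t', ‖a t η‖ₑ * ‖a t' η‖ₑ * rieszK (t' - t) := by
        refine lintegral_mono fun η => lintegral_curveAdj_le hX (D := D * rho η) (by fun_prop)
          fun t => (hb t η).trans (le_of_eq (by ring))
    _ = 2 * ∫⁻ t, ∫⁻ t', (∫⁻ η, ‖a t η‖ₑ * ‖a t' η‖ₑ) * rieszK (t' - t) := by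
        rw [lintegral_const_mul _ (by fun_prop), lintegral_lintegral_swap (by fun_prop)]
        congr 1
        refine lintegral_congr fun t => ?_
        rw [lintegral_lintegral_swap (by fun_prop)]
        refine lintegral_congr fun t' => ?_
        rw [lintegral_mul_const _ (by fun_prop)]
    _ ≤ 2 * ∫⁻ t, ∫⁻ t', nTwo (a t) * nTwo (a t') * rieszK (t' - t) := by
        gcongr with t t'
        exact lintegral_enorm_mul_le_nTwo (by fun_prop) (by fun_prop)
    _ ≤ 2 * (20 * (testNorm a * testNorm a)) := by
        gcongr
        exact hls (by fun_prop) (by fun_prop)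
    _ = 40 * testNorm a ^ 2 := by ring
    _ ≤ 49 * testNorm a ^ 2 := by gcongr; norm_num
    _ = (7 * testNorm a) ^ 2 := by ring

/-! ### Duality arguments -/

lemma le_pow_four_of_le_mul_rpow {Q B : ℝ≥0∞} (hQ : Q ≠ ∞) (h : Q ≤ B * Q ^ (3 / 4 : ℝ)) :
    Q ≤ B ^ 4 := by
  rcases eq_or_ne Q 0 with h0 | h0
  · rw [h0]; exact zero_le
  have h1 : Q ^ (1 / 4 : ℝ) ≤ B := by
    calc Q ^ (1 / 4 : ℝ) = Q * Q ^ (-(3 / 4) : ℝ) := by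
          nth_rewrite 2 [← ENNReal.rpow_one Q]
          rw [← ENNReal.rpow_add _ _ h0 hQ]; norm_num
      _ ≤ B * Q ^ (3 / 4 : ℝ) * Q ^ (-(3 / 4) : ℝ) := by gcongr
      _ = B := by rw [mul_assoc, ← ENNReal.rpow_add _ _ h0 hQ]; norm_num
  calc Q = (Q ^ (1 / 4 : ℝ)) ^ 4 := by
        rw [← ENNReal.rpow_natCast, ← ENNReal.rpow_mul]; norm_num
    _ ≤ B ^ 4 := by gcongr

lemma lintegral_pow_four_le_of_forall {φ : ℝ → ℝ≥0∞} (hφ : Measurable φ) {B : ℝ≥0∞}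
    (h : ∀ n : ℕ, ∫⁻ t in Set.Icc (-(n : ℝ)) n, min (φ t) n ^ 4 ≤ B) : ∫⁻ t, φ t ^ 4 ≤ B := by
  have e : ∀ n : ℕ, ∫⁻ t in Set.Icc (-(n : ℝ)) n, min (φ t) n ^ 4 =
      ∫⁻ t, (Set.Icc (-(n : ℝ)) n).indicator (fun t => min (φ t) n ^ 4) t := fun n => by
    rw [lintegral_indicator measurableSet_Icc]
  have hm : ∀ n : ℕ, Measurable ((Set.Icc (-(n : ℝ)) n).indicator (fun t => min (φ t) n ^ 4)) :=
    fun n => Measurable.indicator (by fun_prop) measurableSet_Icc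
  have key : ∀ t, φ t ^ 4 =
      Filter.liminf (fun n : ℕ => (Set.Icc (-(n : ℝ)) n).indicator (fun t => min (φ t) n ^ 4) t)
        Filter.atTop := by
    intro t
    symm
    refine Filter.Tendsto.liminf_eq ?_
    have h1 : Filter.Tendsto (fun n : ℕ => min (φ t) n ^ 4) Filter.atTop (nhds (φ t ^ 4)) := by
      have := (tendsto_const_nhds (x := φ t)).min ENNReal.tendsto_nat_nhds_top
      rw [min_eq_left le_top] at this
      exact ((ENNReal.continuous_pow 4).tendsto _).comp this
    refine h1.congr' ?_
    obtain ⟨N, hN⟩ := exists_nat_ge |t|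
    filter_upwards [Filter.eventually_ge_atTop N] with n hn
    rw [Set.indicator_of_mem]
    rw [Set.mem_Icc, ← abs_le]
    exact hN.trans (by exact_mod_cast hn)
  calc ∫⁻ t, φ t ^ 4 = _ := lintegral_congr key
    _ ≤ _ := lintegral_liminf_le hm
    _ ≤ B := by
      refine Filter.liminf_le_of_le (by isBoundedDefault) fun b hb' => ?_
      obtain ⟨n, hn⟩ := hb'.exists
      exact hn.trans ((e n).symm.trans_le (h n))

/-- Fractional integration `L^{4/3} → L⁴`. -/
lemma lintegral_rieszK_conv_le {f : ℝ → ℝ≥0∞} (hf : Measurable f) :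
    ∫⁻ s, (∫⁻ t, f t * rieszK (t - s)) ^ 4 ≤ (20 * (∫⁻ t, f t ^ (4 / 3 : ℝ)) ^ (3 / 4 : ℝ)) ^ 4 := by
  set φ : ℝ → ℝ≥0∞ := fun s => ∫⁻ t, f t * rieszK (t - s) with hφ
  have hφm : Measurable φ := by fun_prop
  refine lintegral_pow_four_le_of_forall hφm fun n => ?_
  set ψ : ℝ → ℝ≥0∞ := (Set.Icc (-(n : ℝ)) n).indicator (fun t => min (φ t) n) with hψ
  have hψm : Measurable ψ := Measurable.indicator (by fun_prop) measurableSet_Icc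
  have e : ∫⁻ t in Set.Icc (-(n : ℝ)) n, min (φ t) n ^ 4 = ∫⁻ t, ψ t ^ 4 := by
    rw [← lintegral_indicator measurableSet_Icc]
    refine lintegral_congr fun t => ?_
    simp only [hψ, Set.indicator_apply]; split_ifs <;> simp
  have fin : ∫⁻ t, ψ t ^ 4 ≠ ∞ := by
    rw [← e]
    refine ne_top_of_le_ne_top ?_ (lintegral_mono (g := fun _ => (n : ℝ≥0∞) ^ 4) fun t => ?_)
    · rw [setLIntegral_const, Real.volume_Icc]
      exact ENNReal.mul_ne_top (by simp) (by simp)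
    · dsimp only; gcongr; exact min_le_right _ _
  rw [e]
  refine le_pow_four_of_le_mul_rpow fin ?_
  have pe : ∀ t, (ψ t ^ 3) ^ (4 / 3 : ℝ) = ψ t ^ 4 := fun t => by
    rw [← ENNReal.rpow_natCast, ← ENNReal.rpow_natCast, ← ENNReal.rpow_mul]; norm_num
  calc ∫⁻ t, ψ t ^ 4 ≤ ∫⁻ s, ∫⁻ t, ψ s ^ 3 * f t * rieszK (t - s) := by
        refine lintegral_mono fun s => ?_
        have : ∫⁻ t, ψ s ^ 3 * f t * rieszK (t - s) = ψ s ^ 3 * φ s := by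
          simp_rw [mul_assoc]
          rw [lintegral_const_mul _ (by fun_prop)]
        dsimp only
        rw [this, pow_succ]
        gcongr
        simp only [hψ, Set.indicator_apply]; split_ifs
        · exact min_le_left _ _
        · exact zero_le
    _ ≤ _ := hls (by fun_prop) hf
    _ = _ := by simp_rw [pe]; ring

lemma measurable_conj_complex : Measurable fun z : ℂ => (starRingEnd ℂ) z :=
  continuous_conj.measurable

@[fun_prop] lemma Measurable.conj_complex {α : Type*} [MeasurableSpace α] {f : α → ℂ}
    (hf : Measurable f) : Measurable fun x => (starRingEnd ℂ) (f x) :=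
  measurable_conj_complex.comp hf

lemma nonneg_of_rho_bound {z : ℂ} {D x : ℝ} (h : ‖z‖ ≤ D * rho x) : 0 ≤ D :=
  nonneg_of_mul_nonneg_left ((norm_nonneg _).trans h) (rho_pos x)

lemma nTwo_le_of_rho {w : ℝ → ℂ} {D : ℝ} (hb : ∀ η, ‖w η‖ ≤ D * rho η) :
    nTwo w ≤ nTwo fun η => ((D * rho η : ℝ) : ℂ) := by
  unfold nTwo
  gcongr with η
  rw [← ofReal_norm, ← ofReal_norm]
  refine ENNReal.ofReal_le_ofReal ((hb η).trans ?_)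
  rw [Complex.norm_real]
  exact le_abs_self _

lemma nTwo_const_rho_ne_top (D : ℝ) : (nTwo fun η => ((D * rho η : ℝ) : ℂ)) ≠ ∞ := by
  rw [nTwo_eq_eLpNorm]
  refine (memLp_two_of_rho (D := |D|) (by fun_prop) fun η => ?_).eLpNorm_ne_top
  rw [Complex.norm_real, norm_mul, Real.norm_eq_abs, Real.norm_of_nonneg (rho_pos η).le]

lemma nTwo_ne_top_of_rho {w : ℝ → ℂ} {D : ℝ} (hb : ∀ η, ‖w η‖ ≤ D * rho η) : nTwo w ≠ ∞ :=
  ne_top_of_le_ne_top (nTwo_const_rho_ne_top D) (nTwo_le_of_rho hb)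

lemma nTwo_const_mul (c : ℂ) (w : ℝ → ℂ) : nTwo (fun η => c * w η) = ‖c‖ₑ * nTwo w := by
  simp only [nTwo_eq_eLpNorm]
  exact eLpNorm_const_smul c w 2 volume

/-- Duality: an `L⁴(dt) L²(dη)` bound follows from pairing against decaying test functions. -/
lemma lintegral_nTwo_pow_four_le_of_pairing {W : ℝ → ℝ → ℂ} {D : ℝ} {B : ℝ≥0∞}
    (hW : Measurable fun p : ℝ × ℝ => W p.1 p.2) (hb : ∀ t η, ‖W t η‖ ≤ D * rho η)
    (h : ∀ (a : ℝ → ℝ → ℂ) (E : ℝ), (Measurable fun p : ℝ × ℝ => a p.1 p.2) →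
      (∀ t η, ‖a t η‖ ≤ E * (rho t * rho η)) →
      ‖∫ t, ∫ η, W t η * (starRingEnd ℂ) (a t η)‖ₑ ≤ B * testNorm a) :
    ∫⁻ t, nTwo (W t) ^ 4 ≤ B ^ 4 := by
  have hD : 0 ≤ D := nonneg_of_rho_bound (hb 0 0)
  set K : ℝ := (nTwo fun η => ((D * rho η : ℝ) : ℂ)).toReal with hK
  set N : ℝ → ℝ := fun t => (nTwo (W t)).toReal with hN
  have hNK : ∀ t, N t ≤ K := fun t =>
    ENNReal.toReal_mono (nTwo_const_rho_ne_top D) (nTwo_le_of_rho (hb t))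
  have hN0 : ∀ t, 0 ≤ N t := fun t => ENNReal.toReal_nonneg
  have hNe : ∀ t, ‖((N t : ℝ) : ℂ)‖ₑ = nTwo (W t) := fun t => by
    rw [← ofReal_norm, Complex.norm_real, Real.norm_of_nonneg (hN0 t),
      ENNReal.ofReal_toReal (nTwo_ne_top_of_rho (hb t))]
  have hNm : Measurable N := by fun_prop
  refine lintegral_pow_four_le_of_forall (by fun_prop) fun n => ?_
  refine le_trans (lintegral_mono fun t => ?_) (b := ∫⁻ t in Set.Icc (-(n : ℝ)) n, nTwo (W t) ^ 4) ?_
  · dsimp only; gcongr; exact min_le_left _ _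
  set c : ℝ → ℝ := (Set.Icc (-(n : ℝ)) n).indicator N with hc
  have hcm : Measurable c := hNm.indicator measurableSet_Icc
  have hc0 : ∀ t, 0 ≤ c t := fun t => Set.indicator_nonneg (fun t _ => hN0 t) t
  have hcb : ∀ t, c t ≤ K * (1 + (n : ℝ) ^ 2) * rho t := by
    intro t
    have hK0 : 0 ≤ K := ENNReal.toReal_nonneg
    by_cases ht : t ∈ Set.Icc (-(n : ℝ)) n
    · rw [hc, Set.indicator_of_mem ht]
      have : 1 ≤ (1 + (n : ℝ) ^ 2) * rho t := by
        rw [rho, ← div_eq_mul_inv, le_div_iff₀ (by positivity)]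
        have := sq_le_sq' ht.1 ht.2
        linarith
      calc N t ≤ K * 1 := by rw [mul_one]; exact hNK t
        _ ≤ K * ((1 + (n : ℝ) ^ 2) * rho t) := by gcongr
        _ = _ := by ring
    · rw [hc, Set.indicator_of_notMem ht]
      have := (rho_pos t).le
      positivity
  have hcK : ∀ t, c t ≤ K := fun t => by
    simp only [hc, Set.indicator_apply]; split_ifs
    · exact hNK t
    · exact ENNReal.toReal_nonneg
  have hce : ∀ t, ‖((c t : ℝ) : ℂ)‖ₑ = (Set.Icc (-(n : ℝ)) n).indicator (fun t => nTwo (W t)) t := by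
    intro t
    simp only [hc, Set.indicator_apply]; split_ifs
    · exact hNe t
    · simp
  set G : ℝ × ℝ → ℂ := fun p => (c p.1 : ℂ) * W p.1 p.2 with hG
  set a : ℝ → ℝ → ℂ := fun t η => ((c t : ℂ) ^ 2) * W t η with ha
  have ham : Measurable fun p : ℝ × ℝ => a p.1 p.2 := by fun_prop
  have hab : ∀ t η, ‖a t η‖ ≤ (K * (K * (1 + (n : ℝ) ^ 2)) * D) * (rho t * rho η) := by
    intro t η
    simp only [ha, norm_mul, norm_pow, Complex.norm_real, Real.norm_of_nonneg (hc0 t)]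
    have h1 := hcb t
    have h2 := hcK t
    have h3 := hc0 t
    have h4 := hb t η
    calc c t ^ 2 * ‖W t η‖ = c t * c t * ‖W t η‖ := by ring
      _ ≤ K * (K * (1 + (n : ℝ) ^ 2) * rho t) * (D * rho η) := by
          have hK0 : 0 ≤ K := h3.trans h2
          have := (rho_pos t).le
          gcongr
      _ = _ := by ring
  have hGb : ∀ p, ‖G p‖ ^ 2 ≤ (K * (1 + (n : ℝ) ^ 2) * K * D ^ 2) * (rho p.1 * rho p.2) := by
    intro p
    simp only [hG, norm_mul, Complex.norm_real, Real.norm_of_nonneg (hc0 _)]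
    have h1 := hcb p.1
    have h2 := hcK p.1
    have h3 := hc0 p.1
    have h4 := hb p.1 p.2
    have h5 := rho_le_one p.2
    have h6 := (rho_pos p.2).le
    have h7 : 0 ≤ K := ENNReal.toReal_nonneg
    have h8 := (rho_pos p.1).le
    calc (c p.1 * ‖W p.1 p.2‖) ^ 2 = c p.1 * c p.1 * (‖W p.1 p.2‖ * ‖W p.1 p.2‖) := by ring
      _ ≤ (K * (1 + (n : ℝ) ^ 2) * rho p.1) * K * ((D * rho p.2) * (D * 1)) := by
          gcongr
          exact h4.trans (by gcongr)
      _ = _ := by ring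
  have hGm : Measurable G := by fun_prop
  have hGi : Integrable (fun p => ‖G p‖ ^ 2) := by
    refine (integrable_rho_prod.const_mul (K * (1 + (n : ℝ) ^ 2) * K * D ^ 2)).mono'
      (by fun_prop) (ae_of_all _ fun p => ?_)
    rw [Real.norm_of_nonneg (by positivity)]
    exact hGb p
  have hQ : ∫⁻ p, ‖G p‖ₑ ^ 2 = ∫⁻ t in Set.Icc (-(n : ℝ)) n, nTwo (W t) ^ 4 := by
    rw [Measure.volume_eq_prod, lintegral_prod _ (by fun_prop),
      ← lintegral_indicator measurableSet_Icc]
    refine lintegral_congr fun t => ?_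
    have : ∀ η, ‖G (t, η)‖ₑ ^ 2 = ‖(c t : ℂ)‖ₑ ^ 2 * ‖W t η‖ₑ ^ 2 := fun η => by
      rw [hG]; simp only [enorm_mul]; ring
    simp_rw [this]
    rw [lintegral_const_mul _ (by fun_prop), ← nTwo_sq, hce]
    simp only [Set.indicator_apply]; split_ifs
    · ring
    · simp
  have hfin : ∫⁻ p, ‖G p‖ₑ ^ 2 ≠ ∞ := by
    rw [lintegral_enorm_sq_eq hGi]; exact enorm_ne_top
  have hpair : ∫⁻ p, ‖G p‖ₑ ^ 2 = ‖∫ t, ∫ η, W t η * (starRingEnd ℂ) (a t η)‖ₑ := by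
    rw [lintegral_enorm_sq_eq hGi, Measure.volume_eq_prod, integral_prod]
    · congr 2; ext t; congr 1; ext η
      simp only [hG, ha, map_mul, map_pow, Complex.conj_ofReal]; ring
    · refine hGi.mono' (by fun_prop) (ae_of_all _ fun p => ?_)
      rw [norm_mul, RCLike.norm_conj, sq]
  have htest : testNorm a = (∫⁻ p, ‖G p‖ₑ ^ 2) ^ (3 / 4 : ℝ) := by
    rw [testNorm, hQ, ← lintegral_indicator measurableSet_Icc]
    congr 1
    refine lintegral_congr fun t => ?_
    rw [show nTwo (a t) = ‖(c t : ℂ) ^ 2‖ₑ * nTwo (W t) from nTwo_const_mul _ _, enorm_pow, hce]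
    simp only [Set.indicator_apply]; split_ifs
    · rw [← pow_succ, ← ENNReal.rpow_natCast, ← ENNReal.rpow_natCast, ← ENNReal.rpow_mul]
      norm_num
    · simp
  rw [← hQ]
  refine le_pow_four_of_le_mul_rpow hfin ?_
  rw [← htest, hpair]
  exact h a _ ham hab

/-! ### Linearising the supremum in `x` -/

/-- A measurable choice of a point among the first `n + 1` terms of a sequence that maximises `N t`. -/
def argmaxSeq (N : ℝ → ℝ → ℝ≥0∞) (q : ℕ → ℝ) : ℕ → ℝ → ℝ
  | 0, _ => q 0
  | n + 1, t => if N t (argmaxSeq N q n t) < N t (q (n + 1)) then q (n + 1) else argmaxSeq N q n t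

lemma measurable_argmaxSeq {N : ℝ → ℝ → ℝ≥0∞} (hN : Measurable fun p : ℝ × ℝ => N p.1 p.2)
    (q : ℕ → ℝ) (n : ℕ) : Measurable (argmaxSeq N q n) := by
  induction n with
  | zero => exact measurable_const
  | succ n ih =>
    exact Measurable.ite (measurableSet_lt (by fun_prop) (by fun_prop)) measurable_const ih

lemma le_argmaxSeq (N : ℝ → ℝ → ℝ≥0∞) (q : ℕ → ℝ) (t : ℝ) (n : ℕ) :
    N t (argmaxSeq N q n t) ≤ N t (argmaxSeq N q (n + 1) t) ∧
      N t (q n) ≤ N t (argmaxSeq N q n t) := by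
  have hs : ∀ n, N t (argmaxSeq N q (n + 1) t) =
      max (N t (argmaxSeq N q n t)) (N t (q (n + 1))) := by
    intro n
    simp only [argmaxSeq]
    split_ifs with h
    · exact (max_eq_right h.le).symm
    · exact (max_eq_left (not_lt.1 h)).symm
  refine ⟨by rw [hs]; exact le_max_left _ _, ?_⟩
  cases n with
  | zero => exact le_rfl
  | succ n => rw [hs]; exact le_max_right _ _

lemma lintegral_iSup_pow_four_le {N : ℝ → ℝ → ℝ≥0∞} {B : ℝ≥0∞}
    (hN : Measurable fun p : ℝ × ℝ => N p.1 p.2) (hc : ∀ t, Continuous (N t))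
    (h : ∀ X : ℝ → ℝ, Measurable X → ∫⁻ t, N t (X t) ^ 4 ≤ B) :
    ∫⁻ t, (⨆ x, N t x) ^ 4 ≤ B := by
  set q := TopologicalSpace.denseSeq ℝ
  have hq : DenseRange q := TopologicalSpace.denseRange_denseSeq ℝ
  have hmono : ∀ t, Monotone fun n => N t (argmaxSeq N q n t) := fun t =>
    monotone_nat_of_le_succ fun n => (le_argmaxSeq N q t n).1
  have hsup : ∀ t, (⨆ x, N t x) = ⨆ n, N t (argmaxSeq N q n t) := by
    intro t
    refine le_antisymm (iSup_le fun x => ?_) (iSup_le fun n => le_iSup (N t) _)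
    refine hq.induction_on (p := fun x => N t x ≤ ⨆ n, N t (argmaxSeq N q n t)) x
      (isClosed_le (hc t) continuous_const) fun n => ?_
    exact (le_argmaxSeq N q t n).2.trans (le_iSup (fun n => N t (argmaxSeq N q n t)) n)
  have hm : ∀ n, Measurable (argmaxSeq N q n) := measurable_argmaxSeq hN q
  have e : ∀ t, (⨆ x, N t x) ^ 4 = ⨆ n, N t (argmaxSeq N q n t) ^ 4 := by
    intro t
    rw [hsup t]
    have h1 := tendsto_atTop_iSup (hmono t)
    have h2 := ((ENNReal.continuous_pow 4).tendsto _).comp h1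
    have h3 := tendsto_atTop_iSup (f := fun n => N t (argmaxSeq N q n t) ^ 4)
      fun i j hij => pow_le_pow_left' (hmono t hij) 4
    exact tendsto_nhds_unique h2 h3
  simp_rw [e]
  rw [lintegral_iSup (fun n => by have := hm n; fun_prop)
    (fun i j hij t => pow_le_pow_left' (hmono t hij) 4)]
  exact iSup_le fun n => h _ (hm n)

lemma continuous_nTwo {w : ℝ → ℝ → ℂ} {D : ℝ} (hw : ∀ x, Measurable (w x))
    (hc : ∀ η, Continuous fun x => w x η) (hb : ∀ x η, ‖w x η‖ ≤ D * rho η) :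
    Continuous fun x => nTwo (w x) := by
  unfold nTwo
  refine (ENNReal.continuous_rpow_const).comp ?_
  rw [continuous_iff_continuousAt]
  intro x
  refine tendsto_lintegral_filter_of_dominated_convergence
    (fun η => ‖((D * rho η : ℝ) : ℂ)‖ₑ ^ 2) ?_ ?_ ?_ ?_
  · exact Filter.Eventually.of_forall fun y => by have := hw y; fun_prop
  · refine Filter.Eventually.of_forall fun y => ae_of_all _ fun η => ?_
    gcongr
    rw [← ofReal_norm, ← ofReal_norm]
    refine ENNReal.ofReal_le_ofReal ((hb y η).trans ?_)
    rw [Complex.norm_real]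
    exact le_abs_self _
  · rw [← nTwo_sq]
    exact ENNReal.pow_ne_top (nTwo_const_rho_ne_top D)
  · exact ae_of_all _ fun η => ((ENNReal.continuous_pow 2).tendsto _).comp ((hc η).tendsto x).enorm

/-- An `L⁴(dt) L^∞(dx) L²(dη)` bound follows from pairing along arbitrary measurable curves. -/
lemma lintegral_iSup_nTwo_pow_four_le {W : ℝ → ℝ → ℝ → ℂ} {D : ℝ} {B : ℝ≥0∞}
    (hW : Measurable fun p : ℝ × ℝ × ℝ => W p.1 p.2.1 p.2.2)
    (hb : ∀ t x η, ‖W t x η‖ ≤ D * rho η) (hc : ∀ t η, Continuous fun x => W t x η)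
    (h : ∀ X : ℝ → ℝ, Measurable X → ∀ (a : ℝ → ℝ → ℂ) (E : ℝ),
      (Measurable fun p : ℝ × ℝ => a p.1 p.2) → (∀ t η, ‖a t η‖ ≤ E * (rho t * rho η)) →
      ‖∫ t, ∫ η, W t (X t) η * (starRingEnd ℂ) (a t η)‖ₑ ≤ B * testNorm a) :
    ∫⁻ t, (⨆ x, nTwo (W t x)) ^ 4 ≤ B ^ 4 :=
  lintegral_iSup_pow_four_le (N := fun t x => nTwo (W t x)) (by fun_prop)
    (fun t => continuous_nTwo (fun x => by fun_prop) (hc t) (hb t)) fun X hX =>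
    lintegral_nTwo_pow_four_le_of_pairing (by fun_prop) (fun t η => hb t _ η) (h X hX)

/-! ### Mixed norms -/

/-- Mixed norm `L^k(dt) L^ℓ(dx)` of an extended nonnegative function. -/
def mixN (k l : ℝ≥0∞) (N : ℝ → ℝ → ℝ≥0∞) : ℝ≥0∞ :=
  eLpNorm (fun t => eLpNorm (N t) l volume) k volume

lemma eLpNorm_top_le_iSup (f : ℝ → ℝ≥0∞) : eLpNorm f ∞ volume ≤ ⨆ x, f x := by
  rw [eLpNorm_exponent_top]
  refine essSup_le_of_ae_le _ (ae_of_all _ fun x => ?_)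
  simpa using le_iSup f x

/-- Interpolation between `L^∞ L²` and `L⁴ L^∞`. -/
lemma mixN_le_of_endpoints {k l : ℝ≥0∞} (hk : 2 < k) (hl : 2 ≤ l) (hadm : 2 / k + 1 / l = 1 / 2)
    {N : ℝ → ℝ → ℝ≥0∞} {B : ℝ≥0∞} (hN : ∀ t, Measurable (N t)) (h2 : ∀ t, ∫⁻ x, N t x ^ 2 ≤ B ^ 2)
    (h4 : ∫⁻ t, (⨆ x, N t x) ^ 4 ≤ B ^ 4) : mixN k l N ≤ B := by
  rcases eq_or_ne B ∞ with hB | hB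
  · rw [hB]; exact le_top
  unfold mixN
  rcases eq_or_ne l ∞ with rfl | hlt
  · have hk4 : k = 4 := by
      have h : 2 / k = 1 / 2 := by simpa using hadm
      rcases eq_or_ne k ∞ with rfl | hkt
      · exact absurd h (by rw [ENNReal.div_top]; exact (ENNReal.div_pos (by simp) (by simp)).ne)
      rw [ENNReal.div_eq_div_iff (by norm_num) (by norm_num) (by positivity) hkt] at h
      rw [show (2 : ℝ≥0∞) * 2 = 4 by norm_num] at h
      rw [h]; simp
    subst hk4
    rw [eLpNorm_eq_lintegral_rpow_enorm_toReal (by norm_num) (by norm_num)]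
    calc _ ≤ ((B ^ 4)) ^ (1 / (4 : ℝ)) := by
          simp only [ENNReal.toReal_ofNat, enorm_eq_self]
          gcongr
          refine le_trans (lintegral_mono fun t => ?_) h4
          dsimp only
          rw [← ENNReal.rpow_natCast]
          push_cast
          gcongr
          exact eLpNorm_top_le_iSup _
      _ = B := by rw [← ENNReal.rpow_natCast, ← ENNReal.rpow_mul]; norm_num
  have two : ∀ t, eLpNorm (N t) 2 volume ≤ B := by
    intro t
    rw [eLpNorm_eq_lintegral_rpow_enorm_toReal (by norm_num) (by norm_num)]
    calc _ ≤ (B ^ 2) ^ (1 / 2 : ℝ) := by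
          simp only [ENNReal.toReal_ofNat, enorm_eq_self]
          gcongr
          simpa using h2 t
      _ = B := sq_rpow_half B
  rcases eq_or_ne k ∞ with rfl | hkt
  · have hl2 : l = 2 := by
      have h : 1 / l = 1 / 2 := by simpa using hadm
      simpa using h
    subst hl2
    rw [eLpNorm_exponent_top]
    exact essSup_le_of_ae_le _ (ae_of_all _ fun t => by simpa using two t)
  have hl0 : l ≠ 0 := (lt_of_lt_of_le (by norm_num) hl).ne'
  have hk0 : k ≠ 0 := (lt_trans (by norm_num) hk).ne'
  obtain ⟨p, rfl⟩ : ∃ p : ℝ≥0, l = p := ⟨l.toNNReal, (ENNReal.coe_toNNReal hlt).symm⟩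
  obtain ⟨r, rfl⟩ : ∃ r : ℝ≥0, k = r := ⟨k.toNNReal, (ENNReal.coe_toNNReal hkt).symm⟩
  have hp : (2 : ℝ) ≤ p := by exact_mod_cast hl
  have hr : (2 : ℝ) < r := by exact_mod_cast hk
  have hrel : 2 / (r : ℝ) + 1 / (p : ℝ) = 1 / 2 := by
    have := congrArg ENNReal.toReal hadm
    rw [ENNReal.toReal_add] at this
    · simpa using this
    · exact (ENNReal.div_lt_top (by norm_num) hk0).ne
    · exact (ENNReal.div_lt_top (by norm_num) hl0).ne
  have hrel' : 4 * (p : ℝ) + 2 * r = r * p := by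
    have h1 : (p : ℝ) ≠ 0 := by linarith
    have h2 : (r : ℝ) ≠ 0 := by linarith
    field_simp at hrel
    linarith
  have hr4 : (4 : ℝ) ≤ r := by nlinarith
  rw [eLpNorm_eq_lintegral_rpow_enorm_toReal hk0 hkt]
  have key : ∀ t, eLpNorm (N t) p volume ^ (r : ℝ) ≤ B ^ ((r : ℝ) - 4) * (⨆ x, N t x) ^ 4 := by
    intro t
    rw [eLpNorm_eq_lintegral_rpow_enorm_toReal hl0 hlt]
    simp only [enorm_eq_self, ENNReal.coe_toReal]
    have h1 : ∫⁻ x, N t x ^ (p : ℝ) ≤ (⨆ x, N t x) ^ ((p : ℝ) - 2) * B ^ 2 := by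
      calc ∫⁻ x, N t x ^ (p : ℝ) ≤ ∫⁻ x, (⨆ x, N t x) ^ ((p : ℝ) - 2) * N t x ^ 2 := by
            refine lintegral_mono fun x => ?_
            dsimp only
            calc N t x ^ (p : ℝ) = N t x ^ ((p : ℝ) - 2) * N t x ^ 2 := by
                  rw [← ENNReal.rpow_natCast, ← ENNReal.rpow_add_of_nonneg _ _ (by linarith)
                    (by norm_num)]
                  congr 1; norm_num
              _ ≤ _ := by
                  gcongr
                  exact le_iSup (N t) x
        _ ≤ (⨆ x, N t x) ^ ((p : ℝ) - 2) * ∫⁻ x, N t x ^ 2 := by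
            rw [lintegral_const_mul _ ((hN t).pow_const 2)]
        _ ≤ _ := by gcongr; exact h2 t
    calc ((∫⁻ x, N t x ^ (p : ℝ)) ^ (1 / (p : ℝ))) ^ (r : ℝ)
        ≤ (((⨆ x, N t x) ^ ((p : ℝ) - 2) * B ^ 2) ^ (1 / (p : ℝ))) ^ (r : ℝ) := by gcongr
      _ = _ := by
        rw [← ENNReal.rpow_mul, ENNReal.mul_rpow_of_nonneg _ _ (by positivity),
          ← ENNReal.rpow_natCast, ← ENNReal.rpow_natCast, ← ENNReal.rpow_mul, ← ENNReal.rpow_mul,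
          mul_comm]
        have h1 : (p : ℝ) ≠ 0 := by linarith
        congr 2
        · push_cast; field_simp; linarith
        · push_cast; field_simp; linarith
  calc _ ≤ (B ^ ((r : ℝ) - 4) * B ^ 4) ^ (1 / (r : ℝ)) := by
        simp only [enorm_eq_self, ENNReal.coe_toReal]
        gcongr
        refine (lintegral_mono key).trans ?_
        rw [lintegral_const_mul' _ _ (ENNReal.rpow_ne_top_of_nonneg (by linarith) hB)]
        gcongr
    _ = B := by
        rw [← ENNReal.rpow_natCast, ← ENNReal.rpow_add_of_nonneg _ _ (by linarith) (by norm_num),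
          ← ENNReal.rpow_mul]
        have h2 : (r : ℝ) ≠ 0 := by linarith
        rw [show ((r : ℝ) - 4 + (4 : ℕ)) * (1 / r) = 1 by push_cast; field_simp; ring]
        exact ENNReal.rpow_one B

/-! ### Free evolution in the first variable -/

lemma integral_rotate_of_rho {f : ℝ → ℝ → ℝ → ℂ} {D : ℝ}
    (hf : Measurable fun p : ℝ × ℝ × ℝ => f p.1 p.2.1 p.2.2)
    (hb : ∀ x y z, ‖f x y z‖ ≤ D * (rho x * (rho y * rho z))) :
    ∫ x, ∫ y, ∫ z, f x y z = ∫ y, ∫ z, ∫ x, f x y z := by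
  rw [integral_swap_of_rho (D := D * rhoMass) (by fun_prop)]
  · refine integral_congr_ae (ae_of_all _ fun y => ?_)
    exact integral_swap_of_rho (D := D * rho y) (by fun_prop)
      fun x z => (hb x y z).trans (le_of_eq (by ring))
  · intro x y
    refine (norm_integral_le_of_rho (D := D * (rho x * rho y)) fun z => ?_).trans
      (le_of_eq (by ring))
    exact (hb x y z).trans (le_of_eq (by ring))

lemma L2K_sq {g : ℝ → ℝ → ℂ} (hg : Measurable fun p : ℝ × ℝ => g p.1 p.2) :
    L2K g ^ 2 = ∫⁻ η, ∫⁻ ξ, ‖g ξ η‖ₑ ^ 2 := by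
  unfold L2K
  rw [eLpNorm_eq_lintegral_rpow_enorm_toReal (by norm_num) (by norm_num)]
  simp only [ENNReal.toReal_ofNat, ENNReal.rpow_ofNat]
  rw [rpow_half_sq, Measure.volume_eq_prod, lintegral_prod_symm' _ (by fun_prop)]

lemma enorm_integral_mul_conj_le_L2K {g b : ℝ → ℝ → ℂ}
    (hg : Measurable fun p : ℝ × ℝ => g p.1 p.2) (hb : Measurable fun p : ℝ × ℝ => b p.1 p.2) :
    ‖∫ η, ∫ ξ, g ξ η * (starRingEnd ℂ) (b ξ η)‖ₑ ≤ L2K g * L2K b := by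
  calc _ ≤ ∫⁻ η, ∫⁻ ξ, ‖g ξ η‖ₑ * ‖b ξ η‖ₑ := by
        refine (enorm_integral_le_lintegral_enorm _).trans (lintegral_mono fun η => ?_)
        refine (enorm_integral_le_lintegral_enorm _).trans (lintegral_mono fun ξ => ?_)
        simp only [enorm_mul, RCLike.enorm_conj, le_refl]
    _ = ∫⁻ p : ℝ × ℝ, ‖g p.1 p.2‖ₑ * ‖b p.1 p.2‖ₑ := by
        rw [Measure.volume_eq_prod, lintegral_prod_symm' _ (by fun_prop)]
    _ ≤ _ := by
        refine (lintegral_mul_le_sqrt_mul_sqrt (by fun_prop) (by fun_prop)).trans (le_of_eq ?_)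
        unfold L2K
        rw [eLpNorm_eq_lintegral_rpow_enorm_toReal (by norm_num) (by norm_num),
          eLpNorm_eq_lintegral_rpow_enorm_toReal (by norm_num) (by norm_num)]
        simp

/-- Free Schrödinger evolution in the first variable, on the Fourier side, of time-dependent data. -/
def evol (G : ℝ → ℝ → ℝ → ℂ) (t x η : ℝ) : ℂ := ∫ ξ, phase (ξ * x - t * ξ ^ 2) * G t ξ η

lemma evol_eq_invFI (G : ℝ → ℝ → ℝ → ℂ) (t x η : ℝ) :
    evol G t x η = invFI (fun ξ => phase (-(t * ξ ^ 2)) * G t ξ η) x := by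
  unfold evol invFI
  congr 1; ext ξ
  rw [sub_eq_add_neg, phase_add, mul_assoc]

lemma measurable_evol {G : ℝ → ℝ → ℝ → ℂ} (hG : Measurable fun p : ℝ × ℝ × ℝ => G p.1 p.2.1 p.2.2) :
    Measurable fun p : ℝ × ℝ × ℝ => evol G p.1 p.2.1 p.2.2 := by
  unfold evol; fun_prop

lemma norm_evol_le {G : ℝ → ℝ → ℝ → ℂ} {D : ℝ} (hb : ∀ t ξ η, ‖G t ξ η‖ ≤ D * (rho ξ * rho η))
    (t x η : ℝ) : ‖evol G t x η‖ ≤ D * rhoMass * rho η := by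
  refine (norm_integral_le_of_rho (D := D * rho η) fun ξ => ?_).trans (le_of_eq (by ring))
  rw [norm_mul, norm_phase, one_mul]
  exact (hb t ξ η).trans (le_of_eq (by ring))

lemma continuous_evol {G : ℝ → ℝ → ℝ → ℂ} {D : ℝ}
    (hG : Measurable fun p : ℝ × ℝ × ℝ => G p.1 p.2.1 p.2.2)
    (hb : ∀ t ξ η, ‖G t ξ η‖ ≤ D * (rho ξ * rho η)) (t η : ℝ) :
    Continuous fun x => evol G t x η := by
  simp_rw [evol_eq_invFI]
  refine continuous_invFI (integrable_of_rho (D := D * rho η) (by fun_prop) fun ξ => ?_)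
  rw [norm_mul, norm_phase, one_mul]
  exact (hb t ξ η).trans (le_of_eq (by ring))

@[fun_prop] lemma measurable_invFI {α : Type*} [MeasurableSpace α] {g : α → ℝ → ℂ} {x : α → ℝ}
    (hg : Measurable fun p : α × ℝ => g p.1 p.2) (hx : Measurable x) :
    Measurable fun a => invFI (g a) (x a) := by
  unfold invFI; fun_prop

lemma lintegral_nTwo_invFI_sq {g : ℝ → ℝ → ℂ} {D : ℝ} (hg : Measurable fun p : ℝ × ℝ => g p.1 p.2)
    (hb : ∀ ξ η, ‖g ξ η‖ ≤ D * (rho ξ * rho η)) :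
    ∫⁻ x, nTwo (fun η => invFI (fun ξ => g ξ η) x) ^ 2 = ENNReal.ofReal (2 * π) * L2K g ^ 2 := by
  simp_rw [nTwo_sq]
  have hm : Measurable fun p : ℝ × ℝ => invFI (fun ξ => g ξ p.2) p.1 := by fun_prop
  rw [lintegral_lintegral_swap (hm.enorm.pow_const 2).aemeasurable, L2K_sq hg, ← lintegral_const_mul _ (by fun_prop)]
  refine lintegral_congr fun η => ?_
  have hb' : ∀ ξ, ‖g ξ η‖ ≤ (D * rho η) * rho ξ := fun ξ => (hb ξ η).trans (le_of_eq (by ring))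
  exact lintegral_invFI_sq _ (integrable_of_rho (by fun_prop) hb') (memLp_two_of_rho (by fun_prop) hb')

lemma two_pi_le : ENNReal.ofReal (2 * π) ≤ 7 ^ 2 := by
  rw [ENNReal.ofReal_le_iff_le_toReal (by simp)]
  have := Real.pi_le_four
  norm_num; linarith

lemma L2K_phase_mul (φ : ℝ → ℝ → ℝ) (g : ℝ → ℝ → ℂ) :
    L2K (fun ξ η => phase (φ ξ η) * g ξ η) = L2K g := by
  unfold L2K
  refine eLpNorm_congr_norm_ae (ae_of_all _ fun p => ?_)
  simp

lemma lintegral_nTwo_evol_sq_le {G : ℝ → ℝ → ℝ → ℂ} {D : ℝ}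
    (hG : Measurable fun p : ℝ × ℝ × ℝ => G p.1 p.2.1 p.2.2)
    (hb : ∀ t ξ η, ‖G t ξ η‖ ≤ D * (rho ξ * rho η)) (t : ℝ) :
    ∫⁻ x, nTwo (evol G t x) ^ 2 ≤ (7 * L2K (G t)) ^ 2 := by
  have e : ∀ x, evol G t x = fun η => invFI (fun ξ => phase (-(t * ξ ^ 2)) * G t ξ η) x :=
    fun x => funext fun η => evol_eq_invFI G t x η
  simp_rw [e]
  rw [lintegral_nTwo_invFI_sq (D := D) (g := fun ξ η => phase (-(t * ξ ^ 2)) * G t ξ η)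
    (by fun_prop) (fun ξ η => by simpa using hb t ξ η),
    L2K_phase_mul (fun ξ _ => -(t * ξ ^ 2)), mul_pow]
  gcongr
  exact two_pi_le

lemma L2K_le_of_lintegral {g : ℝ → ℝ → ℂ} {B : ℝ≥0∞} (hg : Measurable fun p : ℝ × ℝ => g p.1 p.2)
    (h : ∫⁻ η, ∫⁻ ξ, ‖g ξ η‖ₑ ^ 2 ≤ B ^ 2) : L2K g ≤ B :=
  ennreal_le_of_sq_le_sq ((L2K_sq hg).trans_le h)

lemma evol_pairing_eq {X : ℝ → ℝ} (hX : Measurable X) {G : ℝ → ℝ → ℝ → ℂ} {D E : ℝ}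
    (hG : Measurable fun p : ℝ × ℝ × ℝ => G p.1 p.2.1 p.2.2)
    (hb : ∀ t ξ η, ‖G t ξ η‖ ≤ D * (rho ξ * rho η)) {a : ℝ → ℝ → ℂ}
    (ha : Measurable fun p : ℝ × ℝ => a p.1 p.2) (hab : ∀ t η, ‖a t η‖ ≤ E * (rho t * rho η)) :
    ∫ t, ∫ η, evol G t (X t) η * (starRingEnd ℂ) (a t η) = ∫ η, ∫ ξ, ∫ t, G t ξ η *
      (starRingEnd ℂ) (phase (-(ξ * X t) + t * ξ ^ 2) * a t η) := by
  have hD : 0 ≤ D := nonneg_of_mul_nonneg_left ((norm_nonneg _).trans (hb 0 0 0))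
    (mul_pos (rho_pos 0) (rho_pos 0))
  have hE : 0 ≤ E := nonneg_of_mul_nonneg_left ((norm_nonneg _).trans (hab 0 0))
    (mul_pos (rho_pos 0) (rho_pos 0))
  rw [← integral_rotate_of_rho (D := D * E) (by fun_prop)]
  · refine integral_congr_ae (ae_of_all _ fun t => integral_congr_ae (ae_of_all _ fun η => ?_))
    dsimp only
    unfold evol
    rw [← integral_mul_const]
    congr 1; ext ξ
    rw [map_mul, conj_phase, show -(-(ξ * X t) + t * ξ ^ 2) = ξ * X t - t * ξ ^ 2 by ring]
    ring
  · intro t η ξ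
    rw [norm_mul, RCLike.norm_conj, norm_mul, norm_phase, one_mul]
    have h1 := rho_pos t
    have h2 := rho_pos ξ
    have h3 := rho_pos η
    calc _ ≤ (D * (rho ξ * rho η)) * (E * (rho t * rho η)) :=
          mul_le_mul (hb _ _ _) (hab _ _) (norm_nonneg _) (by positivity)
      _ = (D * E * (rho t * (rho η * rho ξ))) * rho η := by ring
      _ ≤ _ := mul_le_of_le_one_right (by positivity) (rho_le_one η)

lemma enorm_evol_pairing_le {X : ℝ → ℝ} (hX : Measurable X) {g : ℝ → ℝ → ℂ} {D E : ℝ}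
    (hg : Measurable fun p : ℝ × ℝ => g p.1 p.2)
    (hb : ∀ ξ η, ‖g ξ η‖ ≤ D * (rho ξ * rho η)) {a : ℝ → ℝ → ℂ}
    (ha : Measurable fun p : ℝ × ℝ => a p.1 p.2) (hab : ∀ t η, ‖a t η‖ ≤ E * (rho t * rho η)) :
    ‖∫ t, ∫ η, evol (fun _ => g) t (X t) η * (starRingEnd ℂ) (a t η)‖ₑ
      ≤ 7 * L2K g * testNorm a := by
  rw [evol_pairing_eq hX (by fun_prop) (fun _ => hb) ha hab]
  have e : ∀ η ξ, ∫ t, g ξ η * (starRingEnd ℂ) (phase (-(ξ * X t) + t * ξ ^ 2) * a t η)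
      = g ξ η * (starRingEnd ℂ) (curveAdj X (fun t => a t η) ξ) := fun η ξ => by
    rw [integral_const_mul, integral_conj]; rfl
  simp_rw [e]
  have hm : Measurable fun p : ℝ × ℝ => curveAdj X (fun t => a t p.2) p.1 := by
    unfold curveAdj; fun_prop
  refine (enorm_integral_mul_conj_le_L2K hg hm).trans ?_
  calc _ ≤ L2K g * (7 * testNorm a) := by
        gcongr
        exact L2K_le_of_lintegral hm (lintegral_lintegral_curveAdj_le hX ha hab)
    _ = _ := by ring

/-! ### Hölder's inequality for mixed norms -/

lemma lintegral_mul_le_of_exponent_top {f g : ℝ → ℝ≥0∞} (hg : Measurable g) :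
    ∫⁻ x, f x * g x ≤ eLpNorm f ∞ volume * eLpNorm g 1 volume := by
  rw [eLpNorm_one_eq_lintegral_enorm, eLpNorm_exponent_top]
  simp only [enorm_eq_self]
  rw [← lintegral_const_mul _ hg]
  refine lintegral_mono_ae ?_
  filter_upwards [ENNReal.ae_le_essSup f] with x hx
  gcongr
  simpa [eLpNormEssSup] using hx

lemma lintegral_mul_le_eLpNorm {p q : ℝ≥0∞} (hpq : 1 / p + 1 / q = 1) {f g : ℝ → ℝ≥0∞}
    (hf : Measurable f) (hg : Measurable g) :
    ∫⁻ x, f x * g x ≤ eLpNorm f p volume * eLpNorm g q volume := by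
  have hp0 : p ≠ 0 := by rintro rfl; simp at hpq
  have hq0 : q ≠ 0 := by rintro rfl; simp at hpq
  rcases eq_or_ne p ∞ with rfl | hp
  · obtain rfl : q = 1 := by simpa using hpq
    exact lintegral_mul_le_of_exponent_top hg
  rcases eq_or_ne q ∞ with rfl | hq
  · obtain rfl : p = 1 := by simpa using hpq
    simp_rw [mul_comm (f _)]
    rw [mul_comm]
    exact lintegral_mul_le_of_exponent_top hf
  rw [eLpNorm_eq_lintegral_rpow_enorm_toReal hp0 hp, eLpNorm_eq_lintegral_rpow_enorm_toReal hq0 hq]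
  simp only [enorm_eq_self]
  refine ENNReal.lintegral_mul_le_Lp_mul_Lq volume ?_ hf.aemeasurable hg.aemeasurable
  rw [Real.holderConjugate_iff]
  have h1 : p.toReal⁻¹ + q.toReal⁻¹ = 1 := by
    have := congrArg ENNReal.toReal hpq
    rw [ENNReal.toReal_add (by simpa using hp0) (by simpa using hq0)] at this
    simpa using this
  have hqp : 0 < q.toReal := ENNReal.toReal_pos hq0 hq
  have hpp : 0 < p.toReal := ENNReal.toReal_pos hp0 hp
  refine ⟨?_, h1⟩
  have h2 : p.toReal⁻¹ < 1 := by linarith [inv_pos.2 hqp]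
  exact (inv_lt_one₀ hpp).1 h2

lemma measurable_eLpNorm_slice {N : ℝ → ℝ → ℝ≥0∞} (hN : Measurable fun p : ℝ × ℝ => N p.1 p.2)
    (l : ℝ≥0∞) : Measurable fun t => eLpNorm (N t) l volume := by
  rcases eq_or_ne l 0 with rfl | h0
  · simp
  rcases eq_or_ne l ∞ with rfl | hl
  · refine measurable_of_Iic fun c => ?_
    have e : (fun t => eLpNorm (N t) ∞ volume) ⁻¹' Set.Iic c =
        (fun t => volume (Prod.mk t ⁻¹' {p : ℝ × ℝ | c < N p.1 p.2})) ⁻¹' {0} := by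
      ext t
      simp only [Set.mem_preimage, Set.mem_Iic, Set.mem_singleton_iff, eLpNorm_exponent_top,
        eLpNormEssSup, enorm_eq_self]
      constructor
      · intro h
        have : ∀ᵐ x, N t x ≤ c := (ENNReal.ae_le_essSup (N t)).mono fun x hx => hx.trans h
        rw [ae_iff] at this
        simpa using this
      · intro h
        refine essSup_le_of_ae_le _ ?_
        rw [Filter.EventuallyLE, ae_iff]
        simpa using h
    rw [e]
    exact measurable_measure_prodMk_left (measurableSet_lt measurable_const hN)
      (measurableSet_singleton 0)
  simp_rw [eLpNorm_eq_lintegral_rpow_enorm_toReal h0 hl, enorm_eq_self]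
  fun_prop

lemma lintegral_lintegral_mul_le_mixN {p q r s : ℝ≥0∞} (hpq : 1 / p + 1 / q = 1)
    (hrs : 1 / r + 1 / s = 1) {M N : ℝ → ℝ → ℝ≥0∞} (hM : Measurable fun p : ℝ × ℝ => M p.1 p.2)
    (hN : Measurable fun p : ℝ × ℝ => N p.1 p.2) :
    ∫⁻ t, ∫⁻ x, M t x * N t x ≤ mixN p r M * mixN q s N :=
  (lintegral_mono fun t => lintegral_mul_le_eLpNorm hrs (by fun_prop) (by fun_prop)).trans
    (lintegral_mul_le_eLpNorm hpq (measurable_eLpNorm_slice hM r) (measurable_eLpNorm_slice hN s))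

/-- The `L²(dη)` norm of the inverse Fourier transform in the first variable. -/
def invN (g : ℝ → ℝ → ℝ → ℂ) (s x : ℝ) : ℝ≥0∞ := nTwo fun η => invFI (fun ξ => g s ξ η) x

lemma measurable_invN {g : ℝ → ℝ → ℝ → ℂ}
    (hg : Measurable fun p : ℝ × ℝ × ℝ => g p.1 p.2.1 p.2.2) :
    Measurable fun p : ℝ × ℝ => invN g p.1 p.2 := by
  unfold invN; fun_prop

/-- Parseval combined with Hölder's inequality. -/
lemma enorm_pairing_le_mixN {p q r s : ℝ≥0∞} (hpq : 1 / p + 1 / q = 1)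
    (hrs : 1 / r + 1 / s = 1) {g b : ℝ → ℝ → ℝ → ℂ} {D E : ℝ}
    (hg : Measurable fun p : ℝ × ℝ × ℝ => g p.1 p.2.1 p.2.2)
    (hb : Measurable fun p : ℝ × ℝ × ℝ => b p.1 p.2.1 p.2.2)
    (hgb : ∀ t ξ η, ‖g t ξ η‖ ≤ D * (rho ξ * rho η))
    (hbb : ∀ t ξ η, ‖b t ξ η‖ ≤ E * (rho ξ * rho η)) :
    ‖∫ t, ∫ η, ∫ ξ, g t ξ η * (starRingEnd ℂ) (b t ξ η)‖ₑ
      ≤ mixN p r (invN g) * mixN q s (invN b) := by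
  have hpi : (1 : ℝ≥0∞) ≤ ‖(2 * (π : ℂ))‖ₑ := by
    rw [← ofReal_norm, ENNReal.one_le_ofReal]
    simp only [norm_mul, Complex.norm_real, Complex.norm_ofNat, Real.norm_of_nonneg Real.pi_pos.le]
    linarith [Real.pi_gt_three]
  refine le_trans ?_ (lintegral_lintegral_mul_le_mixN hpq hrs (measurable_invN hg)
    (measurable_invN hb))
  refine (enorm_integral_le_lintegral_enorm _).trans (lintegral_mono fun t => ?_)
  have e : ∀ η, ∫ ξ, g t ξ η * (starRingEnd ℂ) (b t ξ η) = (2 * (π : ℂ))⁻¹ *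
      ∫ x, invFI (fun ξ => g t ξ η) x * (starRingEnd ℂ) (invFI (fun ξ => b t ξ η) x) := by
    intro η
    have h1 : ∀ ξ, ‖g t ξ η‖ ≤ D * rho η * rho ξ := fun ξ => (hgb t ξ η).trans (le_of_eq (by ring))
    have h2 : ∀ ξ, ‖b t ξ η‖ ≤ E * rho η * rho ξ := fun ξ => (hbb t ξ η).trans (le_of_eq (by ring))
    rw [integral_invFI_mul_conj _ _ (integrable_of_rho (by fun_prop) h1)
      (memLp_two_of_rho (by fun_prop) h1) (integrable_of_rho (by fun_prop) h2)
      (memLp_two_of_rho (by fun_prop) h2), ← mul_assoc, inv_mul_cancel₀, one_mul]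
    simp [Real.pi_ne_zero]
  simp_rw [e]
  rw [integral_const_mul, enorm_mul]
  have hpi' : ‖(2 * (π : ℂ))⁻¹‖ₑ ≤ 1 := by
    rw [enorm_inv (by simp [Real.pi_ne_zero])]
    exact ENNReal.inv_le_one.2 hpi
  calc _ ≤ 1 * ∫⁻ η, ∫⁻ x, ‖invFI (fun ξ => g t ξ η) x‖ₑ * ‖invFI (fun ξ => b t ξ η) x‖ₑ := by
        gcongr
        refine (enorm_integral_le_lintegral_enorm _).trans (lintegral_mono fun η => ?_)
        refine (enorm_integral_le_lintegral_enorm _).trans (lintegral_mono fun x => ?_)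
        simp only [enorm_mul, RCLike.enorm_conj, le_refl]
    _ ≤ _ := by
        rw [one_mul, lintegral_lintegral_swap (by fun_prop)]
        exact lintegral_mono fun x => lintegral_enorm_mul_le_nTwo (by fun_prop) (by fun_prop)

/-! ### Homogeneous and retarded estimates -/

lemma mixN_mono {k l : ℝ≥0∞} {M N : ℝ → ℝ → ℝ≥0∞} (h : ∀ t x, M t x ≤ N t x) :
    mixN k l M ≤ mixN k l N :=
  eLpNorm_mono_enorm fun t => by
    simpa using eLpNorm_mono_enorm (p := l) (μ := (volume : Measure ℝ)) fun x => by simpa using h t x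

lemma mixN_evol_le {k l : ℝ≥0∞} (hk : 2 < k) (hl : 2 ≤ l) (hadm : 2 / k + 1 / l = 1 / 2)
    {g : ℝ → ℝ → ℂ} {D : ℝ} (hg : Measurable fun p : ℝ × ℝ => g p.1 p.2)
    (hb : ∀ ξ η, ‖g ξ η‖ ≤ D * (rho ξ * rho η)) :
    mixN k l (fun t x => nTwo (evol (fun _ => g) t x)) ≤ 7 * L2K g := by
  have hm := measurable_evol (G := fun _ => g) (by fun_prop)
  refine mixN_le_of_endpoints hk hl hadm (fun t => by fun_prop)
    (lintegral_nTwo_evol_sq_le (by fun_prop) fun _ => hb)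
    (lintegral_iSup_nTwo_pow_four_le hm (norm_evol_le fun _ => hb)
      (continuous_evol (by fun_prop) fun _ => hb) fun X hX a E ha hab =>
        enorm_evol_pairing_le hX hg hb ha hab)

/-- The Duhamel integral in the interaction picture, with a bounded time weight `κ`. -/
def duh (κ : ℝ → ℝ → ℝ) (g : ℝ → ℝ → ℝ → ℂ) (t ξ η : ℝ) : ℂ :=
  ∫ s, (κ t s : ℂ) * (phase (s * ξ ^ 2) * g s ξ η)

lemma measurable_duh {κ : ℝ → ℝ → ℝ} {g : ℝ → ℝ → ℝ → ℂ}
    (hκ : Measurable fun p : ℝ × ℝ => κ p.1 p.2)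
    (hg : Measurable fun p : ℝ × ℝ × ℝ => g p.1 p.2.1 p.2.2) :
    Measurable fun p : ℝ × ℝ × ℝ => duh κ g p.1 p.2.1 p.2.2 := by
  unfold duh; fun_prop

lemma norm_duh_integrand_le {κ : ℝ → ℝ → ℝ} {g : ℝ → ℝ → ℝ → ℂ} {D : ℝ} (hκ1 : ∀ t s, |κ t s| ≤ 1)
    (hgb : ∀ s ξ η, ‖g s ξ η‖ ≤ D * (rho s * (rho ξ * rho η))) (t s ξ η : ℝ) :
    ‖(κ t s : ℂ) * (phase (s * ξ ^ 2) * g s ξ η)‖ ≤ D * (rho s * (rho ξ * rho η)) := by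
  rw [norm_mul, norm_mul, norm_phase, one_mul, Complex.norm_real, Real.norm_eq_abs]
  exact (mul_le_of_le_one_left (norm_nonneg _) (hκ1 t s)).trans (hgb s ξ η)

lemma norm_duh_le {κ : ℝ → ℝ → ℝ} {g : ℝ → ℝ → ℝ → ℂ} {D : ℝ} (hκ1 : ∀ t s, |κ t s| ≤ 1)
    (hgb : ∀ s ξ η, ‖g s ξ η‖ ≤ D * (rho s * (rho ξ * rho η))) (t ξ η : ℝ) :
    ‖duh κ g t ξ η‖ ≤ D * rhoMass * (rho ξ * rho η) :=
  (norm_integral_le_of_rho (D := D * (rho ξ * rho η)) fun s =>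
    (norm_duh_integrand_le hκ1 hgb t s ξ η).trans (le_of_eq (by ring))).trans (le_of_eq (by ring))

lemma L2K_ne_top_of_rho {g : ℝ → ℝ → ℂ} {D : ℝ} (hg : Measurable fun p : ℝ × ℝ => g p.1 p.2)
    (hb : ∀ ξ η, ‖g ξ η‖ ≤ D * (rho ξ * rho η)) : L2K g ≠ ∞ := by
  refine (MemLp.eLpNorm_lt_top (p := 2) ?_).ne
  rw [memLp_two_iff_integrable_sq_norm hg.aestronglyMeasurable]
  refine (integrable_rho_prod.const_mul (D ^ 2)).mono' (by fun_prop) (ae_of_all _ fun p => ?_)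
  rw [Real.norm_of_nonneg (by positivity)]
  have h1 := rho_pos p.1
  have h2 := rho_pos p.2
  calc ‖g p.1 p.2‖ ^ 2 ≤ (D * (rho p.1 * rho p.2)) ^ 2 := by gcongr; exact hb _ _
    _ = D ^ 2 * (rho p.1 * rho p.2) * (rho p.1 * rho p.2) := by ring
    _ ≤ _ := mul_le_of_le_one_right (by positivity)
      (mul_le_one₀ (rho_le_one _) h2.le (rho_le_one _))

lemma rho_bound_mono {g D : ℝ} (hD : 0 ≤ D) (s : ℝ) {c : ℝ} (hc : 0 ≤ c)
    (h : g ≤ D * (rho s * c)) : g ≤ D * c :=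
  h.trans (mul_le_mul_of_nonneg_left (mul_le_of_le_one_left hc (rho_le_one s)) hD)

lemma const_nonneg_of_rho₂ {D a : ℝ} (h : ‖a‖ ≤ D * (rho 0 * rho 0)) : 0 ≤ D :=
  nonneg_of_mul_nonneg_left ((norm_nonneg _).trans h) (mul_pos (rho_pos 0) (rho_pos 0))

/-- Energy estimate for the Duhamel term. -/
lemma L2K_duh_le {kt lt kt' lt' : ℝ≥0∞} (hkt : 2 < kt) (hlt : 2 ≤ lt)
    (hadmt : 2 / kt + 1 / lt = 1 / 2) (hconjk : 1 / kt + 1 / kt' = 1)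
    (hconjl : 1 / lt + 1 / lt' = 1) {κ : ℝ → ℝ → ℝ} {g : ℝ → ℝ → ℝ → ℂ} {D : ℝ}
    (hκ : Measurable fun p : ℝ × ℝ => κ p.1 p.2) (hκ1 : ∀ t s, |κ t s| ≤ 1)
    (hg : Measurable fun p : ℝ × ℝ × ℝ => g p.1 p.2.1 p.2.2)
    (hgb : ∀ s ξ η, ‖g s ξ η‖ ≤ D * (rho s * (rho ξ * rho η))) (t : ℝ) :
    L2K (duh κ g t) ≤ 7 * mixN kt' lt' (invN g) := by
  have hD : 0 ≤ D := nonneg_of_mul_nonneg_left ((norm_nonneg _).trans (hgb 0 0 0))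
    (mul_pos (rho_pos 0) (mul_pos (rho_pos 0) (rho_pos 0)))
  have hM := measurable_duh hκ hg
  have hMb := norm_duh_le hκ1 hgb t
  have hMt : Measurable fun p : ℝ × ℝ => duh κ g t p.1 p.2 := by fun_prop
  set b : ℝ → ℝ → ℝ → ℂ := fun s ξ η => (κ t s : ℂ) * (phase (-(s * ξ ^ 2)) * duh κ g t ξ η)
    with hbdef
  have hbm : Measurable fun p : ℝ × ℝ × ℝ => b p.1 p.2.1 p.2.2 := by
    simp only [hbdef]; fun_prop
  have hbb : ∀ s ξ η, ‖b s ξ η‖ ≤ D * rhoMass * (rho ξ * rho η) := fun s ξ η => by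
    simp only [hbdef, norm_mul, norm_phase, one_mul, Complex.norm_real, Real.norm_eq_abs]
    exact (mul_le_of_le_one_left (norm_nonneg _) (hκ1 t s)).trans (hMb ξ η)
  have hgb' : ∀ s ξ η, ‖g s ξ η‖ ≤ D * (rho ξ * rho η) := fun s ξ η =>
    rho_bound_mono hD s (mul_pos (rho_pos ξ) (rho_pos η)).le (hgb s ξ η)
  have e1 : L2K (duh κ g t) ^ 2 = ‖∫ s, ∫ η, ∫ ξ, g s ξ η * (starRingEnd ℂ) (b s ξ η)‖ₑ := by
    rw [integral_rotate_of_rho (D := D * (D * rhoMass)) (by fun_prop)]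
    · have e2 : ∀ η ξ, ∫ s, g s ξ η * (starRingEnd ℂ) (b s ξ η) =
          duh κ g t ξ η * (starRingEnd ℂ) (duh κ g t ξ η) := fun η ξ => by
        nth_rewrite 1 [duh]
        rw [← integral_mul_const]
        congr 1; ext s
        simp only [hbdef, map_mul, conj_phase, Complex.conj_ofReal, neg_neg]
        ring
      simp_rw [e2]
      have hInt : Integrable fun p : ℝ × ℝ =>
          duh κ g t p.1 p.2 * (starRingEnd ℂ) (duh κ g t p.1 p.2) := by
        refine integrable_of_rho_prod (f := fun ξ η => duh κ g t ξ η * (starRingEnd ℂ)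
          (duh κ g t ξ η)) (D := (D * rhoMass) ^ 2) (by fun_prop) fun ξ η => ?_
        rw [norm_mul, RCLike.norm_conj]
        have h1 := rho_pos ξ
        have h2 := rho_pos η
        have h3 := rhoMass_nonneg
        calc _ ≤ (D * rhoMass * (rho ξ * rho η)) * (D * rhoMass * (rho ξ * rho η)) :=
              mul_le_mul (hMb ξ η) (hMb ξ η) (norm_nonneg _) (by positivity)
          _ = (D * rhoMass) ^ 2 * (rho ξ * rho η) * (rho ξ * rho η) := by ring
          _ ≤ _ := mul_le_of_le_one_right (by positivity)
            (mul_le_one₀ (rho_le_one _) h2.le (rho_le_one _))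
      rw [integral_integral_swap (by
        rw [← Measure.volume_eq_prod]
        exact hInt.swap)]
      have e3 : ∫ ξ, ∫ η, duh κ g t ξ η * (starRingEnd ℂ) (duh κ g t ξ η) =
          ∫ p : ℝ × ℝ, duh κ g t p.1 p.2 * (starRingEnd ℂ) (duh κ g t p.1 p.2) :=
        (integral_prod _ hInt).symm
      rw [e3, ← lintegral_enorm_sq_eq]
      · unfold L2K
        rw [eLpNorm_eq_lintegral_rpow_enorm_toReal (by norm_num) (by norm_num)]
        simp only [ENNReal.toReal_ofNat, ENNReal.rpow_ofNat]
        rw [rpow_half_sq]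
      · refine hInt.norm.congr (ae_of_all _ fun p => ?_)
        simp only [norm_mul, RCLike.norm_conj]; ring
    · intro s η ξ
      rw [norm_mul, RCLike.norm_conj]
      have h1 := rho_pos ξ
      have h2 := rho_pos η
      have h3 := rhoMass_nonneg
      have h4 := rho_pos s
      calc _ ≤ (D * (rho s * (rho ξ * rho η))) * (D * rhoMass * (rho ξ * rho η)) :=
            mul_le_mul (hgb s ξ η) (hbb s ξ η) (norm_nonneg _) (by positivity)
        _ = D * (D * rhoMass) * (rho s * (rho η * rho ξ)) * (rho ξ * rho η) := by ring
        _ ≤ _ := mul_le_of_le_one_right (by positivity)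
            (mul_le_one₀ (rho_le_one _) h2.le (rho_le_one _))
  have h2 : mixN kt lt (invN b) ≤ 7 * L2K (duh κ g t) := by
    refine le_trans (mixN_mono fun s x => ?_) (mixN_evol_le hkt hlt hadmt hMt hMb)
    have e4 : invN b s x = ‖(κ t s : ℂ)‖ₑ * nTwo (evol (fun _ => duh κ g t) s x) := by
      rw [← nTwo_const_mul]
      unfold invN
      congr 1; ext η
      rw [evol_eq_invFI]
      unfold invFI
      rw [← integral_const_mul]
      congr 1; ext ξ
      simp only [hbdef]
      ring
    rw [e4]
    refine mul_le_of_le_one_left zero_le ?_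
    rw [← ofReal_norm, Complex.norm_real, Real.norm_eq_abs, ENNReal.ofReal_le_one]
    exact hκ1 t s
  have h3 : L2K (duh κ g t) ^ 2 ≤ mixN kt' lt' (invN g) * (7 * L2K (duh κ g t)) := by
    rw [e1]
    refine (enorm_pairing_le_mixN (by rw [add_comm]; exact hconjk) (by rw [add_comm]; exact hconjl)
      hg hbm hgb' hbb).trans ?_
    gcongr
  have hfin := L2K_ne_top_of_rho hMt hMb
  rcases eq_or_ne (L2K (duh κ g t)) 0 with h0 | h0
  · rw [h0]; exact zero_le
  rw [sq, ← mul_assoc] at h3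
  rw [mul_comm]
  exact (ENNReal.mul_le_mul_iff_left h0 hfin).1 h3

/-! ### The retarded estimate at the maximal endpoint -/

/-- The weighted adjoint of the retarded evolution along the curve `X`, on the Fourier side. -/
def retAdj (κ : ℝ → ℝ → ℝ) (X : ℝ → ℝ) (a : ℝ → ℝ → ℂ) (s ξ η : ℝ) : ℂ :=
  phase (-(s * ξ ^ 2)) * curveAdj X (fun t => (κ t s : ℂ) * a t η) ξ

lemma measurable_retAdj {κ : ℝ → ℝ → ℝ} {X : ℝ → ℝ} {a : ℝ → ℝ → ℂ}
    (hκ : Measurable fun p : ℝ × ℝ => κ p.1 p.2) (hX : Measurable X)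
    (ha : Measurable fun p : ℝ × ℝ => a p.1 p.2) :
    Measurable fun p : ℝ × ℝ × ℝ => retAdj κ X a p.1 p.2.1 p.2.2 := by
  unfold retAdj curveAdj; fun_prop

lemma norm_weight_mul_le {κ : ℝ → ℝ → ℝ} (hκ1 : ∀ t s, |κ t s| ≤ 1) (t s : ℝ) (z : ℂ) :
    ‖(κ t s : ℂ) * z‖ ≤ ‖z‖ := by
  rw [norm_mul, Complex.norm_real, Real.norm_eq_abs]
  exact mul_le_of_le_one_left (norm_nonneg _) (hκ1 t s)

lemma norm_retAdj_le {κ : ℝ → ℝ → ℝ} {X : ℝ → ℝ} {a : ℝ → ℝ → ℂ} {E : ℝ}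
    (hκ1 : ∀ t s, |κ t s| ≤ 1) (hab : ∀ t η, ‖a t η‖ ≤ E * (rho t * rho η)) (s ξ η : ℝ) :
    ‖retAdj κ X a s ξ η‖ ≤ E * rhoMass * rho η := by
  rw [retAdj, norm_mul, norm_phase, one_mul]
  refine (norm_curveAdj_le (D := E * rho η) (fun t => ?_) ξ).trans (le_of_eq (by ring))
  exact (norm_weight_mul_le hκ1 t s _).trans ((hab t η).trans (le_of_eq (by ring)))

lemma testNorm_mono {a b : ℝ → ℝ → ℂ} (h : ∀ t η, ‖a t η‖ ≤ ‖b t η‖) : testNorm a ≤ testNorm b := by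
  unfold testNorm nTwo
  gcongr with t η
  rw [← ofReal_norm, ← ofReal_norm]
  exact ENNReal.ofReal_le_ofReal (h t η)

lemma L2K_mono {f g : ℝ → ℝ → ℂ} (h : ∀ x y, ‖f x y‖ ≤ ‖g x y‖) : L2K f ≤ L2K g :=
  eLpNorm_mono fun p => h p.1 p.2

lemma norm_exp_neg_mul_sq_le_one {ε : ℝ} (hε : 0 < ε) (ξ : ℝ) :
    ‖(Real.exp (-ε * ξ ^ 2) : ℂ)‖ ≤ 1 := by
  rw [Complex.norm_real, Real.norm_of_nonneg (Real.exp_pos _).le, Real.exp_le_one_iff]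
  nlinarith [sq_nonneg ξ]

lemma enorm_invFI_regularised_retAdj_le {κ : ℝ → ℝ → ℝ} {X : ℝ → ℝ} {a : ℝ → ℝ → ℂ} {E : ℝ}
    (hκ : Measurable fun p : ℝ × ℝ => κ p.1 p.2) (hκ1 : ∀ t s, |κ t s| ≤ 1) (hX : Measurable X)
    (ha : Measurable fun p : ℝ × ℝ => a p.1 p.2) (hab : ∀ t η, ‖a t η‖ ≤ E * (rho t * rho η))
    {ε : ℝ} (hε : 0 < ε) (s x η : ℝ) :
    ‖invFI (fun ξ => (Real.exp (-ε * ξ ^ 2) : ℂ) * retAdj κ X a s ξ η) x‖ₑ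
      ≤ ∫⁻ t, ‖a t η‖ₑ * (2 * rieszK (t - s)) := by
  have hE := const_nonneg_of_rho₂ (a := ‖a 0 0‖) (by simpa using hab 0 0)
  have e : invFI (fun ξ => (Real.exp (-ε * ξ ^ 2) : ℂ) * retAdj κ X a s ξ η) x =
      ∫ t, ∫ ξ, (κ t s : ℂ) * a t η *
        (phase (ξ * (x - X t) + (t - s) * ξ ^ 2) * (Real.exp (-ε * ξ ^ 2) : ℂ)) := by
    rw [integral_swap_of_rho (D := (1 + ε⁻¹) * (E * rho η)) (by fun_prop)]
    · unfold invFI retAdj curveAdj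
      congr 1; ext ξ
      simp_rw [← integral_const_mul]
      congr 1; ext t
      rw [show ξ * (x - X t) + (t - s) * ξ ^ 2 =
        ξ * x + (-(s * ξ ^ 2) + (-(ξ * X t) + t * ξ ^ 2)) by ring, phase_add (ξ * x),
        phase_add (-(s * ξ ^ 2))]
      ring
    · intro t ξ
      have h1 := rho_pos ξ
      have h2 := rho_pos η
      have h3 := rho_pos t
      rw [norm_mul]
      calc _ ≤ (E * (rho t * rho η)) * ((1 + ε⁻¹) * rho ξ) := by
            refine mul_le_mul ((norm_weight_mul_le hκ1 t s _).trans (hab t η)) ?_ (norm_nonneg _)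
              (by positivity)
            rw [norm_mul, norm_phase, one_mul, Complex.norm_real,
              Real.norm_of_nonneg (Real.exp_pos _).le]
            exact exp_neg_mul_sq_le hε ξ
        _ = _ := by ring
  rw [e]
  refine (enorm_integral_le_lintegral_enorm _).trans (lintegral_mono_ae ?_)
  have hne : ∀ᵐ t : ℝ, t ≠ s := by simp [ae_iff]
  filter_upwards [hne] with t ht
  rw [integral_const_mul, enorm_mul]
  gcongr
  · rw [← ofReal_norm, ← ofReal_norm]
    exact ENNReal.ofReal_le_ofReal (norm_weight_mul_le hκ1 t s _)
  · exact enorm_regularised_kernel_le hε (sub_ne_zero.2 ht) _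

lemma mixN_regularised_retAdj_le {kt lt : ℝ≥0∞} (hkt : 2 < kt) (hlt : 2 ≤ lt)
    (hadmt : 2 / kt + 1 / lt = 1 / 2) {κ : ℝ → ℝ → ℝ} {X : ℝ → ℝ} {a : ℝ → ℝ → ℂ} {E : ℝ}
    (hκ : Measurable fun p : ℝ × ℝ => κ p.1 p.2) (hκ1 : ∀ t s, |κ t s| ≤ 1) (hX : Measurable X)
    (ha : Measurable fun p : ℝ × ℝ => a p.1 p.2) (hab : ∀ t η, ‖a t η‖ ≤ E * (rho t * rho η))
    {ε : ℝ} (hε : 0 < ε) :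
    mixN kt lt (invN fun s ξ η => (Real.exp (-ε * ξ ^ 2) : ℂ) * retAdj κ X a s ξ η)
      ≤ 40 * testNorm a := by
  have hE := const_nonneg_of_rho₂ (a := ‖a 0 0‖) (by simpa using hab 0 0)
  have hm := measurable_retAdj hκ hX ha
  have hm' : Measurable fun p : ℝ × ℝ × ℝ =>
    (Real.exp (-ε * p.2.1 ^ 2) : ℂ) * retAdj κ X a p.1 p.2.1 p.2.2 := by fun_prop
  have hmN := measurable_invN (g := fun s ξ η =>
    (Real.exp (-ε * ξ ^ 2) : ℂ) * retAdj κ X a s ξ η) hm'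
  refine mixN_le_of_endpoints hkt hlt hadmt (fun s => by fun_prop) (fun s => ?_) ?_
  · unfold invN
    rw [lintegral_nTwo_invFI_sq (D := (1 + ε⁻¹) * (E * rhoMass)) (g := fun ξ η =>
      (Real.exp (-ε * ξ ^ 2) : ℂ) * retAdj κ X a s ξ η) (by fun_prop) (fun ξ η => ?_)]
    · have h1 : L2K (fun ξ η => (Real.exp (-ε * ξ ^ 2) : ℂ) * retAdj κ X a s ξ η)
          ≤ 7 * testNorm a := by
        have hmc : Measurable fun p : ℝ × ℝ =>
            curveAdj X (fun t => (κ t s : ℂ) * a t p.2) p.1 := by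
          unfold curveAdj; fun_prop
        calc _ ≤ L2K (fun ξ η => curveAdj X (fun t => (κ t s : ℂ) * a t η) ξ) := by
              refine L2K_mono fun ξ η => ?_
              rw [retAdj, norm_mul, norm_mul, norm_phase, one_mul]
              exact mul_le_of_le_one_left (norm_nonneg _) (norm_exp_neg_mul_sq_le_one hε ξ)
          _ ≤ 7 * testNorm (fun t η => (κ t s : ℂ) * a t η) :=
              L2K_le_of_lintegral hmc (lintegral_lintegral_curveAdj_le hX (by fun_prop)
                fun t η => (norm_weight_mul_le hκ1 t s _).trans (hab t η))
          _ ≤ _ := by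
              gcongr
              exact testNorm_mono fun t η => norm_weight_mul_le hκ1 t s _
      calc _ ≤ (8 : ℝ≥0∞) * (7 * testNorm a) ^ 2 := by
            gcongr
            rw [ENNReal.ofReal_le_iff_le_toReal (by simp)]
            have := Real.pi_le_four
            norm_num; linarith
        _ = 392 * testNorm a ^ 2 := by ring
        _ ≤ 1600 * testNorm a ^ 2 := by gcongr; norm_num
        _ = _ := by ring
    · have h1 := rho_pos ξ
      have h2 := rho_pos η
      have h3 := rhoMass_nonneg
      rw [norm_mul]
      calc _ ≤ ((1 + ε⁻¹) * rho ξ) * (E * rhoMass * rho η) := by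
            refine mul_le_mul ?_ (norm_retAdj_le hκ1 hab s ξ η) (norm_nonneg _) (by positivity)
            rw [Complex.norm_real, Real.norm_of_nonneg (Real.exp_pos _).le]
            exact exp_neg_mul_sq_le hε ξ
        _ = _ := by ring
  · have h1 : ∀ s, (⨆ x, invN (fun s ξ η => (Real.exp (-ε * ξ ^ 2) : ℂ) * retAdj κ X a s ξ η) s x)
        ≤ ∫⁻ t, (2 * nTwo (a t)) * rieszK (t - s) := by
      intro s
      refine iSup_le fun x => ennreal_le_of_sq_le_sq ?_
      unfold invN
      rw [nTwo_sq]
      calc _ ≤ ∫⁻ η, (∫⁻ t, ‖a t η‖ₑ * (2 * rieszK (t - s))) ^ 2 := by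
            gcongr with η
            exact enorm_invFI_regularised_retAdj_le hκ hκ1 hX ha hab hε s x η
        _ ≤ _ := lintegral_sq_lintegral_le (by fun_prop)
        _ = _ := by
            congr 1
            refine lintegral_congr fun t => ?_
            simp_rw [mul_pow]
            rw [lintegral_mul_const _ (by fun_prop), ENNReal.mul_rpow_of_nonneg _ _ (by norm_num),
              ← mul_pow, sq_rpow_half]
            unfold nTwo; ring
    calc _ ≤ ∫⁻ s, (∫⁻ t, (2 * nTwo (a t)) * rieszK (t - s)) ^ 4 := by
          gcongr with s; exact h1 s
      _ ≤ _ := lintegral_rieszK_conv_le (by fun_prop)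
      _ = (40 * testNorm a) ^ 4 := by
          congr 1
          simp_rw [ENNReal.mul_rpow_of_nonneg _ _ (by norm_num : (0 : ℝ) ≤ 4 / 3)]
          rw [lintegral_const_mul _ (by fun_prop), ENNReal.mul_rpow_of_nonneg _ _ (by norm_num),
            ← ENNReal.rpow_mul]
          norm_num
          rw [← mul_assoc]
          norm_num
          rfl

lemma integral_triple_eq_of_rho {f : ℝ → ℝ → ℝ → ℂ} {D : ℝ}
    (hf : Measurable fun p : ℝ × ℝ × ℝ => f p.1 p.2.1 p.2.2)
    (hb : ∀ x y z, ‖f x y z‖ ≤ D * (rho x * (rho y * rho z))) :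
    ∫ x, ∫ y, ∫ z, f x y z = ∫ p : ℝ × ℝ × ℝ, f p.1 p.2.1 p.2.2 := by
  have h : Integrable (fun p : ℝ × ℝ × ℝ => f p.1 p.2.1 p.2.2) (volume.prod volume) :=
    (integrable_rho_prod₃.const_mul D).mono' hf.aestronglyMeasurable
      (ae_of_all _ fun p => hb p.1 p.2.1 p.2.2)
  rw [Measure.volume_eq_prod, integral_prod _ h]
  refine integral_congr_ae (ae_of_all _ fun x => ?_)
  dsimp only
  rw [Measure.volume_eq_prod, integral_prod]
  rw [← Measure.volume_eq_prod]
  exact integrable_of_rho_prod (f := fun y z => f x y z) (D := D * rho x) (by fun_prop)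
    fun y z => (hb x y z).trans (le_of_eq (by ring))

lemma duh_pairing_eq {κ : ℝ → ℝ → ℝ} {X : ℝ → ℝ} {a : ℝ → ℝ → ℂ} {g : ℝ → ℝ → ℝ → ℂ} {D E : ℝ}
    (hκ : Measurable fun p : ℝ × ℝ => κ p.1 p.2) (hκ1 : ∀ t s, |κ t s| ≤ 1) (hX : Measurable X)
    (hg : Measurable fun p : ℝ × ℝ × ℝ => g p.1 p.2.1 p.2.2)
    (hgb : ∀ s ξ η, ‖g s ξ η‖ ≤ D * (rho s * (rho ξ * rho η)))
    (ha : Measurable fun p : ℝ × ℝ => a p.1 p.2) (hab : ∀ t η, ‖a t η‖ ≤ E * (rho t * rho η)) :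
    ∫ t, ∫ η, evol (duh κ g) t (X t) η * (starRingEnd ℂ) (a t η) =
      ∫ s, ∫ η, ∫ ξ, g s ξ η * (starRingEnd ℂ) (retAdj κ X a s ξ η) := by
  have hE := const_nonneg_of_rho₂ (a := ‖a 0 0‖) (by simpa using hab 0 0)
  have hD : 0 ≤ D := nonneg_of_mul_nonneg_left ((norm_nonneg _).trans (hgb 0 0 0))
    (mul_pos (rho_pos 0) (mul_pos (rho_pos 0) (rho_pos 0)))
  have hm := measurable_retAdj hκ hX ha
  rw [evol_pairing_eq hX (measurable_duh hκ hg) (norm_duh_le hκ1 hgb) ha hab,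
    integral_rotate_of_rho (D := D * (E * rhoMass)) (f := fun s η ξ => g s ξ η *
      (starRingEnd ℂ) (retAdj κ X a s ξ η)) (by fun_prop)]
  · refine integral_congr_ae (ae_of_all _ fun η => integral_congr_ae (ae_of_all _ fun ξ => ?_))
    dsimp only
    have e1 : ∀ t, duh κ g t ξ η * (starRingEnd ℂ) (phase (-(ξ * X t) + t * ξ ^ 2) * a t η) =
        ∫ s, (κ t s : ℂ) * (phase (s * ξ ^ 2) * g s ξ η) *
          (starRingEnd ℂ) (phase (-(ξ * X t) + t * ξ ^ 2) * a t η) := fun t => by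
      rw [integral_mul_const]; rfl
    simp_rw [e1]
    rw [integral_swap_of_rho (D := D * (rho ξ * rho η) * (E * rho η)) (by fun_prop)]
    · congr 1; ext s
      rw [retAdj, map_mul, conj_phase, neg_neg, curveAdj, ← integral_conj, ← integral_const_mul,
        ← integral_const_mul]
      congr 1; ext t
      simp only [map_mul, Complex.conj_ofReal]
      ring
    · intro t s
      have h1 := rho_pos ξ
      have h2 := rho_pos η
      have h3 := rho_pos s
      rw [norm_mul, RCLike.norm_conj, norm_mul (phase _), norm_phase, one_mul]
      calc _ ≤ (D * (rho s * (rho ξ * rho η))) * (E * (rho t * rho η)) :=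
            mul_le_mul (norm_duh_integrand_le hκ1 hgb t s ξ η) (hab t η) (norm_nonneg _)
              (by positivity)
        _ = _ := by ring
  · intro s η ξ
    have h1 := rho_pos ξ
    have h2 := rho_pos η
    have h3 := rho_pos s
    have h4 := rhoMass_nonneg
    rw [norm_mul, RCLike.norm_conj]
    calc _ ≤ (D * (rho s * (rho ξ * rho η))) * (E * rhoMass * rho η) :=
          mul_le_mul (hgb s ξ η) (norm_retAdj_le hκ1 hab s ξ η) (norm_nonneg _) (by positivity)
      _ = D * (E * rhoMass) * (rho s * (rho η * rho ξ)) * rho η := by ring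
      _ ≤ _ := mul_le_of_le_one_right (by positivity) (rho_le_one _)

lemma enorm_duh_pairing_le {kt lt kt' lt' : ℝ≥0∞} (hkt : 2 < kt) (hlt : 2 ≤ lt)
    (hadmt : 2 / kt + 1 / lt = 1 / 2) (hconjk : 1 / kt + 1 / kt' = 1)
    (hconjl : 1 / lt + 1 / lt' = 1)
    {κ : ℝ → ℝ → ℝ} {X : ℝ → ℝ} {a : ℝ → ℝ → ℂ} {g : ℝ → ℝ → ℝ → ℂ} {D E : ℝ}
    (hκ : Measurable fun p : ℝ × ℝ => κ p.1 p.2) (hκ1 : ∀ t s, |κ t s| ≤ 1) (hX : Measurable X)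
    (hg : Measurable fun p : ℝ × ℝ × ℝ => g p.1 p.2.1 p.2.2)
    (hgb : ∀ s ξ η, ‖g s ξ η‖ ≤ D * (rho s * (rho ξ * rho η)))
    (ha : Measurable fun p : ℝ × ℝ => a p.1 p.2) (hab : ∀ t η, ‖a t η‖ ≤ E * (rho t * rho η)) :
    ‖∫ t, ∫ η, evol (duh κ g) t (X t) η * (starRingEnd ℂ) (a t η)‖ₑ
      ≤ 40 * mixN kt' lt' (invN g) * testNorm a := by
  have hE := const_nonneg_of_rho₂ (a := ‖a 0 0‖) (by simpa using hab 0 0)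
  have hD : 0 ≤ D := nonneg_of_mul_nonneg_left ((norm_nonneg _).trans (hgb 0 0 0))
    (mul_pos (rho_pos 0) (mul_pos (rho_pos 0) (rho_pos 0)))
  have hm := measurable_retAdj hκ hX ha
  have hM := rhoMass_nonneg
  have hbd : ∀ s η ξ, ‖g s ξ η * (starRingEnd ℂ) (retAdj κ X a s ξ η)‖
      ≤ D * (E * rhoMass) * (rho s * (rho η * rho ξ)) := by
    intro s η ξ
    have h1 := rho_pos ξ
    have h2 := rho_pos η
    have h3 := rho_pos s
    rw [norm_mul, RCLike.norm_conj]
    calc _ ≤ (D * (rho s * (rho ξ * rho η))) * (E * rhoMass * rho η) :=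
          mul_le_mul (hgb s ξ η) (norm_retAdj_le hκ1 hab s ξ η) (norm_nonneg _) (by positivity)
      _ = D * (E * rhoMass) * (rho s * (rho η * rho ξ)) * rho η := by ring
      _ ≤ _ := mul_le_of_le_one_right (by positivity) (rho_le_one _)
  rw [duh_pairing_eq hκ hκ1 hX hg hgb ha hab, integral_triple_eq_of_rho (by fun_prop) hbd]
  have lim : Filter.Tendsto (fun n : ℕ => ∫ p : ℝ × ℝ × ℝ, g p.1 p.2.2 p.2.1 *
      (starRingEnd ℂ) ((Real.exp (-(1 / ((n : ℝ) + 1)) * p.2.2 ^ 2) : ℂ) *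
        retAdj κ X a p.1 p.2.2 p.2.1)) Filter.atTop
      (nhds (∫ p : ℝ × ℝ × ℝ, g p.1 p.2.2 p.2.1 *
        (starRingEnd ℂ) (retAdj κ X a p.1 p.2.2 p.2.1))) := by
    refine tendsto_integral_of_dominated_convergence
      (fun p => D * (E * rhoMass) * (rho p.1 * (rho p.2.1 * rho p.2.2)))
      (fun n => Measurable.aestronglyMeasurable (by fun_prop))
      (integrable_rho_prod₃.const_mul _) (fun n => ae_of_all _ fun p => ?_)
      (ae_of_all _ fun p => ?_)
    · refine le_trans ?_ (hbd p.1 p.2.1 p.2.2)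
      simp only [norm_mul, RCLike.norm_conj]
      gcongr
      exact mul_le_of_le_one_left (norm_nonneg _) (norm_exp_neg_mul_sq_le_one (by positivity) _)
    · have h := ((tendsto_exp_neg_mul_sq p.2.2).mul_const (retAdj κ X a p.1 p.2.2 p.2.1))
      rw [one_mul] at h
      exact ((continuous_conj.tendsto _).comp h).const_mul _
  refine le_of_tendsto' lim.enorm fun n => ?_
  have hε : 0 < 1 / ((n : ℝ) + 1) := by positivity
  set ε := 1 / ((n : ℝ) + 1)
  rw [← integral_triple_eq_of_rho (f := fun s η ξ => g s ξ η * (starRingEnd ℂ)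
    ((Real.exp (-ε * ξ ^ 2) : ℂ) * retAdj κ X a s ξ η)) (D := D * (E * rhoMass)) (by fun_prop)]
  · refine (enorm_pairing_le_mixN (p := kt') (q := kt) (r := lt') (s := lt) (D := D)
      (E := (1 + ε⁻¹) * (E * rhoMass))
      (b := fun s ξ η => (Real.exp (-ε * ξ ^ 2) : ℂ) * retAdj κ X a s ξ η)
      (by rw [add_comm]; exact hconjk) (by rw [add_comm]; exact hconjl)
      hg (by fun_prop) (fun s ξ η =>
        rho_bound_mono hD s (mul_pos (rho_pos ξ) (rho_pos η)).le (hgb s ξ η)) ?_).trans ?_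
    · intro s ξ η
      have h1 := rho_pos ξ
      have h2 := rho_pos η
      rw [norm_mul]
      calc _ ≤ ((1 + ε⁻¹) * rho ξ) * (E * rhoMass * rho η) := by
            refine mul_le_mul ?_ (norm_retAdj_le hκ1 hab s ξ η) (norm_nonneg _) (by positivity)
            rw [Complex.norm_real, Real.norm_of_nonneg (Real.exp_pos _).le]
            exact exp_neg_mul_sq_le hε ξ
        _ = _ := by ring
    · calc _ ≤ mixN kt' lt' (invN g) * (40 * testNorm a) := by
            gcongr
            exact mixN_regularised_retAdj_le hkt hlt hadmt hκ hκ1 hX ha hab hε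
        _ = _ := by ring
  · intro s η ξ
    refine le_trans ?_ (hbd s η ξ)
    simp only [norm_mul, RCLike.norm_conj]
    gcongr
    exact mul_le_of_le_one_left (norm_nonneg _) (norm_exp_neg_mul_sq_le_one hε _)

/-! ### The estimate on the Fourier side -/

lemma integrable_evol_pairing {G : ℝ → ℝ → ℝ → ℂ} {X : ℝ → ℝ} {a : ℝ → ℝ → ℂ} {D E : ℝ}
    (hX : Measurable X) (hG : Measurable fun p : ℝ × ℝ × ℝ => G p.1 p.2.1 p.2.2)
    (hb : ∀ t ξ η, ‖G t ξ η‖ ≤ D * (rho ξ * rho η))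
    (ha : Measurable fun p : ℝ × ℝ => a p.1 p.2) (hab : ∀ t η, ‖a t η‖ ≤ E * (rho t * rho η)) :
    Integrable fun p : ℝ × ℝ => evol G p.1 (X p.1) p.2 * (starRingEnd ℂ) (a p.1 p.2) := by
  have hD := const_nonneg_of_rho₂ (a := ‖G 0 0 0‖) (by simpa using hb 0 0 0)
  have hE := const_nonneg_of_rho₂ (a := ‖a 0 0‖) (by simpa using hab 0 0)
  have hm := measurable_evol hG
  refine integrable_of_rho_prod (f := fun t η => evol G t (X t) η * (starRingEnd ℂ) (a t η))
    (D := D * rhoMass * E) (by fun_prop) fun t η => ?_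
  rw [norm_mul, RCLike.norm_conj]
  have h1 := rho_pos t
  have h2 := rho_pos η
  have h3 := rhoMass_nonneg
  calc _ ≤ (D * rhoMass * rho η) * (E * (rho t * rho η)) :=
        mul_le_mul (norm_evol_le hb t _ η) (hab t η) (norm_nonneg _) (by positivity)
    _ = D * rhoMass * E * (rho t * rho η) * rho η := by ring
    _ ≤ _ := mul_le_of_le_one_right (by positivity) (rho_le_one _)

lemma evol_add_const_mul {G₁ G₂ : ℝ → ℝ → ℝ → ℂ} {D₁ D₂ : ℝ}
    (hG₁ : Measurable fun p : ℝ × ℝ × ℝ => G₁ p.1 p.2.1 p.2.2)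
    (hb₁ : ∀ t ξ η, ‖G₁ t ξ η‖ ≤ D₁ * (rho ξ * rho η))
    (hG₂ : Measurable fun p : ℝ × ℝ × ℝ => G₂ p.1 p.2.1 p.2.2)
    (hb₂ : ∀ t ξ η, ‖G₂ t ξ η‖ ≤ D₂ * (rho ξ * rho η)) (c : ℂ) (t x η : ℝ) :
    evol (fun t ξ η => G₁ t ξ η + c * G₂ t ξ η) t x η = evol G₁ t x η + c * evol G₂ t x η := by
  have key : ∀ {G : ℝ → ℝ → ℝ → ℂ} {D : ℝ},
      (Measurable fun p : ℝ × ℝ × ℝ => G p.1 p.2.1 p.2.2) →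
      (∀ t ξ η, ‖G t ξ η‖ ≤ D * (rho ξ * rho η)) →
      Integrable fun ξ => phase (ξ * x - t * ξ ^ 2) * G t ξ η := fun {G D} hG hb =>
    integrable_of_rho (D := D * rho η) (by fun_prop) fun ξ => by
      rw [norm_mul, norm_phase, one_mul]
      exact (hb t ξ η).trans (le_of_eq (by ring))
  unfold evol
  rw [← integral_const_mul, ← integral_add (key hG₁ hb₁) ((key hG₂ hb₂).const_mul c)]
  congr 1; ext ξ
  ring

/-- Inhomogeneous Strichartz estimate on the Fourier side. -/
lemma mixN_evol_duh_le {k l kt lt kt' lt' : ℝ≥0∞} (hk : 2 < k) (hl : 2 ≤ l)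
    (hadm : 2 / k + 1 / l = 1 / 2) (hkt : 2 < kt) (hlt : 2 ≤ lt)
    (hadmt : 2 / kt + 1 / lt = 1 / 2) (hconjk : 1 / kt + 1 / kt' = 1)
    (hconjl : 1 / lt + 1 / lt' = 1)
    {κ : ℝ → ℝ → ℝ} {g₀ : ℝ → ℝ → ℂ} {g : ℝ → ℝ → ℝ → ℂ} {D₀ D : ℝ}
    (hκ : Measurable fun p : ℝ × ℝ => κ p.1 p.2) (hκ1 : ∀ t s, |κ t s| ≤ 1)
    (hg₀ : Measurable fun p : ℝ × ℝ => g₀ p.1 p.2)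
    (hgb₀ : ∀ ξ η, ‖g₀ ξ η‖ ≤ D₀ * (rho ξ * rho η))
    (hg : Measurable fun p : ℝ × ℝ × ℝ => g p.1 p.2.1 p.2.2)
    (hgb : ∀ s ξ η, ‖g s ξ η‖ ≤ D * (rho s * (rho ξ * rho η))) :
    mixN k l (fun t x => nTwo (evol (fun t ξ η => g₀ ξ η + I * duh κ g t ξ η) t x))
      ≤ 49 * (L2K g₀ + mixN kt' lt' (invN g)) := by
  have hM := measurable_duh hκ hg
  have hMb := norm_duh_le hκ1 hgb
  have hG : Measurable fun p : ℝ × ℝ × ℝ => g₀ p.2.1 p.2.2 + I * duh κ g p.1 p.2.1 p.2.2 := by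
    fun_prop
  have hGb : ∀ t ξ η, ‖g₀ ξ η + I * duh κ g t ξ η‖ ≤ (D₀ + D * rhoMass) * (rho ξ * rho η) := by
    intro t ξ η
    refine (norm_add_le _ _).trans ?_
    rw [norm_mul, Complex.norm_I, one_mul]
    linarith [hgb₀ ξ η, hMb t ξ η]
  have hm := measurable_evol (G := fun t ξ η => g₀ ξ η + I * duh κ g t ξ η) hG
  refine mixN_le_of_endpoints hk hl hadm (fun t => by fun_prop) (fun t => ?_)
    (lintegral_iSup_nTwo_pow_four_le hm (norm_evol_le hGb) (continuous_evol hG hGb)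
      fun X hX a E ha hab => ?_)
  · refine (lintegral_nTwo_evol_sq_le hG hGb t).trans ?_
    gcongr ?_ ^ 2
    calc _ ≤ 7 * (L2K g₀ + L2K (duh κ g t)) := by
          gcongr
          unfold L2K
          refine (eLpNorm_add_le (f := fun p : ℝ × ℝ => g₀ p.1 p.2)
            (g := fun p : ℝ × ℝ => I * duh κ g t p.1 p.2)
            (Measurable.aestronglyMeasurable (by fun_prop))
            (Measurable.aestronglyMeasurable (by fun_prop)) (by norm_num)).trans ?_
          gcongr
          exact eLpNorm_mono fun p => by simp
      _ ≤ 7 * (7 * L2K g₀ + 7 * mixN kt' lt' (invN g)) := by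
          gcongr
          · exact le_mul_of_one_le_left zero_le (by norm_num)
          · exact L2K_duh_le hkt hlt hadmt hconjk hconjl hκ hκ1 hg hgb t
      _ = _ := by ring
  · have e : ∫ t, ∫ η, evol (fun t ξ η => g₀ ξ η + I * duh κ g t ξ η) t (X t) η *
        (starRingEnd ℂ) (a t η) = (∫ t, ∫ η, evol (fun _ => g₀) t (X t) η * (starRingEnd ℂ) (a t η))
        + I * ∫ t, ∫ η, evol (duh κ g) t (X t) η * (starRingEnd ℂ) (a t η) := by
      have i1 := integrable_evol_pairing (G := fun _ => g₀) hX (by fun_prop) (fun _ => hgb₀) ha hab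
      have i2 := integrable_evol_pairing hX hM hMb ha hab
      have i3 := integrable_evol_pairing hX hG hGb ha hab
      have p1 := integral_prod _ (Measure.volume_eq_prod ℝ ℝ ▸ i1)
      have p2 := integral_prod _ (Measure.volume_eq_prod ℝ ℝ ▸ i2)
      have p3 := integral_prod _ (Measure.volume_eq_prod ℝ ℝ ▸ i3)
      rw [← Measure.volume_eq_prod] at p1 p2 p3
      rw [← p1, ← p2, ← p3, ← integral_const_mul, ← integral_add i1 (i2.const_mul I)]
      congr 1; ext p
      rw [evol_add_const_mul (by fun_prop) (fun _ => hgb₀) hM hMb]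
      ring
    rw [e]
    calc _ ≤ 7 * L2K g₀ * testNorm a + 40 * mixN kt' lt' (invN g) * testNorm a := by
          refine (enorm_add_le _ _).trans ?_
          rw [enorm_mul, show ‖I‖ₑ = 1 by rw [← ofReal_norm]; simp, one_mul]
          gcongr
          · exact enorm_evol_pairing_le hX hg₀ hgb₀ ha hab
          · exact enorm_duh_pairing_le hkt hlt hadmt hconjk hconjl hκ hκ1 hX hg hgb ha hab
      _ ≤ 49 * L2K g₀ * testNorm a + 49 * mixN kt' lt' (invN g) * testNorm a := by
          gcongr <;> norm_num
      _ = _ := by ring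

/-! ### Transfer to physical space -/

lemma mixN_le_mul {k l : ℝ≥0∞} {M N : ℝ → ℝ → ℝ≥0∞} {c : ℝ≥0} (h : ∀ t x, M t x ≤ c * N t x) :
    mixN k l M ≤ c * mixN k l N :=
  eLpNorm_le_nnreal_smul_eLpNorm_of_ae_le_mul' (ae_of_all _ fun t => by
    simpa [ENNReal.smul_def] using eLpNorm_le_nnreal_smul_eLpNorm_of_ae_le_mul' (p := l) (μ := (volume : Measure ℝ))
      (ae_of_all _ fun x => by simpa using h t x)) k

lemma cexp_eq_phase (ξ x η y : ℝ) :
    cexp (I * ((ξ : ℂ) * x + (η : ℂ) * y)) = phase (ξ * x + η * y) := by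
  unfold phase; push_cast; ring_nf

lemma IFT2_eq_invFI {h : ℝ → ℝ → ℂ} {D : ℝ} (hm : Measurable fun p : ℝ × ℝ => h p.1 p.2)
    (hb : ∀ ξ η, ‖h ξ η‖ ≤ D * (rho ξ * rho η)) (x y : ℝ) :
    IFT2 h x y = ((2 * (π : ℂ)) ^ 2)⁻¹ * invFI (fun η => invFI (fun ξ => h ξ η) x) y := by
  unfold IFT2
  simp_rw [cexp_eq_phase]
  rw [integral_swap_of_rho (D := D) (by fun_prop) fun ξ η => by simpa using hb ξ η]
  congr 1
  unfold invFI
  congr 1; ext η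
  rw [← integral_const_mul]
  congr 1; ext ξ
  rw [phase_add]; ring

lemma eLpNorm_IFT2_sq {h : ℝ → ℝ → ℂ} {D : ℝ} (hm : Measurable fun p : ℝ × ℝ => h p.1 p.2)
    (hb : ∀ ξ η, ‖h ξ η‖ ≤ D * (rho ξ * rho η)) (x : ℝ) :
    eLpNorm (IFT2 h x) 2 volume ^ 2 =
      ENNReal.ofReal ((2 * π) ^ 3)⁻¹ * nTwo (fun η => invFI (fun ξ => h ξ η) x) ^ 2 := by
  have hb' : ∀ η, ‖invFI (fun ξ => h ξ η) x‖ ≤ D * rhoMass * rho η := fun η =>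
    (norm_integral_le_of_rho (D := D * rho η) fun ξ => by
      rw [norm_mul, norm_phase, one_mul]
      exact (hb ξ η).trans (le_of_eq (by ring))).trans (le_of_eq (by ring))
  have e : IFT2 h x = fun y =>
      ((2 * (π : ℂ)) ^ 2)⁻¹ * invFI (fun η => invFI (fun ξ => h ξ η) x) y :=
    funext fun y => IFT2_eq_invFI hm hb x y
  rw [e, ← nTwo_eq_eLpNorm, nTwo_const_mul, mul_pow, nTwo_sq, nTwo_sq,
    lintegral_invFI_sq _ (integrable_of_rho (by fun_prop) hb') (memLp_two_of_rho (by fun_prop) hb'),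
    ← mul_assoc]
  congr 1
  have hpi := Real.pi_pos
  rw [← ofReal_norm, ← ENNReal.ofReal_pow (norm_nonneg _), ← ENNReal.ofReal_mul (by positivity)]
  congr 1
  rw [norm_inv, norm_pow, norm_mul, Complex.norm_real, Complex.norm_ofNat,
    Real.norm_of_nonneg hpi.le]
  field_simp

lemma eLpNorm_IFT2_le {h : ℝ → ℝ → ℂ} {D : ℝ} (hm : Measurable fun p : ℝ × ℝ => h p.1 p.2)
    (hb : ∀ ξ η, ‖h ξ η‖ ≤ D * (rho ξ * rho η)) (x : ℝ) :
    eLpNorm (IFT2 h x) 2 volume ≤ nTwo fun η => invFI (fun ξ => h ξ η) x := by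
  refine ennreal_le_of_sq_le_sq ?_
  rw [eLpNorm_IFT2_sq hm hb]
  refine mul_le_of_le_one_left zero_le ?_
  rw [ENNReal.ofReal_le_one]
  refine inv_le_one_of_one_le₀ (one_le_pow₀ ?_)
  linarith [Real.pi_gt_three]

lemma nTwo_invFI_le {h : ℝ → ℝ → ℂ} {D : ℝ} (hm : Measurable fun p : ℝ × ℝ => h p.1 p.2)
    (hb : ∀ ξ η, ‖h ξ η‖ ≤ D * (rho ξ * rho η)) (x : ℝ) :
    (nTwo fun η => invFI (fun ξ => h ξ η) x) ≤ 49 * eLpNorm (IFT2 h x) 2 volume := by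
  refine ennreal_le_of_sq_le_sq ?_
  rw [mul_pow, eLpNorm_IFT2_sq hm hb, ← mul_assoc]
  refine le_mul_of_one_le_left zero_le ?_
  have h8 : (2 * π) ^ 3 ≤ 49 ^ 2 := by
    calc (2 * π) ^ 3 ≤ 8 ^ 3 := by
          have := Real.pi_pos
          gcongr
          linarith [Real.pi_le_four]
      _ ≤ _ := by norm_num
  rw [show (49 : ℝ≥0∞) ^ 2 = ENNReal.ofReal (49 ^ 2) by norm_num, ← ENNReal.ofReal_mul (by norm_num),
    ENNReal.one_le_ofReal, ← div_eq_mul_inv, one_le_div (by have := Real.pi_pos; positivity)]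
  exact h8

lemma measurable_IFT2 {h : ℝ → ℝ → ℂ} (hm : Measurable fun p : ℝ × ℝ => h p.1 p.2) :
    Measurable fun p : ℝ × ℝ => IFT2 h p.1 p.2 := by
  unfold IFT2; simp_rw [cexp_eq_phase]; fun_prop

lemma L2K_sq_eq_lintegral_slice {f : ℝ → ℝ → ℂ} (hf : Measurable fun p : ℝ × ℝ => f p.1 p.2) :
    L2K f ^ 2 = ∫⁻ x, eLpNorm (f x) 2 volume ^ 2 := by
  simp_rw [← nTwo_eq_eLpNorm, nTwo_sq]
  rw [L2K_sq hf, lintegral_lintegral_swap (by fun_prop)]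

lemma L2K_le_IFT2 {h : ℝ → ℝ → ℂ} {D : ℝ} (hm : Measurable fun p : ℝ × ℝ => h p.1 p.2)
    (hb : ∀ ξ η, ‖h ξ η‖ ≤ D * (rho ξ * rho η)) : L2K h ≤ 49 * L2K (IFT2 h) := by
  refine ennreal_le_of_sq_le_sq ?_
  rw [mul_pow, L2K_sq_eq_lintegral_slice (measurable_IFT2 hm)]
  have h1 := lintegral_nTwo_invFI_sq hm hb
  have hI := measurable_IFT2 hm
  have hm2 : Measurable fun x => eLpNorm (IFT2 h x) 2 volume := by
    simp_rw [← nTwo_eq_eLpNorm]; fun_prop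
  calc L2K h ^ 2 ≤ ENNReal.ofReal (2 * π) * L2K h ^ 2 := by
        refine le_mul_of_one_le_left zero_le ?_
        rw [ENNReal.one_le_ofReal]
        linarith [Real.pi_gt_three]
    _ ≤ ∫⁻ x, 49 ^ 2 * eLpNorm (IFT2 h x) 2 volume ^ 2 := by
        rw [← h1]
        gcongr with x
        rw [← mul_pow]
        gcongr
        exact nTwo_invFI_le hm hb x
    _ = _ := lintegral_const_mul _ (by fun_prop)

/-- The Duhamel formula on the Fourier side. -/
def duhHat (κ : ℝ → ℝ → ℝ) (h₀ : ℝ → ℝ → ℂ) (h : ℝ → ℝ → ℝ → ℂ) (t ξ η : ℝ) : ℂ :=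
  phase (t * (η ^ 2 - ξ ^ 2)) * h₀ ξ η +
    I * ∫ s, (κ t s : ℂ) * (phase ((t - s) * (η ^ 2 - ξ ^ 2)) * h s ξ η)

lemma measurable_duhHat {κ : ℝ → ℝ → ℝ} {h₀ : ℝ → ℝ → ℂ} {h : ℝ → ℝ → ℝ → ℂ}
    (hκ : Measurable fun p : ℝ × ℝ => κ p.1 p.2)
    (hg₀ : Measurable fun p : ℝ × ℝ => h₀ p.1 p.2)
    (hg : Measurable fun p : ℝ × ℝ × ℝ => h p.1 p.2.1 p.2.2) :
    Measurable fun p : ℝ × ℝ × ℝ => duhHat κ h₀ h p.1 p.2.1 p.2.2 := by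
  unfold duhHat; fun_prop

lemma duhHat_eq (κ : ℝ → ℝ → ℝ) (h₀ : ℝ → ℝ → ℂ) (h : ℝ → ℝ → ℝ → ℂ) (t ξ η : ℝ) :
    duhHat κ h₀ h t ξ η = phase (t * η ^ 2) * (phase (-(t * ξ ^ 2)) * (h₀ ξ η +
      I * duh κ (fun s ξ η => phase (-(s * η ^ 2)) * h s ξ η) t ξ η)) := by
  unfold duhHat duh
  have e : ∀ s, (κ t s : ℂ) * (phase ((t - s) * (η ^ 2 - ξ ^ 2)) * h s ξ η) =
      (phase (t * η ^ 2) * phase (-(t * ξ ^ 2))) *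
        ((κ t s : ℂ) * (phase (s * ξ ^ 2) * (phase (-(s * η ^ 2)) * h s ξ η))) := fun s => by
    rw [show (t - s) * (η ^ 2 - ξ ^ 2) = t * η ^ 2 + (-(t * ξ ^ 2) + (s * ξ ^ 2 + -(s * η ^ 2)))
      by ring, phase_add (t * η ^ 2), phase_add (-(t * ξ ^ 2)), phase_add (s * ξ ^ 2)]
    ring
  simp_rw [e]
  rw [integral_const_mul, show t * (η ^ 2 - ξ ^ 2) = t * η ^ 2 + -(t * ξ ^ 2) by ring, phase_add]
  ring

lemma nTwo_phase_mul (φ : ℝ → ℝ) (w : ℝ → ℂ) : nTwo (fun η => phase (φ η) * w η) = nTwo w := by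
  unfold nTwo; simp [enorm_mul]

lemma norm_duhHat_le {κ : ℝ → ℝ → ℝ} {h₀ : ℝ → ℝ → ℂ} {h : ℝ → ℝ → ℝ → ℂ} {D₀ D : ℝ}
    (hκ1 : ∀ t s, |κ t s| ≤ 1) (hgb₀ : ∀ ξ η, ‖h₀ ξ η‖ ≤ D₀ * (rho ξ * rho η))
    (hgb : ∀ s ξ η, ‖h s ξ η‖ ≤ D * (rho s * (rho ξ * rho η))) (t ξ η : ℝ) :
    ‖duhHat κ h₀ h t ξ η‖ ≤ (D₀ + D * rhoMass) * (rho ξ * rho η) := by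
  rw [duhHat_eq, norm_mul, norm_mul, norm_phase, norm_phase, one_mul, one_mul]
  refine (norm_add_le _ _).trans ?_
  rw [norm_mul, Complex.norm_I, one_mul]
  have := norm_duh_le (g := fun s ξ η => phase (-(s * η ^ 2)) * h s ξ η) hκ1
    (fun s ξ η => by simpa using hgb s ξ η) t ξ η
  linarith [hgb₀ ξ η]

/-- Inhomogeneous Strichartz estimate for inverse Fourier transforms of decaying data. -/
lemma mixN_IFT2_duhHat_le {k l kt lt kt' lt' : ℝ≥0∞} (hk : 2 < k) (hl : 2 ≤ l)
    (hadm : 2 / k + 1 / l = 1 / 2) (hkt : 2 < kt) (hlt : 2 ≤ lt)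
    (hadmt : 2 / kt + 1 / lt = 1 / 2) (hconjk : 1 / kt + 1 / kt' = 1)
    (hconjl : 1 / lt + 1 / lt' = 1)
    {κ : ℝ → ℝ → ℝ} {h₀ : ℝ → ℝ → ℂ} {h : ℝ → ℝ → ℝ → ℂ} {D₀ D : ℝ}
    (hκ : Measurable fun p : ℝ × ℝ => κ p.1 p.2) (hκ1 : ∀ t s, |κ t s| ≤ 1)
    (hg₀ : Measurable fun p : ℝ × ℝ => h₀ p.1 p.2)
    (hgb₀ : ∀ ξ η, ‖h₀ ξ η‖ ≤ D₀ * (rho ξ * rho η))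
    (hg : Measurable fun p : ℝ × ℝ × ℝ => h p.1 p.2.1 p.2.2)
    (hgb : ∀ s ξ η, ‖h s ξ η‖ ≤ D * (rho s * (rho ξ * rho η))) :
    mixN k l (fun t x => eLpNorm (IFT2 (duhHat κ h₀ h t) x) 2 volume)
      ≤ 2401 * (L2K (IFT2 h₀) + mixN kt' lt' fun s x => eLpNorm (IFT2 (h s) x) 2 volume) := by
  have hD : 0 ≤ D := nonneg_of_mul_nonneg_left ((norm_nonneg _).trans (hgb 0 0 0))
    (mul_pos (rho_pos 0) (mul_pos (rho_pos 0) (rho_pos 0)))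
  have hm := measurable_duhHat hκ hg₀ hg
  set g : ℝ → ℝ → ℝ → ℂ := fun s ξ η => phase (-(s * η ^ 2)) * h s ξ η with hgdef
  have hgm : Measurable fun p : ℝ × ℝ × ℝ => g p.1 p.2.1 p.2.2 := by
    simp only [hgdef]; fun_prop
  have hgb' : ∀ s ξ η, ‖g s ξ η‖ ≤ D * (rho s * (rho ξ * rho η)) := fun s ξ η => by
    simpa [hgdef] using hgb s ξ η
  calc _ ≤ mixN k l (fun t x => nTwo (evol (fun t ξ η => h₀ ξ η + I * duh κ g t ξ η) t x)) := by
        refine mixN_mono fun t x => ?_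
        refine (eLpNorm_IFT2_le (by fun_prop) (norm_duhHat_le hκ1 hgb₀ hgb t) x).trans_eq ?_
        rw [← nTwo_phase_mul (fun η => t * η ^ 2) (evol _ t x)]
        congr 1; ext η
        rw [evol_eq_invFI]
        unfold invFI
        rw [← integral_const_mul]
        congr 1; ext ξ
        dsimp only
        rw [duhHat_eq]
        ring
    _ ≤ 49 * (L2K h₀ + mixN kt' lt' (invN g)) :=
        mixN_evol_duh_le hk hl hadm hkt hlt hadmt hconjk hconjl hκ hκ1 hg₀ hgb₀ hgm hgb'
    _ ≤ 49 * (49 * L2K (IFT2 h₀) +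
          ((49 : ℝ≥0) : ℝ≥0∞) * mixN kt' lt' fun s x => eLpNorm (IFT2 (h s) x) 2 volume) := by
        gcongr
        · exact L2K_le_IFT2 hg₀ hgb₀
        · refine mixN_le_mul fun s x => ?_
          refine le_trans (le_of_eq ?_) (nTwo_invFI_le (by fun_prop) (fun ξ η =>
            rho_bound_mono hD s (mul_pos (rho_pos ξ) (rho_pos η)).le (hgb s ξ η)) x)
          unfold invN
          rw [← nTwo_phase_mul (fun η => -(s * η ^ 2)) fun η => invFI (fun ξ => h s ξ η) x]
          congr 1; ext η
          unfold invFI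
          rw [← integral_const_mul]
          congr 1; ext ξ
          simp only [hgdef]; ring
    _ = _ := by
        rw [show ((49 : ℝ≥0) : ℝ≥0∞) = 49 by norm_num]
        ring_nf

/-! ### Families of rapidly decreasing functions of two variables -/

/-- A set of families `a s x y`, bounded by multiples of the weight `w s`, which is stable under
linear combinations, multiplication by `θ s`, `x` and `y`, and under `∂_x` and `∂_y`. -/
structure IsRapidClass (w θ : ℝ → ℝ) (𝒜 : Set (ℝ → ℝ → ℝ → ℂ)) : Prop where
  bound : ∀ a ∈ 𝒜, ∃ C, ∀ s x y, ‖a s x y‖ ≤ C * w s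
  cont : ∀ a ∈ 𝒜, Continuous fun p : ℝ × ℝ × ℝ => a p.1 p.2.1 p.2.2
  add : ∀ a ∈ 𝒜, ∀ b ∈ 𝒜, (fun s x y => a s x y + b s x y) ∈ 𝒜
  smul : ∀ a ∈ 𝒜, ∀ c : ℂ, (fun s x y => c * a s x y) ∈ 𝒜
  mulParam : ∀ a ∈ 𝒜, (fun s x y => (θ s : ℂ) * a s x y) ∈ 𝒜
  mulFst : ∀ a ∈ 𝒜, (fun (s x y : ℝ) => (x : ℂ) * a s x y) ∈ 𝒜
  mulSnd : ∀ a ∈ 𝒜, (fun (s x y : ℝ) => (y : ℂ) * a s x y) ∈ 𝒜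
  derivFst : ∀ a ∈ 𝒜, ∃ b ∈ 𝒜, ∀ s x y, HasDerivAt (fun x' => a s x' y) (b s x y) x
  derivSnd : ∀ a ∈ 𝒜, ∃ b ∈ 𝒜, ∀ s x y, HasDerivAt (fun y' => a s x y') (b s x y) y

namespace IsRapidClass

variable {w θ : ℝ → ℝ} {𝒜 : Set (ℝ → ℝ → ℝ → ℂ)}

lemma mul_weight (h : IsRapidClass w θ 𝒜) {a : ℝ → ℝ → ℝ → ℂ} (ha : a ∈ 𝒜) (m : ℕ) :
    (fun s x y => ((((1 + x ^ 2) * (1 + y ^ 2)) ^ m : ℝ) : ℂ) * a s x y) ∈ 𝒜 := by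
  induction m with
  | zero => simpa using ha
  | succ m ih =>
    have h1 := h.add _ ih _ (h.mulFst _ (h.mulFst _ ih))
    have h2 := h.add _ h1 _ (h.mulSnd _ (h.mulSnd _ h1))
    convert h2 using 4
    push_cast; ring

lemma decay (h : IsRapidClass w θ 𝒜) {a : ℝ → ℝ → ℝ → ℂ} (ha : a ∈ 𝒜) (m : ℕ) :
    ∃ C, ∀ s x y, ((1 + x ^ 2) * (1 + y ^ 2)) ^ m * ‖a s x y‖ ≤ C * w s := by
  obtain ⟨C, hC⟩ := h.bound _ (h.mul_weight ha m)
  refine ⟨C, fun s x y => ?_⟩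
  have := hC s x y
  rwa [norm_mul, Complex.norm_real, Real.norm_of_nonneg (by positivity)] at this

lemma rho_bound (h : IsRapidClass w θ 𝒜) {a : ℝ → ℝ → ℝ → ℂ} (ha : a ∈ 𝒜) :
    ∃ C, ∀ s x y, ‖a s x y‖ ≤ C * (w s * (rho x * rho y)) := by
  obtain ⟨C, hC⟩ := h.decay ha 1
  refine ⟨C, fun s x y => ?_⟩
  have := hC s x y
  rw [pow_one, mul_comm, ← le_div_iff₀ (by positivity)] at this
  refine this.trans_eq ?_
  unfold rho; field_simp

lemma rho_bound_uniform (h : IsRapidClass w θ 𝒜) (w0 : ∀ s, 0 ≤ w s) (w1 : ∀ s, w s ≤ 1)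
    {a : ℝ → ℝ → ℝ → ℂ} (ha : a ∈ 𝒜) :
    ∃ C, ∀ s x y, ‖a s x y‖ ≤ C * (rho x * rho y) := by
  obtain ⟨C, hC⟩ := h.rho_bound ha
  refine ⟨|C|, fun s x y => (hC s x y).trans ?_⟩
  have := mul_pos (rho_pos x) (rho_pos y)
  calc C * (w s * (rho x * rho y)) ≤ |C| * (1 * (rho x * rho y)) := by
        have := w0 s
        gcongr
        · exact le_abs_self C
        · exact w1 s
    _ = _ := by ring

end IsRapidClass

/-! ### The Fourier transform in two variables as an integral over the plane -/

lemma cexp_neg_eq_phase (ξ x η y : ℝ) :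
    cexp (-(I) * ((ξ : ℂ) * x + (η : ℂ) * y)) = phase (-(ξ * x + η * y)) := by
  unfold phase; push_cast; ring_nf

lemma integrable_phase_mul {f : ℝ → ℝ → ℂ} {D : ℝ}
    (hf : Measurable fun p : ℝ × ℝ => f p.1 p.2) (hb : ∀ x y, ‖f x y‖ ≤ D * (rho x * rho y))
    (ξ η : ℝ) : Integrable fun p : ℝ × ℝ => phase (-(ξ * p.1 + η * p.2)) * f p.1 p.2 :=
  integrable_of_rho_prod (f := fun x y => phase (-(ξ * x + η * y)) * f x y) (D := D)
    (by fun_prop) (fun x y => by simpa using hb x y)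

lemma FT2_eq_integral {f : ℝ → ℝ → ℂ} {D : ℝ}
    (hf : Measurable fun p : ℝ × ℝ => f p.1 p.2) (hb : ∀ x y, ‖f x y‖ ≤ D * (rho x * rho y))
    (ξ η : ℝ) : FT2 f ξ η = ∫ p : ℝ × ℝ, phase (-(ξ * p.1 + η * p.2)) * f p.1 p.2 := by
  unfold FT2
  simp only [cexp_neg_eq_phase]
  rw [Measure.volume_eq_prod, integral_prod _ (integrable_phase_mul hf hb ξ η)]

lemma hasDerivAt_phase_lin (a b t : ℝ) :
    HasDerivAt (fun t : ℝ => phase (a + t * b)) (I * b * phase (a + t * b)) t := by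
  unfold phase
  have h : HasDerivAt (fun t : ℝ => ((a + t * b : ℝ) : ℂ) * I) ((b : ℂ) * I) t := by
    have h1 : HasDerivAt (fun t : ℝ => a + t * b) b t := by
      simpa using ((hasDerivAt_id t).mul_const b).const_add a
    exact h1.ofReal_comp.mul_const I
  convert h.cexp using 1
  ring

lemma integral_phase_mul_lineDeriv {f f' : ℝ × ℝ → ℂ} {v : ℝ × ℝ} (hf : Integrable f)
    (hf' : Integrable f') (hd : ∀ p, HasLineDerivAt ℝ f (f' p) p v) (ξ η : ℝ) :
    ∫ p : ℝ × ℝ, phase (-(ξ * p.1 + η * p.2)) * f' p =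
      I * ((ξ * v.1 + η * v.2 : ℝ) : ℂ) * ∫ p : ℝ × ℝ, phase (-(ξ * p.1 + η * p.2)) * f p := by
  have hm : AEStronglyMeasurable (fun p : ℝ × ℝ => phase (-(ξ * p.1 + η * p.2))) volume :=
    Measurable.aestronglyMeasurable (by fun_prop)
  have key := integral_bilinear_hasLineDerivAt_right_eq_neg_left_of_integrable
    (μ := (volume : Measure (ℝ × ℝ))) (B := ContinuousLinearMap.mul ℝ ℂ) (v := v)
    (f := fun p : ℝ × ℝ => phase (-(ξ * p.1 + η * p.2)))
    (f' := fun p : ℝ × ℝ => I * ((-(ξ * v.1 + η * v.2) : ℝ) : ℂ) * phase (-(ξ * p.1 + η * p.2)))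
    (g := f) (g' := f')
    (by
      simp only [ContinuousLinearMap.mul_apply', mul_assoc]
      exact ((hf.bdd_mul hm (c := 1) (ae_of_all _ fun p => by simp)).const_mul _).const_mul _)
    (by
      simp only [ContinuousLinearMap.mul_apply']
      exact hf'.bdd_mul hm (c := 1) (ae_of_all _ fun p => by simp))
    (by
      simp only [ContinuousLinearMap.mul_apply']
      exact hf.bdd_mul hm (c := 1) (ae_of_all _ fun p => by simp))
    (fun p _ => by
      have := hasDerivAt_phase_lin (-(ξ * p.1 + η * p.2)) (-(ξ * v.1 + η * v.2)) 0
      have e : (fun t : ℝ => phase (-(ξ * (p + t • v).1 + η * (p + t • v).2))) =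
          fun t => phase (-(ξ * p.1 + η * p.2) + t * -(ξ * v.1 + η * v.2)) := by
        ext t; congr 1; simp; ring
      show HasDerivAt (fun t : ℝ => phase (-(ξ * (p + t • v).1 + η * (p + t • v).2))) _ 0
      rw [e]
      exact this.congr_deriv (by simp))
    (fun p _ => hd p)
  simp only [ContinuousLinearMap.mul_apply'] at key
  rw [key, ← integral_neg, ← integral_const_mul]
  congr 1; ext p
  push_cast; ring

lemma hasDerivAt_integral_phase {f : ℝ × ℝ → ℂ} {u : ℝ × ℝ → ℝ} (hu : Measurable u)
    {c : ℝ × ℝ → ℝ} (hc : Measurable c) (hf : Integrable f)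
    (hf' : Integrable fun p => (c p : ℂ) * f p) (t : ℝ) :
    HasDerivAt (fun t : ℝ => ∫ p, phase (u p + t * c p) * f p)
      (∫ p, phase (u p + t * c p) * (I * ((c p : ℂ) * f p))) t := by
  have hm : ∀ t : ℝ, AEStronglyMeasurable (fun p : ℝ × ℝ => phase (u p + t * c p)) volume :=
    fun t => Measurable.aestronglyMeasurable (by fun_prop)
  refine (hasDerivAt_integral_of_dominated_loc_of_deriv_le (s := Set.univ) Filter.univ_mem
    (bound := fun p => ‖(c p : ℂ) * f p‖)
    (F' := fun t p => phase (u p + t * c p) * (I * ((c p : ℂ) * f p)))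
    (Filter.Eventually.of_forall fun t => (hm t).mul hf.1)
    (hf.bdd_mul (hm t) (c := 1) (ae_of_all _ fun p => by simp))
    ((hm t).mul (hf'.const_mul I).1)
    (ae_of_all _ fun p t _ => by simp) hf'.norm
    (ae_of_all _ fun p t _ => ?_)).2
  exact ((hasDerivAt_phase_lin (u p) (c p) t).mul_const (f p)).congr_deriv (by ring)

lemma IsRapidClass.fourier {w θ : ℝ → ℝ} {𝒜 : Set (ℝ → ℝ → ℝ → ℂ)} (h : IsRapidClass w θ 𝒜)
    (w0 : ∀ s, 0 ≤ w s) (w1 : ∀ s, w s ≤ 1) :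
    IsRapidClass w θ ((fun a s => FT2 (a s)) '' 𝒜) := by
  have hm : ∀ a ∈ 𝒜, Measurable fun p : ℝ × ℝ × ℝ => a p.1 p.2.1 p.2.2 :=
    fun a ha => (h.cont a ha).measurable
  have hms : ∀ a ∈ 𝒜, ∀ s, Measurable fun p : ℝ × ℝ => a s p.1 p.2 := fun a ha s => by
    have := hm a ha
    fun_prop
  have hInt : ∀ a ∈ 𝒜, ∀ s, Integrable fun p : ℝ × ℝ => a s p.1 p.2 := fun a ha s => by
    obtain ⟨C, hC⟩ := h.rho_bound_uniform w0 w1 ha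
    exact integrable_of_rho_prod (hms a ha s) (hC s)
  have hinp : ∀ a ∈ 𝒜, ∀ s ξ η,
      Integrable fun p : ℝ × ℝ => phase (-(ξ * p.1 + η * p.2)) * a s p.1 p.2 := fun a ha s => by
    obtain ⟨C, hC⟩ := h.rho_bound_uniform w0 w1 ha
    exact integrable_phase_mul (hms a ha s) (hC s)
  have hFT : ∀ a ∈ 𝒜, ∀ s ξ η, FT2 (a s) ξ η =
      ∫ p : ℝ × ℝ, phase (-(ξ * p.1 + η * p.2)) * a s p.1 p.2 := fun a ha s => by
    obtain ⟨C, hC⟩ := h.rho_bound_uniform w0 w1 ha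
    exact FT2_eq_integral (hms a ha s) (hC s)
  refine ⟨?_, ?_, ?_, ?_, ?_, ?_, ?_, ?_, ?_⟩
  · rintro _ ⟨a, ha, rfl⟩
    obtain ⟨C, hC⟩ := h.rho_bound ha
    refine ⟨C * ∫ p : ℝ × ℝ, rho p.1 * rho p.2, fun s ξ η => ?_⟩
    dsimp only
    rw [hFT a ha]
    refine (norm_integral_le_of_norm_le (integrable_rho_prod.const_mul (C * w s))
      (ae_of_all _ fun p => ?_)).trans_eq ?_
    · rw [norm_mul, norm_phase, one_mul, mul_assoc]; exact hC s p.1 p.2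
    · rw [integral_const_mul]; ring
  · rintro _ ⟨a, ha, rfl⟩
    obtain ⟨C, hC⟩ := h.rho_bound_uniform w0 w1 ha
    have hc := h.cont a ha
    simp only [hFT a ha]
    refine continuous_of_dominated (bound := fun p : ℝ × ℝ => C * (rho p.1 * rho p.2))
      (fun q => (hinp a ha q.1 q.2.1 q.2.2).1)
      (fun q => ae_of_all _ fun p => by simpa using hC q.1 p.1 p.2)
      (integrable_rho_prod.const_mul C) (ae_of_all _ fun p => ?_)
    have h2 : Continuous fun q : ℝ × ℝ × ℝ => a q.1 p.1 p.2 :=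
      hc.comp (g := fun p : ℝ × ℝ × ℝ => a p.1 p.2.1 p.2.2)
        (f := fun q : ℝ × ℝ × ℝ => (q.1, p.1, p.2)) (by fun_prop)
    fun_prop
  · rintro _ ⟨a, ha, rfl⟩ _ ⟨b, hb, rfl⟩
    refine ⟨_, h.add a ha b hb, ?_⟩
    ext s ξ η
    dsimp only
    rw [hFT _ (h.add a ha b hb), hFT a ha, hFT b hb, ← integral_add (hinp a ha s ξ η)
      (hinp b hb s ξ η)]
    congr 1; ext p; ring
  · rintro _ ⟨a, ha, rfl⟩ c
    refine ⟨_, h.smul a ha c, ?_⟩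
    ext s ξ η
    dsimp only
    rw [hFT _ (h.smul a ha c), hFT a ha, ← integral_const_mul]
    congr 1; ext p; ring
  · rintro _ ⟨a, ha, rfl⟩
    refine ⟨_, h.mulParam a ha, ?_⟩
    ext s ξ η
    dsimp only
    rw [hFT _ (h.mulParam a ha), hFT a ha, ← integral_const_mul]
    congr 1; ext p; ring
  · rintro _ ⟨a, ha, rfl⟩
    obtain ⟨b, hb, hab⟩ := h.derivFst a ha
    refine ⟨_, h.smul b hb (-I), ?_⟩
    ext s ξ η
    dsimp only
    have key := integral_phase_mul_lineDeriv (v := (1, 0)) (hInt a ha s) (hInt b hb s)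
      (fun p => by
        have := hab s p.1 p.2
        unfold HasLineDerivAt
        rw [← add_zero p.1] at this
        simpa using this.comp_const_add p.1 0) ξ η
    rw [hFT _ (h.smul b hb (-I)), hFT a ha]
    simp only [mul_left_comm _ (-I)]
    rw [integral_const_mul, key, ← mul_assoc, ← mul_assoc]
    simp
  · rintro _ ⟨a, ha, rfl⟩
    obtain ⟨b, hb, hab⟩ := h.derivSnd a ha
    refine ⟨_, h.smul b hb (-I), ?_⟩
    ext s ξ η
    dsimp only
    have key := integral_phase_mul_lineDeriv (v := (0, 1)) (hInt a ha s) (hInt b hb s)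
      (fun p => by
        have := hab s p.1 p.2
        unfold HasLineDerivAt
        rw [← add_zero p.2] at this
        simpa using this.comp_const_add p.2 0) ξ η
    rw [hFT _ (h.smul b hb (-I)), hFT a ha]
    simp only [mul_left_comm _ (-I)]
    rw [integral_const_mul, key, ← mul_assoc, ← mul_assoc]
    simp
  · rintro _ ⟨a, ha, rfl⟩
    have hb := h.smul _ (h.mulFst a ha) (-I)
    refine ⟨_, ⟨_, hb, rfl⟩, fun s ξ η => ?_⟩
    dsimp only
    have key := hasDerivAt_integral_phase (f := fun p => a s p.1 p.2)
      (u := fun p => -(η * p.2)) (by fun_prop) (c := fun p => -p.1) (by fun_prop) (hInt a ha s)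
      (by simpa using (hInt _ (h.mulFst a ha) s).neg) ξ
    rw [hFT _ hb]
    simp only [hFT a ha]
    convert key using 2
    · congr 1; ext p; ring_nf
    · ext p; push_cast; ring_nf
  · rintro _ ⟨a, ha, rfl⟩
    have hb := h.smul _ (h.mulSnd a ha) (-I)
    refine ⟨_, ⟨_, hb, rfl⟩, fun s ξ η => ?_⟩
    dsimp only
    have key := hasDerivAt_integral_phase (f := fun p => a s p.1 p.2)
      (u := fun p => -(ξ * p.1)) (by fun_prop) (c := fun p => -p.2) (by fun_prop) (hInt a ha s)
      (by simpa using (hInt _ (h.mulSnd a ha) s).neg) η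
    rw [hFT _ hb]
    simp only [hFT a ha]
    convert key using 2
    · congr 1; ext p; ring_nf
    · ext p; push_cast; ring_nf

lemma IsRapidClass.phase_mul {w θ : ℝ → ℝ} {𝒜 : Set (ℝ → ℝ → ℝ → ℂ)} (h : IsRapidClass w θ 𝒜)
    (hθ : Continuous θ) :
    IsRapidClass w θ ((fun a s x y => phase (θ s * (y ^ 2 - x ^ 2)) * a s x y) '' 𝒜) := by
  have hph : ∀ v : ℝ → ℝ, ∀ v' x : ℝ, HasDerivAt v v' x →
      HasDerivAt (fun x => phase (v x)) (I * v' * phase (v x)) x := by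
    intro v v' x hv
    have := (hasDerivAt_phase_lin 0 1 (v x)).scomp x hv
    simp only [mul_one, zero_add, Function.comp_def, ofReal_one] at this
    exact this.congr_deriv (by rw [real_smul]; ring)
  refine ⟨?_, ?_, ?_, ?_, ?_, ?_, ?_, ?_, ?_⟩
  · rintro _ ⟨a, ha, rfl⟩
    simpa using h.bound a ha
  · rintro _ ⟨a, ha, rfl⟩
    have := h.cont a ha
    dsimp only
    fun_prop
  · rintro _ ⟨a, ha, rfl⟩ _ ⟨b, hb, rfl⟩
    exact ⟨_, h.add a ha b hb, by ext s x y; ring⟩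
  · rintro _ ⟨a, ha, rfl⟩ c
    exact ⟨_, h.smul a ha c, by ext s x y; ring⟩
  · rintro _ ⟨a, ha, rfl⟩
    exact ⟨_, h.mulParam a ha, by ext s x y; ring⟩
  · rintro _ ⟨a, ha, rfl⟩
    exact ⟨_, h.mulFst a ha, by ext s x y; ring⟩
  · rintro _ ⟨a, ha, rfl⟩
    exact ⟨_, h.mulSnd a ha, by ext s x y; ring⟩
  · rintro _ ⟨a, ha, rfl⟩
    obtain ⟨b, hb, hab⟩ := h.derivFst a ha
    refine ⟨_, ⟨_, h.add b hb _ (h.smul _ (h.mulParam _ (h.mulFst a ha)) (-(2 * I))), rfl⟩,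
      fun s x y => ?_⟩
    have h1 : HasDerivAt (fun x => θ s * (y ^ 2 - x ^ 2)) (θ s * (-(2 * x))) x := by
      simpa using ((hasDerivAt_pow 2 x).const_sub (y ^ 2)).const_mul (θ s)
    refine ((hph _ _ _ h1).mul (hab s x y)).congr_deriv ?_
    push_cast; ring
  · rintro _ ⟨a, ha, rfl⟩
    obtain ⟨b, hb, hab⟩ := h.derivSnd a ha
    refine ⟨_, ⟨_, h.add b hb _ (h.smul _ (h.mulParam _ (h.mulSnd a ha)) (2 * I)), rfl⟩,
      fun s x y => ?_⟩
    have h1 : HasDerivAt (fun y => θ s * (y ^ 2 - x ^ 2)) (θ s * (2 * y)) y := by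
      simpa using ((hasDerivAt_pow 2 y).sub_const (x ^ 2)).const_mul (θ s)
    refine ((hph _ _ _ h1).mul (hab s x y)).congr_deriv ?_
    push_cast; ring

/-! ### Schwartz functions form rapidly decreasing classes -/

lemma SchwartzMap.exists_mul_ofReal {E : Type*} [NormedAddCommGroup E] [NormedSpace ℝ E]
    (F : 𝓢(E, ℂ)) {u : E → ℝ} (hu : Function.HasTemperateGrowth u) :
    ∃ G : 𝓢(E, ℂ), ∀ p, G p = (u p : ℂ) * F p :=
  ⟨SchwartzMap.smulLeftCLM ℂ u F, fun p => by
    rw [SchwartzMap.smulLeftCLM_apply_apply hu]; simp⟩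

lemma SchwartzMap.hasDerivAt_curve {E : Type*} [NormedAddCommGroup E] [NormedSpace ℝ E]
    (F : 𝓢(E, ℂ)) {c : ℝ → E} {v : E} {x : ℝ} (hc : HasDerivAt c v x) :
    HasDerivAt (fun x => F (c x)) ((LineDeriv.lineDerivOp v F : 𝓢(E, ℂ)) (c x)) x := by
  rw [SchwartzMap.lineDerivOp_apply_eq_fderiv]
  exact (F.differentiableAt (x := c x)).hasFDerivAt.comp_hasDerivAt x hc

lemma hasTemperateGrowth_fst {E F : Type*} [NormedAddCommGroup E] [NormedSpace ℝ E]
    [NormedAddCommGroup F] [NormedSpace ℝ F] :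
    Function.HasTemperateGrowth fun p : E × F => p.1 :=
  (ContinuousLinearMap.fst ℝ E F).hasTemperateGrowth

lemma hasTemperateGrowth_snd {E F : Type*} [NormedAddCommGroup E] [NormedSpace ℝ E]
    [NormedAddCommGroup F] [NormedSpace ℝ F] :
    Function.HasTemperateGrowth fun p : E × F => p.2 :=
  (ContinuousLinearMap.snd ℝ E F).hasTemperateGrowth

lemma SchwartzMap.isRapidClass_three (t : ℝ) :
    IsRapidClass rho (fun s => t - s)
      (Set.range fun (F : 𝓢(ℝ × ℝ × ℝ, ℂ)) s x y => F (s, x, y)) := by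
  refine ⟨?_, ?_, ?_, ?_, ?_, ?_, ?_, ?_, ?_⟩
  · rintro _ ⟨F, rfl⟩
    have hu : Function.HasTemperateGrowth fun p : ℝ × ℝ × ℝ => 1 + p.1 ^ 2 := by
      have := hasTemperateGrowth_fst (E := ℝ) (F := ℝ × ℝ)
      fun_prop
    obtain ⟨G, hG⟩ := F.exists_mul_ofReal hu
    obtain ⟨C, hC⟩ := G.decay 0 0
    refine ⟨C, fun s x y => ?_⟩
    have := hC.2 (s, x, y)
    simp only [pow_zero, one_mul, norm_iteratedFDeriv_zero, hG, norm_mul, Complex.norm_real] at this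
    rw [Real.norm_of_nonneg (by positivity)] at this
    rw [rho, ← div_eq_mul_inv, le_div_iff₀ (by positivity), mul_comm]
    exact this
  · rintro _ ⟨F, rfl⟩
    exact F.continuous
  · rintro _ ⟨F, rfl⟩ _ ⟨G, rfl⟩
    exact ⟨F + G, rfl⟩
  · rintro _ ⟨F, rfl⟩ c
    exact ⟨c • F, rfl⟩
  · rintro _ ⟨F, rfl⟩
    have hu : Function.HasTemperateGrowth fun p : ℝ × ℝ × ℝ => t - p.1 := by
      have := hasTemperateGrowth_fst (E := ℝ) (F := ℝ × ℝ)
      fun_prop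
    obtain ⟨G, hG⟩ := F.exists_mul_ofReal hu
    exact ⟨G, by ext s x y; exact hG _⟩
  · rintro _ ⟨F, rfl⟩
    have hu : Function.HasTemperateGrowth fun p : ℝ × ℝ × ℝ => p.2.1 :=
      hasTemperateGrowth_fst.comp hasTemperateGrowth_snd
    obtain ⟨G, hG⟩ := F.exists_mul_ofReal hu
    exact ⟨G, by ext s x y; exact hG _⟩
  · rintro _ ⟨F, rfl⟩
    have hu : Function.HasTemperateGrowth fun p : ℝ × ℝ × ℝ => p.2.2 :=
      hasTemperateGrowth_snd.comp hasTemperateGrowth_snd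
    obtain ⟨G, hG⟩ := F.exists_mul_ofReal hu
    exact ⟨G, by ext s x y; exact hG _⟩
  · rintro _ ⟨F, rfl⟩
    exact ⟨_, ⟨_, rfl⟩, fun s x y => F.hasDerivAt_curve
      ((hasDerivAt_const x s).prodMk ((hasDerivAt_id x).prodMk (hasDerivAt_const x y)))⟩
  · rintro _ ⟨F, rfl⟩
    exact ⟨_, ⟨_, rfl⟩, fun s x y => F.hasDerivAt_curve
      ((hasDerivAt_const y s).prodMk ((hasDerivAt_const y x).prodMk (hasDerivAt_id y)))⟩

lemma SchwartzMap.isRapidClass_two (t : ℝ) :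
    IsRapidClass (fun _ => 1) (fun _ => t)
      (Set.range fun (F : 𝓢(ℝ × ℝ, ℂ)) (_ : ℝ) x y => F (x, y)) := by
  refine ⟨?_, ?_, ?_, ?_, ?_, ?_, ?_, ?_, ?_⟩
  · rintro _ ⟨F, rfl⟩
    obtain ⟨C, hC⟩ := F.decay 0 0
    refine ⟨C, fun s x y => ?_⟩
    simpa using hC.2 (x, y)
  · rintro _ ⟨F, rfl⟩
    exact F.continuous.comp (by fun_prop)
  · rintro _ ⟨F, rfl⟩ _ ⟨G, rfl⟩
    exact ⟨F + G, rfl⟩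
  · rintro _ ⟨F, rfl⟩ c
    exact ⟨c • F, rfl⟩
  · rintro _ ⟨F, rfl⟩
    exact ⟨(t : ℂ) • F, rfl⟩
  · rintro _ ⟨F, rfl⟩
    obtain ⟨G, hG⟩ := F.exists_mul_ofReal hasTemperateGrowth_fst
    exact ⟨G, by ext s x y; exact hG _⟩
  · rintro _ ⟨F, rfl⟩
    obtain ⟨G, hG⟩ := F.exists_mul_ofReal hasTemperateGrowth_snd
    exact ⟨G, by ext s x y; exact hG _⟩
  · rintro _ ⟨F, rfl⟩
    exact ⟨_, ⟨_, rfl⟩, fun s x y => F.hasDerivAt_curve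
      ((hasDerivAt_id x).prodMk (hasDerivAt_const x y))⟩
  · rintro _ ⟨F, rfl⟩
    exact ⟨_, ⟨_, rfl⟩, fun s x y => F.hasDerivAt_curve
      ((hasDerivAt_const y x).prodMk (hasDerivAt_id y))⟩

/-! ### Fourier inversion in the plane -/

lemma FT2_eq_fourier {f : ℝ → ℝ → ℂ} {D : ℝ}
    (hf : Measurable fun p : ℝ × ℝ => f p.1 p.2) (hb : ∀ x y, ‖f x y‖ ≤ D * (rho x * rho y))
    (ξ η : ℝ) : FT2 f ξ η =
      FourierTransform.fourier (fun z : ℂ => f z.re z.im) (⟨ξ / (2 * π), η / (2 * π)⟩ : ℂ) := by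
  rw [FT2_eq_integral hf hb, Real.fourier_eq']
  rw [← Complex.volume_preserving_equiv_real_prod.integral_comp
    Complex.measurableEquivRealProd.measurableEmbedding]
  congr 1; ext z
  simp only [Complex.measurableEquivRealProd_apply, smul_eq_mul]
  congr 1
  unfold phase
  congr 2
  rw [Complex.inner]
  simp
  field_simp
  ring

lemma IFT2_eq_FT2_neg (g : ℝ → ℝ → ℂ) (x y : ℝ) :
    IFT2 g x y = ((2 * (π : ℂ)) ^ 2)⁻¹ * FT2 g (-x) (-y) := by
  unfold IFT2 FT2
  congr 3; ext ξ; congr 1; ext η; congr 2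
  push_cast; ring

lemma rho_two_pi_mul_le (x : ℝ) : rho (2 * π * x) ≤ rho x := by
  unfold rho
  have : 1 ≤ (2 * π) ^ 2 := by nlinarith [Real.pi_gt_three]
  rw [mul_pow]
  gcongr
  nlinarith [sq_nonneg x]

lemma integrable_complex_of_rho {f : ℝ → ℝ → ℂ} {D : ℝ}
    (hf : Measurable fun p : ℝ × ℝ => f p.1 p.2) (hb : ∀ x y, ‖f x y‖ ≤ D * (rho x * rho y)) :
    Integrable fun z : ℂ => f z.re z.im :=
  (Complex.volume_preserving_equiv_real_prod.integrable_comp_emb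
    Complex.measurableEquivRealProd.measurableEmbedding).2 (integrable_of_rho_prod hf hb)

lemma IFT2_FT2 {f : ℝ → ℝ → ℂ} {D D' : ℝ} (hf : Continuous fun p : ℝ × ℝ => f p.1 p.2)
    (hb : ∀ x y, ‖f x y‖ ≤ D * (rho x * rho y))
    (hm : Measurable fun p : ℝ × ℝ => FT2 f p.1 p.2)
    (hb' : ∀ x y, ‖FT2 f x y‖ ≤ D' * (rho x * rho y)) (x y : ℝ) :
    IFT2 (FT2 f) x y = f x y := by
  have hD' : 0 ≤ D' := nonneg_of_mul_nonneg_left ((norm_nonneg _).trans (hb' 0 0))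
    (mul_pos (rho_pos 0) (rho_pos 0))
  have hpi : (2 * π) ≠ 0 := by positivity
  set f' : ℂ → ℂ := fun z => f z.re z.im with hf'
  have hcont : Continuous f' := hf.comp (f := fun z : ℂ => (z.re, z.im)) (by fun_prop)
  have hInt : Integrable f' := integrable_complex_of_rho hf.measurable hb
  have hFF : FourierTransform.fourier f' =
      fun z : ℂ => FT2 f (2 * π * z.re) (2 * π * z.im) := by
    ext z
    rw [FT2_eq_fourier hf.measurable hb]
    rw [mul_div_cancel_left₀ _ hpi, mul_div_cancel_left₀ _ hpi]
  have hInt' : Integrable (FourierTransform.fourier f') := by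
    rw [hFF]
    refine integrable_complex_of_rho (f := fun a b => FT2 f (2 * π * a) (2 * π * b)) (D := D')
      (by fun_prop) fun a b => (hb' _ _).trans ?_
    have := rho_pos (2 * π * b)
    have := rho_pos a
    gcongr <;> exact rho_two_pi_mul_le _
  have key := congrFun (hcont.fourierInv_fourier_eq hInt hInt') (⟨x, y⟩ : ℂ)
  rw [show f' ⟨x, y⟩ = f x y from rfl] at key
  rw [← key, hFF, Real.fourierInv_eq', IFT2_eq_FT2_neg, FT2_eq_integral hm hb',
    ← Complex.volume_preserving_equiv_real_prod.integral_comp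
    Complex.measurableEquivRealProd.measurableEmbedding]
  have hs := Measure.integral_comp_smul (volume : Measure ℂ)
    (fun z : ℂ => phase (-(-x * z.re + -y * z.im)) * FT2 f z.re z.im) (2 * π)
  rw [Complex.finrank_real_complex, abs_of_pos (by positivity)] at hs
  simp only [Complex.measurableEquivRealProd_apply]
  rw [show ((2 * (π : ℂ)) ^ 2)⁻¹ = ((((2 * π) ^ 2)⁻¹ : ℝ) : ℂ) by push_cast; rfl,
    ← real_smul, ← hs]
  congr 1; ext z
  simp only [real_smul, smul_eq_mul, re_ofReal_mul, im_ofReal_mul]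
  congr 1
  unfold phase
  congr 1
  rw [Complex.inner]
  push_cast
  simp
  ring

lemma FT2_IFT2 {g : ℝ → ℝ → ℂ} {D D' : ℝ} (hg : Continuous fun p : ℝ × ℝ => g p.1 p.2)
    (hb : ∀ x y, ‖g x y‖ ≤ D * (rho x * rho y))
    (hm : Measurable fun p : ℝ × ℝ => FT2 g p.1 p.2)
    (hb' : ∀ x y, ‖FT2 g x y‖ ≤ D' * (rho x * rho y)) (ξ η : ℝ) :
    FT2 (IFT2 g) ξ η = g ξ η := by
  rw [← IFT2_FT2 hg hb hm hb' ξ η]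
  simp only [FT2, IFT2]
  rw [← integral_neg_eq_self, ← integral_const_mul]
  congr 1; ext x
  rw [← integral_neg_eq_self, ← integral_const_mul]
  congr 1; ext y
  rw [mul_left_comm]
  congr 2
  · push_cast; ring_nf
  · congr 1; ext a; congr 1; ext b; push_cast; ring_nf

/-! ### The multiplier `(ξ² + η²)^{σ/2}` -/

/-- The symbol of the `σ`-th power of the gradient in two variables. -/
def gradSymb (σ ξ η : ℝ) : ℝ := (ξ ^ 2 + η ^ 2) ^ (σ / 2)

@[fun_prop] lemma measurable_gradSymb (σ : ℝ) :
    Measurable fun p : ℝ × ℝ => gradSymb σ p.1 p.2 := by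
  unfold gradSymb; fun_prop

lemma gradSymb_nonneg (σ ξ η : ℝ) : 0 ≤ gradSymb σ ξ η := by unfold gradSymb; positivity

lemma one_le_weight (ξ η : ℝ) : 1 ≤ (1 + ξ ^ 2) * (1 + η ^ 2) := by
  nlinarith [sq_nonneg ξ, sq_nonneg η, mul_nonneg (sq_nonneg ξ) (sq_nonneg η)]

lemma add_sq_rpow_le {τ : ℝ} (hτ : 0 ≤ τ) {M : ℕ} (hM : τ ≤ M) (ξ η : ℝ) :
    (ξ ^ 2 + η ^ 2) ^ τ ≤ ((1 + ξ ^ 2) * (1 + η ^ 2)) ^ M := by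
  calc (ξ ^ 2 + η ^ 2) ^ τ ≤ ((1 + ξ ^ 2) * (1 + η ^ 2)) ^ τ := by
        gcongr
        nlinarith [mul_nonneg (sq_nonneg ξ) (sq_nonneg η)]
    _ ≤ ((1 + ξ ^ 2) * (1 + η ^ 2)) ^ (M : ℝ) :=
        Real.rpow_le_rpow_of_exponent_le (one_le_weight ξ η) hM
    _ = _ := Real.rpow_natCast _ _

lemma gradSymb_le {σ : ℝ} (hσ : 0 ≤ σ) (ξ η : ℝ) :
    gradSymb σ ξ η ≤ ((1 + ξ ^ 2) * (1 + η ^ 2)) ^ ⌈σ⌉₊ :=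
  add_sq_rpow_le (by positivity) (by linarith [Nat.le_ceil σ]) ξ η

lemma le_rho_of_weight_mul_le {a C ξ η : ℝ} {M : ℕ}
    (h : ((1 + ξ ^ 2) * (1 + η ^ 2)) ^ (M + 1) * a ≤ C) :
    ((1 + ξ ^ 2) * (1 + η ^ 2)) ^ M * a ≤ C * (rho ξ * rho η) := by
  have e : C * (rho ξ * rho η) = C / ((1 + ξ ^ 2) * (1 + η ^ 2)) := by
    unfold rho; field_simp
  rw [e, le_div_iff₀ (by positivity)]
  calc _ = _ := by ring
    _ ≤ C := h

lemma norm_gradSymb_mul_le {σ : ℝ} (hσ : 0 ≤ σ) {a : ℂ} {C ξ η : ℝ}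
    (h : ((1 + ξ ^ 2) * (1 + η ^ 2)) ^ (⌈σ⌉₊ + 1) * ‖a‖ ≤ C) :
    ‖(gradSymb σ ξ η : ℂ) * a‖ ≤ C * (rho ξ * rho η) := by
  rw [norm_mul, Complex.norm_real, Real.norm_of_nonneg (gradSymb_nonneg _ _ _)]
  refine le_trans ?_ (le_rho_of_weight_mul_le h)
  gcongr
  exact gradSymb_le hσ ξ η

/-- The `ξ`-derivative of `gradSymb`. -/
def gradSymbDeriv (σ ξ η : ℝ) : ℝ := σ * ξ * (ξ ^ 2 + η ^ 2) ^ (σ / 2 - 1)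

@[fun_prop] lemma measurable_gradSymbDeriv (σ : ℝ) :
    Measurable fun p : ℝ × ℝ => gradSymbDeriv σ p.1 p.2 := by
  unfold gradSymbDeriv; fun_prop

lemma hasDerivAt_gradSymb {σ η : ℝ} (hη : η ≠ 0) (ξ : ℝ) :
    HasDerivAt (fun ξ => gradSymb σ ξ η) (gradSymbDeriv σ ξ η) ξ := by
  have h : HasDerivAt (fun ξ : ℝ => ξ ^ 2 + η ^ 2) (2 * ξ) ξ := by
    simpa using (hasDerivAt_pow 2 ξ).add_const (η ^ 2)
  refine (h.rpow_const (p := σ / 2) (Or.inl (by positivity))).congr_deriv ?_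
  unfold gradSymbDeriv; ring

lemma abs_gradSymbDeriv_le {σ : ℝ} (hσ : 0 ≤ σ) {η : ℝ} (hη : η ≠ 0) (ξ : ℝ) :
    |gradSymbDeriv σ ξ η| ≤ σ * (ξ ^ 2 + η ^ 2) ^ ((σ - 1) / 2) := by
  have hp : 0 < ξ ^ 2 + η ^ 2 := by positivity
  unfold gradSymbDeriv
  rw [abs_mul, abs_mul, abs_of_nonneg hσ, abs_of_pos (Real.rpow_pos_of_pos hp _), mul_assoc]
  gcongr
  have h1 : |ξ| ≤ (ξ ^ 2 + η ^ 2) ^ (1 / 2 : ℝ) := by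
    rw [← Real.sqrt_eq_rpow]
    exact Real.abs_le_sqrt (by nlinarith [sq_nonneg η])
  calc |ξ| * (ξ ^ 2 + η ^ 2) ^ (σ / 2 - 1)
      ≤ (ξ ^ 2 + η ^ 2) ^ (1 / 2 : ℝ) * (ξ ^ 2 + η ^ 2) ^ (σ / 2 - 1) := by gcongr
    _ = _ := by rw [← Real.rpow_add hp]; ring_nf

lemma abs_gradSymbDeriv_le_weight {σ : ℝ} (hσ : 0 ≤ σ) {η : ℝ} (hη : η ≠ 0) :
    ∃ K, 0 ≤ K ∧ ∀ ξ, |gradSymbDeriv σ ξ η| ≤ K * ((1 + ξ ^ 2) * (1 + η ^ 2)) ^ ⌈σ⌉₊ := by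
  rcases le_or_gt 1 σ with h | h
  · refine ⟨σ, hσ, fun ξ => (abs_gradSymbDeriv_le hσ hη ξ).trans ?_⟩
    gcongr
    exact add_sq_rpow_le (by linarith) (by linarith [Nat.le_ceil σ]) ξ η
  · refine ⟨σ * (η ^ 2) ^ ((σ - 1) / 2), by positivity, fun ξ =>
      (abs_gradSymbDeriv_le hσ hη ξ).trans ?_⟩
    rw [mul_assoc]
    gcongr
    refine (Real.rpow_le_rpow_of_nonpos (by positivity) (by nlinarith [sq_nonneg ξ] :
      η ^ 2 ≤ ξ ^ 2 + η ^ 2) (by linarith)).trans ?_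
    exact le_mul_of_one_le_right (by positivity) (one_le_pow₀ (one_le_weight ξ η))

lemma exists_sq_gradSymbDeriv_le {σ : ℝ} (hσ : 0 ≤ σ) :
    ∃ α : ℝ, 0 ≤ α ∧ α < 1 ∧ ∀ ξ η : ℝ, ξ ≠ 0 → η ≠ 0 → gradSymbDeriv σ ξ η ^ 2 ≤
      σ ^ 2 * ((|ξ| ^ (-α) * |η| ^ (-α)) * ((1 + ξ ^ 2) * (1 + η ^ 2)) ^ ⌈σ⌉₊) := by
  have hsq : ∀ ξ η : ℝ, η ≠ 0 →
      gradSymbDeriv σ ξ η ^ 2 ≤ σ ^ 2 * (ξ ^ 2 + η ^ 2) ^ (σ - 1) := fun ξ η hη => by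
    have := abs_gradSymbDeriv_le hσ hη ξ
    calc gradSymbDeriv σ ξ η ^ 2 = |gradSymbDeriv σ ξ η| ^ 2 := (sq_abs _).symm
      _ ≤ (σ * (ξ ^ 2 + η ^ 2) ^ ((σ - 1) / 2)) ^ 2 := by gcongr
      _ = _ := by
        rw [mul_pow, ← Real.rpow_natCast ((ξ ^ 2 + η ^ 2) ^ ((σ - 1) / 2)),
          ← Real.rpow_mul (by positivity)]
        norm_num
  rcases eq_or_lt_of_le hσ with h0 | h0
  · exact ⟨0, le_rfl, one_pos, fun ξ η _ _ => by simp [gradSymbDeriv, ← h0]⟩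
  rcases le_or_gt 1 σ with h | h
  · refine ⟨0, le_rfl, one_pos, fun ξ η _ hη => (hsq ξ η hη).trans ?_⟩
    gcongr
    simp only [neg_zero, Real.rpow_zero, one_mul]
    exact add_sq_rpow_le (by linarith) (by linarith [Nat.le_ceil σ]) ξ η
  · refine ⟨1 - σ, by linarith, by linarith, fun ξ η hξ hη => (hsq ξ η hη).trans ?_⟩
    gcongr
    have hξ' := abs_pos.2 hξ
    have hη' := abs_pos.2 hη
    rw [neg_sub, ← Real.mul_rpow (abs_nonneg _) (abs_nonneg _)]
    refine (Real.rpow_le_rpow_of_nonpos (by positivity) (?_ :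
      |ξ| * |η| ≤ ξ ^ 2 + η ^ 2) (by linarith)).trans ?_
    · rw [← sq_abs ξ, ← sq_abs η]
      nlinarith [sq_nonneg (|ξ| - |η|)]
    · exact le_mul_of_one_le_right (by positivity) (one_le_pow₀ (one_le_weight ξ η))

lemma integrable_abs_rpow_mul_rho {α : ℝ} (h0 : 0 ≤ α) (h1 : α < 1) :
    Integrable fun x : ℝ => |x| ^ (-α) * rho x := by
  set f : ℝ → ℝ := (Set.Ioo (0 : ℝ) 1).indicator fun x => x ^ (-α) with hf
  have hfi : Integrable f := by
    rw [hf, integrable_indicator_iff measurableSet_Ioo]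
    exact (intervalIntegral.integrableOn_Ioo_rpow_iff one_pos).2 (by linarith)
  have hf0 : ∀ x, 0 ≤ f x := fun x => Set.indicator_nonneg (fun x hx => by
    have := hx.1
    positivity) x
  refine ((hfi.add hfi.comp_neg).add integrable_rho).mono' (by fun_prop) ?_
  filter_upwards [Measure.ae_ne volume (0 : ℝ)] with x hx
  have hx' := abs_pos.2 hx
  have hr := rho_pos x
  rw [Real.norm_of_nonneg (by positivity)]
  simp only [Pi.add_apply]
  rcases lt_or_ge |x| 1 with hlt | hge
  · have hle : |x| ^ (-α) ≤ f x + f (-x) := by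
      rcases lt_or_gt_of_ne hx with hneg | hpos
      · have : f (-x) = |x| ^ (-α) := by
          rw [hf, Set.indicator_of_mem, abs_of_neg hneg]
          rw [abs_of_neg hneg] at hlt
          exact ⟨by linarith, hlt⟩
        linarith [hf0 x]
      · have : f x = |x| ^ (-α) := by
          rw [hf, Set.indicator_of_mem, abs_of_pos hpos]
          rw [abs_of_pos hpos] at hlt
          exact ⟨hpos, hlt⟩
        linarith [hf0 (-x)]
    have : |x| ^ (-α) * rho x ≤ |x| ^ (-α) * 1 := by
      gcongr; exact rho_le_one x
    linarith
  · have : |x| ^ (-α) ≤ 1 := Real.rpow_le_one_of_one_le_of_nonpos hge (by linarith)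
    have : |x| ^ (-α) * rho x ≤ 1 * rho x := by gcongr
    linarith [hf0 x, hf0 (-x)]

/-! ### Finiteness of the mixed norms of `|∇|^σ` of a Schwartz function -/

lemma invFI_deriv {u u' : ℝ → ℂ} {D D' : ℝ} (hum : Measurable u) (hum' : Measurable u')
    (hb : ∀ ξ, ‖u ξ‖ ≤ D * rho ξ) (hb' : ∀ ξ, ‖u' ξ‖ ≤ D' * rho ξ)
    (hd : ∀ ξ, HasDerivAt u (u' ξ) ξ) (x : ℝ) : invFI u' x = -(I * x * invFI u x) := by
  have hph : ∀ ξ, HasDerivAt (fun ξ : ℝ => phase (ξ * x)) (I * x * phase (ξ * x)) ξ := fun ξ => by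
    simpa using hasDerivAt_phase_lin 0 x ξ
  have hi : Integrable fun ξ => phase (ξ * x) * u ξ :=
    integrable_of_rho (D := D) (by fun_prop) fun ξ => by simpa using hb ξ
  have hi' : Integrable fun ξ => phase (ξ * x) * u' ξ :=
    integrable_of_rho (D := D') (by fun_prop) fun ξ => by simpa using hb' ξ
  have key := integral_mul_deriv_eq_deriv_mul_of_integrable
    (fun ξ _ => hph ξ) (fun ξ _ => hd ξ) hi'
    ((hi.const_mul (I * x)).congr (ae_of_all _ fun ξ => by simp [mul_assoc])) hi
  unfold invFI
  rw [key, ← integral_const_mul]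
  simp_rw [mul_assoc]

lemma integrable_abs_rpow_mul_rho_prod {α : ℝ} (h0 : 0 ≤ α) (h1 : α < 1) :
    Integrable fun p : ℝ × ℝ => (|p.1| ^ (-α) * rho p.1) * (|p.2| ^ (-α) * rho p.2) :=
  (integrable_abs_rpow_mul_rho h0 h1).mul_prod (integrable_abs_rpow_mul_rho h0 h1)

lemma norm_sq_le_of_weight {σ : ℝ} {a : ℂ} {C ξ η : ℝ}
    (h : ((1 + ξ ^ 2) * (1 + η ^ 2)) ^ (⌈σ⌉₊ + 1) * ‖a‖ ≤ C) :
    ((1 + ξ ^ 2) * (1 + η ^ 2)) ^ ⌈σ⌉₊ * ‖a‖ ^ 2 ≤ C ^ 2 * (rho ξ * rho η) := by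
  have h1 := one_le_weight ξ η
  have hn := norm_nonneg a
  have h2 : ‖a‖ ≤ C := le_trans (le_mul_of_one_le_left hn (one_le_pow₀ h1)) h
  have h3 := le_rho_of_weight_mul_le h
  have hρ := mul_pos (rho_pos ξ) (rho_pos η)
  have hC : 0 ≤ C := hn.trans h2
  calc _ = ((1 + ξ ^ 2) * (1 + η ^ 2)) ^ ⌈σ⌉₊ * ‖a‖ * ‖a‖ := by ring
    _ ≤ (C * (rho ξ * rho η)) * C := by gcongr
    _ = _ := by ring

/-- Square integrability of the `ξ`-derivative of `gradSymb σ · H`. -/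
lemma L2K_gradSymb_deriv_ne_top {σ : ℝ} (hσ : 0 ≤ σ) {H H' : ℝ → ℝ → ℂ} {C C' : ℝ}
    (hH : Measurable fun p : ℝ × ℝ => H p.1 p.2) (hH' : Measurable fun p : ℝ × ℝ => H' p.1 p.2)
    (hb : ∀ ξ η, ((1 + ξ ^ 2) * (1 + η ^ 2)) ^ (⌈σ⌉₊ + 1) * ‖H ξ η‖ ≤ C)
    (hb' : ∀ ξ η, ((1 + ξ ^ 2) * (1 + η ^ 2)) ^ (⌈σ⌉₊ + 1) * ‖H' ξ η‖ ≤ C') :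
    L2K (fun ξ η => (gradSymbDeriv σ ξ η : ℂ) * H ξ η + (gradSymb σ ξ η : ℂ) * H' ξ η) ≠ ∞ := by
  refine (MemLp.eLpNorm_lt_top (p := 2) (MemLp.add ?_ ?_)).ne
  · rw [memLp_two_iff_integrable_sq_norm (Measurable.aestronglyMeasurable (by fun_prop))]
    obtain ⟨α, h0, h1, hα⟩ := exists_sq_gradSymbDeriv_le hσ
    refine ((integrable_abs_rpow_mul_rho_prod h0 h1).const_mul (σ ^ 2 * C ^ 2)).mono'
      (by fun_prop) ?_
    have hne : ∀ᵐ p : ℝ × ℝ, p.1 ≠ 0 ∧ p.2 ≠ 0 := by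
      rw [Measure.volume_eq_prod]
      exact (Measure.quasiMeasurePreserving_fst.ae (Measure.ae_ne volume (0 : ℝ))).and
        (Measure.quasiMeasurePreserving_snd.ae (Measure.ae_ne volume (0 : ℝ)))
    filter_upwards [hne] with p hp
    rw [Real.norm_of_nonneg (by positivity), norm_mul, Complex.norm_real, mul_pow, Real.norm_eq_abs,
      sq_abs]
    have e1 := hα p.1 p.2 hp.1 hp.2
    have e2 := norm_sq_le_of_weight (hb p.1 p.2)
    calc _ ≤ σ ^ 2 * ((|p.1| ^ (-α) * |p.2| ^ (-α)) *
            ((1 + p.1 ^ 2) * (1 + p.2 ^ 2)) ^ ⌈σ⌉₊) * ‖H p.1 p.2‖ ^ 2 := by gcongr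
      _ = σ ^ 2 * (|p.1| ^ (-α) * |p.2| ^ (-α)) *
            (((1 + p.1 ^ 2) * (1 + p.2 ^ 2)) ^ ⌈σ⌉₊ * ‖H p.1 p.2‖ ^ 2) := by ring
      _ ≤ σ ^ 2 * (|p.1| ^ (-α) * |p.2| ^ (-α)) * (C ^ 2 * (rho p.1 * rho p.2)) := by gcongr
      _ = _ := by ring
  · refine ⟨Measurable.aestronglyMeasurable (by fun_prop), lt_top_iff_ne_top.2 ?_⟩
    exact L2K_ne_top_of_rho (g := fun ξ η => (gradSymb σ ξ η : ℂ) * H' ξ η) (D := C')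
      (by fun_prop) fun ξ η => norm_gradSymb_mul_le hσ (hb' ξ η)

lemma lintegral_sq_mul_nTwo_invFI_le {σ : ℝ} (hσ : 0 ≤ σ) {H H' : ℝ → ℝ → ℂ} {C C' : ℝ}
    (hH : Measurable fun p : ℝ × ℝ => H p.1 p.2) (hH' : Measurable fun p : ℝ × ℝ => H' p.1 p.2)
    (hd : ∀ ξ η, HasDerivAt (fun ξ => H ξ η) (H' ξ η) ξ)
    (hb : ∀ ξ η, ((1 + ξ ^ 2) * (1 + η ^ 2)) ^ (⌈σ⌉₊ + 1) * ‖H ξ η‖ ≤ C)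
    (hb' : ∀ ξ η, ((1 + ξ ^ 2) * (1 + η ^ 2)) ^ (⌈σ⌉₊ + 1) * ‖H' ξ η‖ ≤ C') :
    ∫⁻ x : ℝ, ‖x‖ₑ ^ 2 * nTwo (fun η => invFI (fun ξ => (gradSymb σ ξ η : ℂ) * H ξ η) x) ^ 2 =
      ENNReal.ofReal (2 * π) *
      L2K (fun ξ η => (gradSymbDeriv σ ξ η : ℂ) * H ξ η + (gradSymb σ ξ η : ℂ) * H' ξ η) ^ 2 := by
  set U : ℝ → ℝ → ℂ :=
    fun ξ η => (gradSymbDeriv σ ξ η : ℂ) * H ξ η + (gradSymb σ ξ η : ℂ) * H' ξ η with hU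
  have hUm : Measurable fun p : ℝ × ℝ => U p.1 p.2 := by simp only [hU]; fun_prop
  have hm : Measurable fun p : ℝ × ℝ =>
      invFI (fun ξ => (gradSymb σ ξ p.2 : ℂ) * H ξ p.2) p.1 := by fun_prop
  simp_rw [nTwo_sq]
  have e : ∀ x : ℝ, ‖x‖ₑ ^ 2 * ∫⁻ η, ‖invFI (fun ξ => (gradSymb σ ξ η : ℂ) * H ξ η) x‖ₑ ^ 2 =
      ∫⁻ η, ‖x‖ₑ ^ 2 * ‖invFI (fun ξ => (gradSymb σ ξ η : ℂ) * H ξ η) x‖ₑ ^ 2 := fun x =>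
    (lintegral_const_mul _ (by fun_prop)).symm
  simp_rw [e]
  rw [lintegral_lintegral_swap (by fun_prop), L2K_sq hUm, ← lintegral_const_mul _ (by fun_prop)]
  refine lintegral_congr_ae ?_
  filter_upwards [Measure.ae_ne volume (0 : ℝ)] with η hη
  obtain ⟨K, hK, hKb⟩ := abs_gradSymbDeriv_le_weight hσ hη
  have hb1 : ∀ ξ, ‖(gradSymb σ ξ η : ℂ) * H ξ η‖ ≤ (C * rho η) * rho ξ := fun ξ =>
    (norm_gradSymb_mul_le hσ (hb ξ η)).trans (le_of_eq (by ring))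
  have hb2 : ∀ ξ, ‖U ξ η‖ ≤ ((K * C + C') * rho η) * rho ξ := fun ξ => by
    have e1 : ‖(gradSymbDeriv σ ξ η : ℂ) * H ξ η‖ ≤ K * (C * (rho ξ * rho η)) := by
      rw [norm_mul, Complex.norm_real, Real.norm_eq_abs]
      calc _ ≤ K * ((1 + ξ ^ 2) * (1 + η ^ 2)) ^ ⌈σ⌉₊ * ‖H ξ η‖ := by gcongr; exact hKb ξ
        _ = K * (((1 + ξ ^ 2) * (1 + η ^ 2)) ^ ⌈σ⌉₊ * ‖H ξ η‖) := by ring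
        _ ≤ _ := mul_le_mul_of_nonneg_left (le_rho_of_weight_mul_le (hb ξ η)) hK
    calc _ ≤ _ := norm_add_le _ _
      _ ≤ K * (C * (rho ξ * rho η)) + C' * (rho ξ * rho η) :=
        add_le_add e1 (norm_gradSymb_mul_le hσ (hb' ξ η))
      _ = _ := by ring
  have hum : Measurable fun ξ => U ξ η := by fun_prop
  rw [← lintegral_invFI_sq _ (integrable_of_rho hum hb2) (memLp_two_of_rho hum hb2)]
  refine lintegral_congr fun x => ?_
  rw [invFI_deriv (u := fun ξ => (gradSymb σ ξ η : ℂ) * H ξ η) (by fun_prop) hum hb1 hb2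
    (fun ξ => (hasDerivAt_gradSymb hη ξ).ofReal_comp.mul (hd ξ η)) x, enorm_neg, enorm_mul,
    enorm_mul, mul_pow, mul_pow]
  simp [← ofReal_norm]

lemma lintegral_ne_top_of_weighted {n : ℝ → ℝ≥0∞} (hn : Measurable n)
    (h0 : ∫⁻ x, n x ^ 2 ≠ ∞) (h1 : ∫⁻ x : ℝ, ‖x‖ₑ ^ 2 * n x ^ 2 ≠ ∞) : ∫⁻ x, n x ≠ ∞ := by
  set a : ℝ → ℝ≥0∞ := fun x => ENNReal.ofReal (rho x) ^ (1 / 2 : ℝ)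
  set b : ℝ → ℝ≥0∞ := fun x => ENNReal.ofReal (1 + x ^ 2) ^ (1 / 2 : ℝ)
  have hab : ∀ x, n x = a x * (b x * n x) := fun x => by
    have hr : rho x * (1 + x ^ 2) = 1 := by unfold rho; field_simp
    rw [← mul_assoc, ← ENNReal.mul_rpow_of_nonneg _ _ (by norm_num),
      ← ENNReal.ofReal_mul (rho_pos x).le, hr]
    simp
  have ha2 : ∫⁻ x, a x ^ 2 ≠ ∞ := by
    simp_rw [a, rpow_half_sq]
    exact integrable_rho.lintegral_lt_top.ne
  have hb2 : ∫⁻ x, (b x * n x) ^ 2 ≠ ∞ := by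
    have e : ∀ x, (b x * n x) ^ 2 = n x ^ 2 + ‖x‖ₑ ^ 2 * n x ^ 2 := fun x => by
      have : ENNReal.ofReal (1 + x ^ 2) = 1 + ‖x‖ₑ ^ 2 := by
        rw [ENNReal.ofReal_add zero_le_one (sq_nonneg x), ENNReal.ofReal_one, ← ofReal_norm,
          ← ENNReal.ofReal_pow (norm_nonneg x), Real.norm_eq_abs, sq_abs]
      rw [mul_pow, rpow_half_sq, this]; ring
    simp_rw [e]
    rw [lintegral_add_left (by fun_prop)]
    exact ENNReal.add_ne_top.2 ⟨h0, h1⟩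
  have := lintegral_mul_le_sqrt_mul_sqrt (μ := volume) (f := a) (g := fun x => b x * n x)
    (by fun_prop) (by fun_prop)
  simp_rw [← hab] at this
  exact ne_top_of_le_ne_top (ENNReal.mul_ne_top
    (ENNReal.rpow_ne_top_of_nonneg (by norm_num) ha2)
    (ENNReal.rpow_ne_top_of_nonneg (by norm_num) hb2)) this

lemma eLpNorm_ne_top_of_one_of_two {n : ℝ → ℝ≥0∞} (hn : Measurable n) {p : ℝ≥0∞} (hp1 : 1 ≤ p)
    (hp2 : p ≤ 2) (h1 : ∫⁻ x, n x ≠ ∞) (h2 : ∫⁻ x, n x ^ 2 ≠ ∞) : eLpNorm n p volume ≠ ∞ := by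
  have hpt : p ≠ ∞ := ne_top_of_le_ne_top (by norm_num) hp2
  have hp0 : p ≠ 0 := (zero_lt_one.trans_le hp1).ne'
  have hr1 : 1 ≤ p.toReal := by simpa using ENNReal.toReal_mono hpt hp1
  have hr2 : p.toReal ≤ 2 := by simpa using ENNReal.toReal_mono (by norm_num) hp2
  refine ((eLpNorm_lt_top_iff_lintegral_rpow_enorm_lt_top hp0 hpt).2 ?_).ne
  refine lt_of_le_of_lt (b := ∫⁻ x, n x + n x ^ 2) (lintegral_mono fun x => ?_) ?_
  · simp only [enorm_eq_self]
    rcases le_total (n x) 1 with h | h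
    · calc n x ^ p.toReal ≤ n x ^ (1 : ℝ) := ENNReal.rpow_le_rpow_of_exponent_ge h hr1
        _ = n x := ENNReal.rpow_one _
        _ ≤ _ := le_self_add
    · calc n x ^ p.toReal ≤ n x ^ (2 : ℝ) := ENNReal.rpow_le_rpow_of_exponent_le h hr2
        _ = n x ^ 2 := ENNReal.rpow_two _
        _ ≤ _ := le_add_self
  · rw [lintegral_add_left hn]
    exact lt_top_iff_ne_top.2 (ENNReal.add_ne_top.2 ⟨h1, h2⟩)

lemma eLpNorm_IFT2_gradSymb_ne_top {σ : ℝ} (hσ : 0 ≤ σ) {H H' : ℝ → ℝ → ℂ} {C C' : ℝ}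
    (hH : Measurable fun p : ℝ × ℝ => H p.1 p.2) (hH' : Measurable fun p : ℝ × ℝ => H' p.1 p.2)
    (hd : ∀ ξ η, HasDerivAt (fun ξ => H ξ η) (H' ξ η) ξ)
    (hb : ∀ ξ η, ((1 + ξ ^ 2) * (1 + η ^ 2)) ^ (⌈σ⌉₊ + 1) * ‖H ξ η‖ ≤ C)
    (hb' : ∀ ξ η, ((1 + ξ ^ 2) * (1 + η ^ 2)) ^ (⌈σ⌉₊ + 1) * ‖H' ξ η‖ ≤ C')
    {p : ℝ≥0∞} (hp1 : 1 ≤ p) (hp2 : p ≤ 2) :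
    eLpNorm (fun x => eLpNorm (IFT2 (fun ξ η => (gradSymb σ ξ η : ℂ) * H ξ η) x) 2 volume) p
      volume ≠ ∞ := by
  set g : ℝ → ℝ → ℂ := fun ξ η => (gradSymb σ ξ η : ℂ) * H ξ η with hg
  have hgm : Measurable fun p : ℝ × ℝ => g p.1 p.2 := by simp only [hg]; fun_prop
  have hgb : ∀ ξ η, ‖g ξ η‖ ≤ C * (rho ξ * rho η) := fun ξ η => norm_gradSymb_mul_le hσ (hb ξ η)
  set n : ℝ → ℝ≥0∞ := fun x => nTwo fun η => invFI (fun ξ => g ξ η) x with hn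
  have hnm : Measurable n := by simp only [hn]; fun_prop
  have h2 : ∫⁻ x, n x ^ 2 ≠ ∞ := by
    rw [hn, lintegral_nTwo_invFI_sq hgm hgb]
    exact ENNReal.mul_ne_top ENNReal.ofReal_ne_top
      (ENNReal.pow_ne_top (L2K_ne_top_of_rho hgm hgb))
  have h1 : ∫⁻ x, n x ≠ ∞ := by
    refine lintegral_ne_top_of_weighted hnm h2 ?_
    rw [hn, hg, lintegral_sq_mul_nTwo_invFI_le hσ hH hH' hd hb hb']
    exact ENNReal.mul_ne_top ENNReal.ofReal_ne_top
      (ENNReal.pow_ne_top (L2K_gradSymb_deriv_ne_top hσ hH hH' hb hb'))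
  refine ne_top_of_le_ne_top (eLpNorm_ne_top_of_one_of_two hnm hp1 hp2 h1 h2)
    (eLpNorm_mono_enorm fun x => ?_)
  simpa using eLpNorm_IFT2_le hgm hgb x

/-! ### The Duhamel formula on the Fourier side -/

/-- The signed indicator of the oriented interval from `0` to `t`. -/
def duhKernel (t s : ℝ) : ℝ :=
  if 0 < s ∧ s ≤ t then 1 else if t < s ∧ s ≤ 0 then -1 else 0

lemma measurable_duhKernel : Measurable fun p : ℝ × ℝ => duhKernel p.1 p.2 := by
  unfold duhKernel
  refine Measurable.ite ?_ measurable_const (Measurable.ite ?_ measurable_const measurable_const)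
  · exact (measurableSet_lt measurable_const measurable_snd).inter
      (measurableSet_le measurable_snd measurable_fst)
  · exact (measurableSet_lt measurable_fst measurable_snd).inter
      (measurableSet_le measurable_snd measurable_const)

lemma abs_duhKernel_le (t s : ℝ) : |duhKernel t s| ≤ 1 := by
  unfold duhKernel; split_ifs <;> simp

lemma intervalIntegral_eq_duhKernel (f : ℝ → ℂ) (t : ℝ) :
    ∫ s in (0 : ℝ)..t, f s = ∫ s, (duhKernel t s : ℂ) * f s := by
  rcases le_total 0 t with h | h
  · rw [intervalIntegral.integral_of_le h, ← integral_indicator measurableSet_Ioc]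
    congr 1; ext s
    by_cases hs : 0 < s ∧ s ≤ t
    · rw [Set.indicator_of_mem (by exact hs)]; simp [duhKernel, hs]
    · have h2 : ¬ (t < s ∧ s ≤ 0) := fun h' => by linarith [h'.1, h'.2]
      rw [Set.indicator_of_notMem (by exact hs)]; simp [duhKernel, hs, h2]
  · rw [intervalIntegral.integral_of_ge h, ← integral_indicator measurableSet_Ioc, ← integral_neg]
    congr 1; ext s
    have h2 : ¬ (0 < s ∧ s ≤ t) := fun h' => by linarith [h'.1, h'.2]
    by_cases hs : t < s ∧ s ≤ 0
    · rw [Set.indicator_of_mem (by exact hs)]; simp only [duhKernel, hs, h2]; simp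
    · rw [Set.indicator_of_notMem (by exact hs)]; simp only [duhKernel, hs, h2]; simp

lemma freeGamma_eq (f : ℝ → ℝ → ℂ) (t : ℝ) :
    freeGamma f t = IFT2 fun ξ η => phase (t * (η ^ 2 - ξ ^ 2)) * FT2 f ξ η := by
  have e : ∀ ξ η : ℝ, cexp (I * (t : ℂ) * ((η : ℂ) ^ 2 - (ξ : ℂ) ^ 2)) =
      phase (t * (η ^ 2 - ξ ^ 2)) := fun ξ η => by
    unfold phase; congr 1; push_cast; ring
  ext x y
  unfold freeGamma
  simp_rw [e]

section Duhamel

variable {κ : ℝ → ℝ → ℝ} {h₀ : ℝ → ℝ → ℂ} {h : ℝ → ℝ → ℝ → ℂ} {D₀ D : ℝ}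

lemma FT2_duhHat (hκ : Measurable fun p : ℝ × ℝ => κ p.1 p.2) (hκ1 : ∀ t s, |κ t s| ≤ 1)
    (hg₀ : Measurable fun p : ℝ × ℝ => h₀ p.1 p.2)
    (hgb₀ : ∀ ξ η, ‖h₀ ξ η‖ ≤ D₀ * (rho ξ * rho η))
    (hg : Measurable fun p : ℝ × ℝ × ℝ => h p.1 p.2.1 p.2.2)
    (hgb : ∀ s ξ η, ‖h s ξ η‖ ≤ D * (rho s * (rho ξ * rho η))) (t x y : ℝ) :
    FT2 (duhHat κ h₀ h t) x y =
      FT2 (fun ξ η => phase (t * (η ^ 2 - ξ ^ 2)) * h₀ ξ η) x y +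
      I * ∫ s, (κ t s : ℂ) * FT2 (fun ξ η => phase ((t - s) * (η ^ 2 - ξ ^ 2)) * h s ξ η) x y := by
  have hm := measurable_duhHat hκ hg₀ hg
  have hgs : ∀ s, Measurable fun p : ℝ × ℝ => h s p.1 p.2 := fun s => by fun_prop
  have hκb : ∀ t s, ‖(κ t s : ℂ)‖ ≤ 1 := fun t s => by
    rw [Complex.norm_real]; exact hκ1 t s
  have hF : ∀ s, FT2 (fun ξ η => phase ((t - s) * (η ^ 2 - ξ ^ 2)) * h s ξ η) x y =
      ∫ p : ℝ × ℝ, phase (-(x * p.1 + y * p.2)) *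
        (phase ((t - s) * (p.2 ^ 2 - p.1 ^ 2)) * h s p.1 p.2) := fun s =>
    FT2_eq_integral (D := D * rho s) (by have := hgs s; fun_prop)
      (fun ξ η => by simpa [mul_assoc] using hgb s ξ η) x y
  have hi : Integrable fun q : ℝ × ℝ × ℝ => phase (-(x * q.2.1 + y * q.2.2)) *
      ((κ t q.1 : ℂ) * (phase ((t - q.1) * (q.2.2 ^ 2 - q.2.1 ^ 2)) * h q.1 q.2.1 q.2.2)) := by
    refine (integrable_rho_prod₃.const_mul D).mono' (Measurable.aestronglyMeasurable
      (by fun_prop)) (ae_of_all _ fun q => ?_)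
    rw [norm_mul, norm_phase, one_mul, norm_mul, norm_mul, norm_phase, one_mul]
    exact (mul_le_of_le_one_left (norm_nonneg _) (hκb t q.1)).trans (hgb q.1 q.2.1 q.2.2)
  have h1 : Integrable fun p : ℝ × ℝ => phase (-(x * p.1 + y * p.2)) *
      (phase (t * (p.2 ^ 2 - p.1 ^ 2)) * h₀ p.1 p.2) :=
    integrable_phase_mul (f := fun ξ η => phase (t * (η ^ 2 - ξ ^ 2)) * h₀ ξ η) (D := D₀)
      (by fun_prop) (fun ξ η => by simpa using hgb₀ ξ η) x y
  rw [FT2_eq_integral (D := D₀ + D * rhoMass) (by fun_prop) (norm_duhHat_le hκ1 hgb₀ hgb t) x y,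
    FT2_eq_integral (D := D₀) (by fun_prop) (fun ξ η => by simpa using hgb₀ ξ η) x y]
  simp_rw [hF]
  have e1 : ∀ p : ℝ × ℝ, phase (-(x * p.1 + y * p.2)) * duhHat κ h₀ h t p.1 p.2 =
      phase (-(x * p.1 + y * p.2)) * (phase (t * (p.2 ^ 2 - p.1 ^ 2)) * h₀ p.1 p.2) +
      I * ∫ s, phase (-(x * p.1 + y * p.2)) *
        ((κ t s : ℂ) * (phase ((t - s) * (p.2 ^ 2 - p.1 ^ 2)) * h s p.1 p.2)) := fun p => by
    rw [integral_const_mul]; unfold duhHat; ring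
  simp_rw [e1]
  have hi2 : Integrable fun p : ℝ × ℝ => ∫ s, phase (-(x * p.1 + y * p.2)) *
        ((κ t s : ℂ) * (phase ((t - s) * (p.2 ^ 2 - p.1 ^ 2)) * h s p.1 p.2)) :=
    hi.integral_prod_right
  rw [integral_add h1 (hi2.const_mul I), integral_const_mul]
  congr 2
  refine (integral_integral_swap (f := fun (s : ℝ) (p : ℝ × ℝ) => phase (-(x * p.1 + y * p.2)) *
    ((κ t s : ℂ) * (phase ((t - s) * (p.2 ^ 2 - p.1 ^ 2)) * h s p.1 p.2))) hi).symm.trans ?_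
  congr 1; ext s
  rw [← integral_const_mul]
  congr 1; ext p; ring

lemma IFT2_duhHat (hκ : Measurable fun p : ℝ × ℝ => κ p.1 p.2) (hκ1 : ∀ t s, |κ t s| ≤ 1)
    (hg₀ : Measurable fun p : ℝ × ℝ => h₀ p.1 p.2)
    (hgb₀ : ∀ ξ η, ‖h₀ ξ η‖ ≤ D₀ * (rho ξ * rho η))
    (hg : Measurable fun p : ℝ × ℝ × ℝ => h p.1 p.2.1 p.2.2)
    (hgb : ∀ s ξ η, ‖h s ξ η‖ ≤ D * (rho s * (rho ξ * rho η))) (t x y : ℝ) :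
    IFT2 (duhHat κ h₀ h t) x y =
      IFT2 (fun ξ η => phase (t * (η ^ 2 - ξ ^ 2)) * h₀ ξ η) x y +
      I * ∫ s, (κ t s : ℂ) *
        IFT2 (fun ξ η => phase ((t - s) * (η ^ 2 - ξ ^ 2)) * h s ξ η) x y := by
  simp_rw [IFT2_eq_FT2_neg]
  rw [FT2_duhHat hκ hκ1 hg₀ hgb₀ hg hgb, mul_add]
  congr 1
  rw [mul_left_comm, ← integral_const_mul]
  simp_rw [mul_left_comm]

lemma continuous_duhHat (hκ : Measurable fun p : ℝ × ℝ => κ p.1 p.2) (hκ1 : ∀ t s, |κ t s| ≤ 1)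
    (hg₀ : Continuous fun p : ℝ × ℝ => h₀ p.1 p.2)
    (hg : Continuous fun p : ℝ × ℝ × ℝ => h p.1 p.2.1 p.2.2)
    (hgb : ∀ s ξ η, ‖h s ξ η‖ ≤ D * (rho s * (rho ξ * rho η))) (t : ℝ) :
    Continuous fun p : ℝ × ℝ => duhHat κ h₀ h t p.1 p.2 := by
  have hgm := hg.measurable
  have hD : 0 ≤ D := by
    have := (norm_nonneg _).trans (hgb 0 0 0)
    exact nonneg_of_mul_nonneg_left this
      (mul_pos (rho_pos 0) (mul_pos (rho_pos 0) (rho_pos 0)))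
  have hph : Continuous phase := by unfold phase; fun_prop
  unfold duhHat
  refine (Continuous.mul (by fun_prop) hg₀).add (continuous_const.mul ?_)
  refine continuous_of_dominated (bound := fun s => D * rho s)
    (fun p => Measurable.aestronglyMeasurable (by fun_prop)) (fun p => ae_of_all _ fun s => ?_)
    (integrable_rho.const_mul D) (ae_of_all _ fun s => by fun_prop)
  rw [norm_mul, norm_mul, norm_phase, one_mul, Complex.norm_real, Real.norm_eq_abs]
  refine (mul_le_of_le_one_left (norm_nonneg _) (hκ1 t s)).trans ((hgb s p.1 p.2).trans ?_)
  have := rho_pos s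
  have := rho_pos p.1
  have := rho_le_one p.1
  have := rho_le_one p.2
  gcongr
  exact mul_le_of_le_one_right (rho_pos s).le (mul_le_one₀ (rho_le_one _) (rho_pos _).le
    (rho_le_one _))

lemma norm_FT2_duhHat_le (hκ : Measurable fun p : ℝ × ℝ => κ p.1 p.2) (hκ1 : ∀ t s, |κ t s| ≤ 1)
    (hg₀ : Measurable fun p : ℝ × ℝ => h₀ p.1 p.2)
    (hgb₀ : ∀ ξ η, ‖h₀ ξ η‖ ≤ D₀ * (rho ξ * rho η))
    (hg : Measurable fun p : ℝ × ℝ × ℝ => h p.1 p.2.1 p.2.2)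
    (hgb : ∀ s ξ η, ‖h s ξ η‖ ≤ D * (rho s * (rho ξ * rho η))) {t E₀ E : ℝ}
    (hE₀ : ∀ x y, ‖FT2 (fun ξ η => phase (t * (η ^ 2 - ξ ^ 2)) * h₀ ξ η) x y‖ ≤
      E₀ * (rho x * rho y))
    (hE : ∀ s x y, ‖FT2 (fun ξ η => phase ((t - s) * (η ^ 2 - ξ ^ 2)) * h s ξ η) x y‖ ≤
      E * (rho s * (rho x * rho y))) (x y : ℝ) :
    ‖FT2 (duhHat κ h₀ h t) x y‖ ≤ (E₀ + E * rhoMass) * (rho x * rho y) := by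
  rw [FT2_duhHat hκ hκ1 hg₀ hgb₀ hg hgb, add_mul]
  refine (norm_add_le _ _).trans (add_le_add (hE₀ x y) ?_)
  rw [norm_mul, Complex.norm_I, one_mul]
  refine (norm_integral_le_of_rho (D := E * (rho x * rho y)) fun s => ?_).trans_eq (by ring)
  rw [norm_mul, Complex.norm_real, Real.norm_eq_abs]
  refine (mul_le_of_le_one_left (norm_nonneg _) (hκ1 t s)).trans ((hE s x y).trans_eq (by ring))

lemma gradSymb_mul_duhHat (σ t ξ η : ℝ) :
    (gradSymb σ ξ η : ℂ) * duhHat κ h₀ h t ξ η =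
      duhHat κ (fun ξ η => (gradSymb σ ξ η : ℂ) * h₀ ξ η)
        (fun s ξ η => (gradSymb σ ξ η : ℂ) * h s ξ η) t ξ η := by
  unfold duhHat
  rw [mul_add, mul_left_comm, mul_left_comm _ I, ← integral_const_mul]
  congr 3
  ext s; ring

end Duhamel

lemma duhamelGamma_eq (Γ₀ : ℝ → ℝ → ℂ) (F : ℝ → ℝ → ℝ → ℂ) {D₀ D : ℝ}
    (hg₀ : Measurable fun p : ℝ × ℝ => FT2 Γ₀ p.1 p.2)
    (hgb₀ : ∀ ξ η, ‖FT2 Γ₀ ξ η‖ ≤ D₀ * (rho ξ * rho η))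
    (hg : Measurable fun p : ℝ × ℝ × ℝ => FT2 (F p.1) p.2.1 p.2.2)
    (hgb : ∀ s ξ η, ‖FT2 (F s) ξ η‖ ≤ D * (rho s * (rho ξ * rho η))) (t : ℝ) :
    duhamelGamma Γ₀ F t = IFT2 (duhHat duhKernel (FT2 Γ₀) (fun s => FT2 (F s)) t) := by
  ext x y
  rw [IFT2_duhHat measurable_duhKernel abs_duhKernel_le hg₀ hgb₀ hg hgb]
  unfold duhamelGamma
  rw [intervalIntegral_eq_duhKernel]
  simp_rw [freeGamma_eq]

/-! ### Application to Schwartz data -/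

lemma one_le_of_conj {l l' : ℝ≥0∞} (h : 1 / l + 1 / l' = 1) : 1 ≤ l' := by
  have : l'⁻¹ ≤ 1 := by
    rw [← h, one_div, one_div]; exact le_add_self
  exact ENNReal.inv_le_one.1 this

lemma le_two_of_conj {l l' : ℝ≥0∞} (hl : 2 ≤ l) (h : 1 / l + 1 / l' = 1) : l' ≤ 2 := by
  rw [one_div, one_div] at h
  have h1 : l⁻¹ ≤ 2⁻¹ := ENNReal.inv_le_inv.2 hl
  rw [← ENNReal.inv_le_inv]
  have h2 : (2 : ℝ≥0∞)⁻¹ + 2⁻¹ ≤ 2⁻¹ + l'⁻¹ := by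
    rw [ENNReal.inv_two_add_inv_two, ← h]; gcongr
  exact (ENNReal.add_le_add_iff_left (by simp)).1 h2

lemma MixedN3_le_mixN (q r : ℝ≥0∞) (u : ℝ → ℝ → ℝ → ℂ) :
    MixedN3 volume q r 2 u ≤ mixN q r fun t x => eLpNorm (u t x) 2 volume := by
  have e : ∀ a : ℝ≥0∞, ‖a.toReal‖ₑ ≤ a := fun a => by
    rw [← ofReal_norm, Real.norm_of_nonneg ENNReal.toReal_nonneg]; exact ENNReal.ofReal_toReal_le
  refine eLpNorm_mono_enorm fun t => (e _).trans ?_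
  refine eLpNorm_mono_enorm fun x => (e _).trans le_rfl

lemma mixN_le_MixedN3 {q r : ℝ≥0∞} {u : ℝ → ℝ → ℝ → ℂ}
    (h1 : ∀ t x, eLpNorm (u t x) 2 volume ≠ ∞)
    (h2 : ∀ t, eLpNorm (fun x => eLpNorm (u t x) 2 volume) r volume ≠ ∞) :
    (mixN q r fun t x => eLpNorm (u t x) 2 volume) ≤ MixedN3 volume q r 2 u := by
  have e : ∀ a : ℝ≥0∞, a ≠ ∞ → ‖a.toReal‖ₑ = a := fun a ha => by
    rw [← ofReal_norm, Real.norm_of_nonneg ENNReal.toReal_nonneg, ENNReal.ofReal_toReal ha]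
  have h3 : ∀ t, eLpNorm (fun x => (eLpNorm (u t x) 2 volume).toReal) r volume =
      eLpNorm (fun x => eLpNorm (u t x) 2 volume) r volume := fun t =>
    eLpNorm_congr_enorm_ae (ae_of_all _ fun x => by rw [e _ (h1 t x), enorm_eq_self])
  refine eLpNorm_mono_enorm fun t => ?_
  rw [h3, e _ (h2 t), enorm_eq_self]

lemma measurable_FT2 {f : ℝ → ℝ → ℂ} (hf : Measurable fun p : ℝ × ℝ => f p.1 p.2) :
    Measurable fun p : ℝ × ℝ => FT2 f p.1 p.2 := by
  unfold FT2; simp_rw [cexp_neg_eq_phase]; fun_prop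

section Schwartz

variable (Γ₀ : 𝓢(ℝ × ℝ, ℂ)) (F : 𝓢(ℝ × ℝ × ℝ, ℂ))

lemma absDxy_eq (σ : ℝ) (f : ℝ → ℝ → ℂ) :
    absDxy σ f = IFT2 fun ξ η => (gradSymb σ ξ η : ℂ) * FT2 f ξ η := rfl

lemma gradSymb_zero (ξ η : ℝ) : gradSymb 0 ξ η = 1 := by simp [gradSymb]

lemma SchwartzMap.isRapidClass_fourier_two (t : ℝ) :
    IsRapidClass (fun _ => 1) (fun _ => t) ((fun a s => FT2 (a s)) ''
      Set.range fun (G : 𝓢(ℝ × ℝ, ℂ)) (_ : ℝ) x y => G (x, y)) :=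
  (isRapidClass_two t).fourier (fun _ => zero_le_one) fun _ => le_rfl

lemma SchwartzMap.isRapidClass_fourier_three (t : ℝ) :
    IsRapidClass rho (fun s => t - s) ((fun a s => FT2 (a s)) ''
      Set.range fun (G : 𝓢(ℝ × ℝ × ℝ, ℂ)) s x y => G (s, x, y)) :=
  (isRapidClass_three t).fourier (fun s => (rho_pos s).le) rho_le_one

lemma SchwartzMap.mem_fourier_two :
    (fun _ : ℝ => FT2 fun a b => Γ₀ (a, b)) ∈ ((fun a s => FT2 (a s)) ''
      Set.range fun (G : 𝓢(ℝ × ℝ, ℂ)) (_ : ℝ) x y => G (x, y)) := ⟨_, ⟨Γ₀, rfl⟩, rfl⟩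

lemma SchwartzMap.mem_fourier_three :
    (fun s : ℝ => FT2 fun a b => F (s, a, b)) ∈ ((fun a s => FT2 (a s)) ''
      Set.range fun (G : 𝓢(ℝ × ℝ × ℝ, ℂ)) s x y => G (s, x, y)) := ⟨_, ⟨F, rfl⟩, rfl⟩

lemma SchwartzMap.continuous_FT2 :
    Continuous fun p : ℝ × ℝ => FT2 (fun a b => Γ₀ (a, b)) p.1 p.2 := by
  have h : Continuous fun p : ℝ × ℝ × ℝ => FT2 (fun a b => Γ₀ (a, b)) p.2.1 p.2.2 :=
    (isRapidClass_fourier_two 0).cont _ Γ₀.mem_fourier_two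
  have hi : Continuous fun p : ℝ × ℝ => ((0 : ℝ), p) := by fun_prop
  have := h.comp hi
  exact this

lemma SchwartzMap.continuous_FT2_slice :
    Continuous fun p : ℝ × ℝ × ℝ => FT2 (fun a b => F (p.1, a, b)) p.2.1 p.2.2 :=
  (isRapidClass_fourier_three 0).cont _ F.mem_fourier_three

lemma SchwartzMap.measurable_FT2_slice (s : ℝ) :
    Measurable fun p : ℝ × ℝ => FT2 (fun a b => F (s, a, b)) p.1 p.2 := by
  have hi : Continuous fun p : ℝ × ℝ => (s, p) := by fun_prop
  exact (F.continuous_FT2_slice.comp hi).measurable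

lemma SchwartzMap.FT2_decay (m : ℕ) : ∃ C, ∀ ξ η : ℝ,
    ((1 + ξ ^ 2) * (1 + η ^ 2)) ^ m * ‖FT2 (fun a b => Γ₀ (a, b)) ξ η‖ ≤ C := by
  obtain ⟨C, hC⟩ := (isRapidClass_fourier_two 0).decay Γ₀.mem_fourier_two m
  exact ⟨C, fun ξ η => by simpa using hC 0 ξ η⟩

lemma SchwartzMap.FT2_slice_decay (m : ℕ) : ∃ C, ∀ s ξ η : ℝ,
    ((1 + ξ ^ 2) * (1 + η ^ 2)) ^ m * ‖FT2 (fun a b => F (s, a, b)) ξ η‖ ≤ C * rho s :=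
  (isRapidClass_fourier_three 0).decay F.mem_fourier_three m

lemma SchwartzMap.FT2_rho_bound : ∃ C, ∀ ξ η : ℝ,
    ‖FT2 (fun a b => Γ₀ (a, b)) ξ η‖ ≤ C * (rho ξ * rho η) := by
  obtain ⟨C, hC⟩ := (isRapidClass_fourier_two 0).rho_bound Γ₀.mem_fourier_two
  exact ⟨C, fun ξ η => by simpa using hC 0 ξ η⟩

lemma SchwartzMap.FT2_slice_rho_bound : ∃ C, ∀ s ξ η : ℝ,
    ‖FT2 (fun a b => F (s, a, b)) ξ η‖ ≤ C * (rho s * (rho ξ * rho η)) :=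
  (isRapidClass_fourier_three 0).rho_bound F.mem_fourier_three

lemma SchwartzMap.FT2_phase_rho_bound (t : ℝ) : ∃ C, ∀ x y : ℝ,
    ‖FT2 (fun ξ η => phase (t * (η ^ 2 - ξ ^ 2)) * FT2 (fun a b => Γ₀ (a, b)) ξ η) x y‖ ≤
      C * (rho x * rho y) := by
  obtain ⟨C, hC⟩ := (((isRapidClass_fourier_two t).phase_mul continuous_const).fourier
    (fun _ => zero_le_one) fun _ => le_rfl).rho_bound ⟨_, ⟨_, Γ₀.mem_fourier_two, rfl⟩, rfl⟩
  exact ⟨C, fun ξ η => by simpa using hC 0 ξ η⟩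

lemma SchwartzMap.FT2_phase_slice_rho_bound (t : ℝ) : ∃ C, ∀ s x y : ℝ,
    ‖FT2 (fun ξ η => phase ((t - s) * (η ^ 2 - ξ ^ 2)) * FT2 (fun a b => F (s, a, b)) ξ η) x y‖ ≤
      C * (rho s * (rho x * rho y)) :=
  (((isRapidClass_fourier_three t).phase_mul (by fun_prop)).fourier
    (fun s => (rho_pos s).le) rho_le_one).rho_bound ⟨_, ⟨_, F.mem_fourier_three, rfl⟩, rfl⟩

lemma SchwartzMap.IFT2_FT2_eq : (IFT2 (FT2 fun a b => Γ₀ (a, b))) = fun a b => Γ₀ (a, b) := by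
  obtain ⟨D', hD'⟩ := Γ₀.FT2_rho_bound
  obtain ⟨D, hD⟩ := (isRapidClass_two 0).rho_bound ⟨Γ₀, rfl⟩
  ext x y
  exact IFT2_FT2 (f := fun a b => Γ₀ (a, b)) (D := D) Γ₀.continuous
    (fun x y => by simpa using hD 0 x y) Γ₀.continuous_FT2.measurable hD' x y

lemma SchwartzMap.IFT2_FT2_slice (s : ℝ) :
    (IFT2 (FT2 fun a b => F (s, a, b))) = fun a b => F (s, a, b) := by
  obtain ⟨D', hD'⟩ := F.FT2_slice_rho_bound
  obtain ⟨D, hD⟩ := (isRapidClass_three 0).rho_bound ⟨F, rfl⟩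
  have hi : Continuous fun p : ℝ × ℝ => (s, p) := by fun_prop
  ext x y
  exact IFT2_FT2 (f := fun a b => F (s, a, b)) (D := D * rho s) (D' := D' * rho s)
    (F.continuous.comp hi) (fun x y => by simpa [mul_assoc] using hD s x y)
    (F.measurable_FT2_slice s)
    (fun x y => by simpa [mul_assoc] using hD' s x y) x y

lemma duhamelGamma_schwartz (t : ℝ) :
    duhamelGamma (fun a b => Γ₀ (a, b)) (fun s a b => F (s, a, b)) t =
      IFT2 (duhHat duhKernel (FT2 fun a b => Γ₀ (a, b)) (fun s => FT2 fun a b => F (s, a, b)) t) := by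
  obtain ⟨D₀, hD₀⟩ := Γ₀.FT2_rho_bound
  obtain ⟨D, hD⟩ := F.FT2_slice_rho_bound
  exact duhamelGamma_eq _ _ Γ₀.continuous_FT2.measurable hD₀ F.continuous_FT2_slice.measurable hD t

lemma absDxy_duhamelGamma (σ t : ℝ) :
    absDxy σ (duhamelGamma (fun a b => Γ₀ (a, b)) (fun s a b => F (s, a, b)) t) =
      IFT2 (duhHat duhKernel (fun ξ η => (gradSymb σ ξ η : ℂ) * FT2 (fun a b => Γ₀ (a, b)) ξ η)
        (fun s ξ η => (gradSymb σ ξ η : ℂ) * FT2 (fun a b => F (s, a, b)) ξ η) t) := by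
  obtain ⟨D₀, hD₀⟩ := Γ₀.FT2_rho_bound
  obtain ⟨D, hD⟩ := F.FT2_slice_rho_bound
  obtain ⟨E₀, hE₀⟩ := Γ₀.FT2_phase_rho_bound t
  obtain ⟨E, hE⟩ := F.FT2_phase_slice_rho_bound t
  have hc₀ := Γ₀.continuous_FT2
  have hc := F.continuous_FT2_slice
  rw [absDxy_eq, duhamelGamma_schwartz]
  congr 1
  ext ξ η
  have hct := continuous_duhHat measurable_duhKernel abs_duhKernel_le hc₀ hc hD t
  have hb := norm_duhHat_le abs_duhKernel_le hD₀ hD t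
  rw [FT2_IFT2 hct hb (measurable_FT2 hct.measurable)
    (norm_FT2_duhHat_le measurable_duhKernel abs_duhKernel_le hc₀.measurable hD₀ hc.measurable hD
      hE₀ hE), gradSymb_mul_duhHat]

lemma mixN_absDxy_slice_le {σ : ℝ} (hσ : 0 ≤ σ) (q : ℝ≥0∞) {r : ℝ≥0∞} (hr1 : 1 ≤ r)
    (hr2 : r ≤ 2) :
    (mixN q r fun s x => eLpNorm (absDxy σ (fun a b => F (s, a, b)) x) 2 volume) ≤
      MixedN3 volume q r 2 (fun s x y => absDxy σ (fun a b => F (s, a, b)) x y) := by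
  obtain ⟨C, hC⟩ := F.FT2_slice_decay (⌈σ⌉₊ + 1)
  obtain ⟨H', hH', hd⟩ := (isRapidClass_fourier_three 0).derivFst _ F.mem_fourier_three
  obtain ⟨C', hC'⟩ := (isRapidClass_fourier_three 0).decay hH' (⌈σ⌉₊ + 1)
  have hm := F.continuous_FT2_slice.measurable
  have hm' := ((isRapidClass_fourier_three 0).cont _ hH').measurable
  have hms := F.measurable_FT2_slice
  refine mixN_le_MixedN3 (fun s x => ?_) fun s => ?_
  · have hb : ∀ ξ η, ‖(gradSymb σ ξ η : ℂ) * FT2 (fun a b => F (s, a, b)) ξ η‖ ≤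
        C * rho s * (rho ξ * rho η) := fun ξ η => norm_gradSymb_mul_le hσ (hC s ξ η)
    have hmg : Measurable fun p : ℝ × ℝ =>
        (gradSymb σ p.1 p.2 : ℂ) * FT2 (fun a b => F (s, a, b)) p.1 p.2 := by
      have := hms s
      fun_prop
    refine ne_top_of_le_ne_top ?_ (eLpNorm_IFT2_le hmg hb x)
    refine nTwo_ne_top_of_rho (D := C * rho s * rhoMass) fun η => ?_
    refine (norm_integral_le_of_rho (D := C * rho s * rho η) fun ξ => ?_).trans_eq (by ring)
    rw [norm_mul, norm_phase, one_mul]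
    exact (hb ξ η).trans_eq (by ring)
  · exact eLpNorm_IFT2_gradSymb_ne_top hσ (hms s) (H' := H' s) (by fun_prop) (hd s) (hC s) (hC' s)
      hr1 hr2

lemma MixedN3_absDxy_duhamelGamma_le {k l kt lt kt' lt' : ℝ≥0∞} (hk : 2 < k) (hl : 2 ≤ l)
    (hadm : 2 / k + 1 / l = 1 / 2) (hkt : 2 < kt) (hlt : 2 ≤ lt)
    (hadmt : 2 / kt + 1 / lt = 1 / 2) (hconjk : 1 / kt + 1 / kt' = 1)
    (hconjl : 1 / lt + 1 / lt' = 1) {σ : ℝ} (hσ : 0 ≤ σ) :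
    MixedN3 volume k l 2 (fun t x y => absDxy σ
        (duhamelGamma (fun a b => Γ₀ (a, b)) (fun s a b => F (s, a, b)) t) x y) ≤
      2401 * (L2K (absDxy σ (fun a b => Γ₀ (a, b))) +
        MixedN3 volume kt' lt' 2 (fun s x y => absDxy σ (fun a b => F (s, a, b)) x y)) := by
  obtain ⟨C₀, hC₀⟩ := Γ₀.FT2_decay (⌈σ⌉₊ + 1)
  obtain ⟨C, hC⟩ := F.FT2_slice_decay (⌈σ⌉₊ + 1)
  have hm₀ := Γ₀.continuous_FT2.measurable
  have hm := F.continuous_FT2_slice.measurable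
  refine (MixedN3_le_mixN _ _ _).trans ?_
  simp_rw [absDxy_duhamelGamma]
  refine (mixN_IFT2_duhHat_le hk hl hadm hkt hlt hadmt hconjk hconjl measurable_duhKernel
    abs_duhKernel_le (D₀ := C₀) (D := C) (by fun_prop)
    (fun ξ η => norm_gradSymb_mul_le hσ (hC₀ ξ η)) (by fun_prop)
    (fun s ξ η => (norm_gradSymb_mul_le hσ (hC s ξ η)).trans_eq (by ring))).trans ?_
  gcongr
  · rfl
  · exact mixN_absDxy_slice_le F hσ kt' (one_le_of_conj hconjl) (le_two_of_conj hlt hconjl)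

lemma absDxy_zero_schwartz : absDxy 0 (fun a b => Γ₀ (a, b)) = fun a b => Γ₀ (a, b) := by
  simpa [absDxy_eq, gradSymb_zero] using Γ₀.IFT2_FT2_eq

lemma absDxy_zero_slice (s : ℝ) : absDxy 0 (fun a b => F (s, a, b)) = fun a b => F (s, a, b) := by
  simpa [absDxy_eq, gradSymb_zero] using F.IFT2_FT2_slice s

lemma absDxy_zero_duhamelGamma (t : ℝ) :
    absDxy 0 (duhamelGamma (fun a b => Γ₀ (a, b)) (fun s a b => F (s, a, b)) t) =
      duhamelGamma (fun a b => Γ₀ (a, b)) (fun s a b => F (s, a, b)) t := by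
  rw [absDxy_duhamelGamma, duhamelGamma_schwartz]
  simp [gradSymb_zero]

end Schwartz

/-- Inhomogeneous Strichartz estimate for the von-Neumann Schrödinger equation. -/
theorem inhomogeneous_strichartz_vonNeumann (k l kt lt kt' lt' : ℝ≥0∞)
    (hk : 2 < k) (hl : 2 ≤ l) (hadm : 2 / k + 1 / l = 1 / 2)
    (hkt : 2 < kt) (hlt : 2 ≤ lt) (hadmt : 2 / kt + 1 / lt = 1 / 2)
    (hconjk : 1 / kt + 1 / kt' = 1) (hconjl : 1 / lt + 1 / lt' = 1) :
    ∃ C : ℝ, 0 < C ∧ ∀ Γ₀ : 𝓢(ℝ × ℝ, ℂ), ∀ F : 𝓢(ℝ × ℝ × ℝ, ℂ),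
      (MixedN3 volume k l 2
          (duhamelGamma (fun a b => Γ₀ (a, b)) (fun s a b => F (s, a, b)))
        ≤ ENNReal.ofReal C *
            (L2K (fun a b => Γ₀ (a, b)) +
              MixedN3 volume kt' lt' 2 (fun s a b => F (s, a, b)))) ∧
      ∀ σ : ℝ, 0 ≤ σ →
        MixedN3 volume k l 2
            (fun t x y => absDxy σ
              (duhamelGamma (fun a b => Γ₀ (a, b)) (fun s a b => F (s, a, b)) t) x y)
          ≤ ENNReal.ofReal C *
              (L2K (absDxy σ (fun a b => Γ₀ (a, b))) +
                MixedN3 volume kt' lt' 2 (fun s x y => absDxy σ (fun a b => F (s, a, b)) x y)) := by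
  refine ⟨2401, by norm_num, fun Γ₀ F => ?_⟩
  rw [ENNReal.ofReal_ofNat]
  have key := fun σ (hσ : (0 : ℝ) ≤ σ) => MixedN3_absDxy_duhamelGamma_le Γ₀ F hk hl hadm hkt hlt
    hadmt hconjk hconjl hσ
  refine ⟨?_, key⟩
  have := key 0 le_rfl
  simp_rw [absDxy_zero_duhamelGamma, absDxy_zero_schwartz, absDxy_zero_slice] at this
  exact this

end
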